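/- arXiv:2205.10817 — 3 statements merged into one kernel-verified Lean document; each statement's English description precedes it below -/
import Mathlib

section
/- Let n = 2m ≥ 4 be an even integer and c_n = 2^{n-2}((n-2)/2)! π^{n/2}. Let u : ℝⁿ → ℝ be smooth with (-Δ)^m u = 2 Q e^{nu}, f := Q e^{nu} ∈ L¹(ℝⁿ), and suppose that for every δ > 0 there is R_δ such that Q(x) ≥ e^{-δ|x|²} for |x| ≥ R_δ, and that ∫₀^∞ e^{u(rθ)} dr = +∞ for every unit vector θ. Then α := (1/c_n)∫_{ℝⁿ} Q(y) e^{nu(y)} dy ≤ 1; equivalently, ∫_{ℝⁿ} Q e^{nu} dx ≤ c_n. -/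
open MeasureTheory Real Filter Metric
open scoped ENNReal Topology

/-- The constant `c_n = 2^(n-2) * ((n-2)/2)! * pi^(n/2)`. -/
noncomputable def cconst (n : ℕ) : ℝ :=
  2 ^ (n - 2) * (Nat.factorial ((n - 2) / 2)) * Real.pi ^ (n / 2)

/-- The logarithmic potential `v x = (1/c_n) * ∫ log (|x-y|/|y|) f y dy`. -/
noncomputable def logPot (n : ℕ) (f : EuclideanSpace ℝ (Fin n) → ℝ)
    (x : EuclideanSpace ℝ (Fin n)) : ℝ :=
  (1 / cconst n) * ∫ y, Real.log (‖x - y‖ / ‖y‖) * f y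

/-- The Laplacian of `f : ℝ^n → ℝ`, as the trace of the second derivative. -/
noncomputable def laplacian {n : ℕ} (f : EuclideanSpace ℝ (Fin n) → ℝ)
    (x : EuclideanSpace ℝ (Fin n)) : ℝ :=
  ∑ i, iteratedFDeriv ℝ 2 f x ![EuclideanSpace.single i 1, EuclideanSpace.single i 1]

/-- The m-th iterate `(-Δ)^m` of the negative Laplacian. -/
noncomputable def negLapIter {n : ℕ} (m : ℕ) (f : EuclideanSpace ℝ (Fin n) → ℝ) :
    EuclideanSpace ℝ (Fin n) → ℝ :=
  (fun (g : EuclideanSpace ℝ (Fin n) → ℝ) x => -laplacian g x)^[m] f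

abbrev Eu (n : ℕ) := EuclideanSpace ℝ (Fin n)

/-- Partial derivative. -/
noncomputable def pd {n : ℕ} (i : Fin n) (w : Eu n → ℝ) : Eu n → ℝ :=
  fun x => fderiv ℝ w x (EuclideanSpace.single i 1)

lemma pd_smooth {n : ℕ} (i : Fin n) {w : Eu n → ℝ} (hw : ContDiff ℝ (⊤ : ℕ∞) w) :
    ContDiff ℝ (⊤ : ℕ∞) (pd i w) := by
  unfold pd
  have h : ContDiff ℝ (⊤ : ℕ∞) (fderiv ℝ w) := hw.fderiv_right (by exact_mod_cast le_top)
  exact h.clm_apply contDiff_const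

lemma pd_continuous {n : ℕ} (i : Fin n) {w : Eu n → ℝ} (hw : ContDiff ℝ 1 w) :
    Continuous (pd i w) := by
  unfold pd
  exact (hw.continuous_fderiv (by simp)).clm_apply continuous_const

lemma laplacian_eq {n : ℕ} {w : Eu n → ℝ} (hw : ContDiff ℝ (⊤ : ℕ∞) w) (x : Eu n) :
    laplacian w x = ∑ i, pd i (pd i w) x := by
  unfold laplacian
  refine Finset.sum_congr rfl fun i _ => ?_
  rw [iteratedFDeriv_two_apply]
  have h : ContDiff ℝ (⊤ : ℕ∞) (fderiv ℝ w) := hw.fderiv_right (by exact_mod_cast le_top)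
  have hd : DifferentiableAt ℝ (fderiv ℝ w) x := (h.differentiable (by simp)) x
  unfold pd
  rw [fderiv_clm_apply hd (differentiableAt_const _)]
  simp

lemma laplacian_smooth {n : ℕ} {w : Eu n → ℝ} (hw : ContDiff ℝ (⊤ : ℕ∞) w) :
    ContDiff ℝ (⊤ : ℕ∞) (laplacian w) := by
  have : laplacian w = fun x => ∑ i, pd i (pd i w) x := funext (laplacian_eq hw)
  rw [this]
  exact ContDiff.sum fun i _ => pd_smooth i (pd_smooth i hw)

lemma negLap_smooth {n : ℕ} (k : ℕ) {w : Eu n → ℝ} (hw : ContDiff ℝ (⊤ : ℕ∞) w) :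
    ContDiff ℝ (⊤ : ℕ∞) (negLapIter k w) := by
  unfold negLapIter
  induction k generalizing w with
  | zero => simpa using hw
  | succ k ih =>
    rw [Function.iterate_succ_apply]
    exact ih (laplacian_smooth hw).neg

lemma negLapIter_succ {n : ℕ} (k : ℕ) (w : Eu n → ℝ) :
    negLapIter (k + 1) w = negLapIter k (fun x => -laplacian w x) := by
  unfold negLapIter
  rw [Function.iterate_succ_apply]

lemma negLapIter_succ' {n : ℕ} (k : ℕ) (w : Eu n → ℝ) :
    negLapIter (k + 1) w = (fun x => -laplacian (negLapIter k w) x) := by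
  unfold negLapIter
  rw [Function.iterate_succ_apply']

lemma cpt_integrable {n : ℕ} {φ w : Eu n → ℝ} (hφ : Continuous φ) (hc : HasCompactSupport φ)
    (hw : Continuous w) : Integrable (fun y => φ y * w y) :=
  (hφ.mul hw).integrable_of_hasCompactSupport hc.mul_right

lemma ibp {n : ℕ} (i : Fin n) {φ w : Eu n → ℝ} (hφ : ContDiff ℝ 1 φ) (hc : HasCompactSupport φ)
    (hw : ContDiff ℝ 1 w) (x : Eu n) (s : ℝ) :
    ∫ y, pd i φ y * w (x + s • y) = - s * ∫ y, φ y * pd i w (x + s • y) := by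
  have hW : ContDiff ℝ 1 (fun y : Eu n => w (x + s • y)) := by fun_prop
  have hfd : ∀ y : Eu n, fderiv ℝ (fun y : Eu n => w (x + s • y)) y (EuclideanSpace.single i 1)
      = s * pd i w (x + s • y) := by
    intro y
    have h1 : HasFDerivAt (fun y : Eu n => x + s • y) (s • ContinuousLinearMap.id ℝ (Eu n)) y :=
      ((hasFDerivAt_id y).const_smul s).const_add x
    have h2 := ((hw.differentiable (by simp)) (x + s • y)).hasFDerivAt.comp y h1
    have h3 := h2.fderiv
    rw [show (fun y : Eu n => w (x + s • y)) = w ∘ (fun y : Eu n => x + s • y) from rfl, h3]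
    simp [pd]
  have hcd : HasCompactSupport (fun y => fderiv ℝ φ y (EuclideanSpace.single i 1)) :=
    hc.fderiv_apply ℝ _
  have key := integral_mul_fderiv_eq_neg_fderiv_mul_of_integrable (μ := volume) (f := φ)
    (g := fun y : Eu n => w (x + s • y)) (v := EuclideanSpace.single i 1)
    (cpt_integrable (pd_continuous i hφ) hcd hW.continuous)
    (cpt_integrable hφ.continuous hc (pd_continuous i hW))
    (cpt_integrable hφ.continuous hc hW.continuous)
    (fun y _ => hφ.differentiable (by simp) y) (fun y _ => hW.differentiable (by simp) y)
  simp only [hfd] at key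
  have e : ∫ y, pd i φ y * w (x + s • y) = - ∫ y, φ y * (s * pd i w (x + s • y)) := by
    rw [key]; simp [pd]
  rw [e, ← integral_const_mul, ← integral_neg]
  congr 1; ext y; ring

lemma param_cont {n : ℕ} {X : Type*} [TopologicalSpace X]
    {φ : Eu n → ℝ} {w : X → Eu n → ℝ} (hφ : Continuous φ) (hc : HasCompactSupport φ)
    (hw : Continuous (Function.uncurry w)) :
    Continuous (fun p => ∫ y, φ y * w p y) := by
  rw [← continuousOn_univ]
  refine continuousOn_integral_of_compact_support (k := tsupport φ) hc ?_ ?_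
  · apply Continuous.continuousOn
    exact (hφ.comp continuous_snd).mul hw
  · intro p y _ hy
    rw [image_eq_zero_of_notMem_tsupport hy, zero_mul]

lemma param_deriv {n : ℕ} {φ w : Eu n → ℝ} (hφ : Continuous φ) (hc : HasCompactSupport φ)
    (hw : ContDiff ℝ 1 w) (x : Eu n) (s : ℝ) :
    HasDerivAt (fun s : ℝ => ∫ y, φ y * w (x + s • y)) (∫ y, φ y * fderiv ℝ w (x + s • y) y) s := by
  have hcf : Continuous (fun p : ℝ × Eu n => φ p.2 * fderiv ℝ w (x + p.1 • p.2) p.2) := by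
    have h1 : Continuous (fderiv ℝ w) := hw.continuous_fderiv (by simp)
    have : Continuous (fun p : ℝ × Eu n => fderiv ℝ w (x + p.1 • p.2) p.2) :=
      (h1.comp (by fun_prop)).clm_apply continuous_snd
    exact (hφ.comp continuous_snd).mul this
  obtain ⟨C, hC⟩ := ((isCompact_Icc (a := s - 1) (b := s + 1)).prod hc).exists_bound_of_continuousOn
    hcf.continuousOn
  have hb : Integrable (Set.indicator (tsupport φ) (fun _ => C)) := by
    rw [integrable_indicator_iff (isClosed_tsupport φ).measurableSet]
    exact integrableOn_const (IsCompact.measure_ne_top hc)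
  refine (hasDerivAt_integral_of_dominated_loc_of_deriv_le (s := Set.Icc (s - 1) (s + 1))
    (bound := Set.indicator (tsupport φ) (fun _ => C))
    (F' := fun s y => φ y * fderiv ℝ w (x + s • y) y) (Icc_mem_nhds (by linarith) (by linarith))
    ?_ ?_ ?_ ?_ hb ?_).2
  · refine Eventually.of_forall fun t => ?_
    exact (hφ.mul (hw.continuous.comp (by fun_prop))).aestronglyMeasurable
  · exact cpt_integrable hφ hc (hw.continuous.comp (by fun_prop))
  · exact (hcf.comp (by fun_prop : Continuous fun y : Eu n => (s, y))).aestronglyMeasurable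
  · refine Eventually.of_forall fun y t ht => ?_
    by_cases hy : y ∈ tsupport φ
    · rw [Set.indicator_of_mem hy]
      exact hC (t, y) ⟨ht, hy⟩
    · rw [Set.indicator_of_notMem hy, image_eq_zero_of_notMem_tsupport hy]; simp
  · refine Eventually.of_forall fun y t _ => ?_
    apply HasDerivAt.const_mul
    have h1 : HasDerivAt (fun t : ℝ => x + t • y) y t := by
      simpa using ((hasDerivAt_id t).smul_const y).const_add x
    exact ((hw.differentiable (by simp)) (x + t • y)).hasFDerivAt.comp_hasDerivAt t h1

/-- radial functions -/
lemma radial_hasCompactSupport {n : ℕ} {G : ℝ → ℝ} {ρ : ℝ} (hG : ∀ s, ρ ≤ s → G s = 0) :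
    HasCompactSupport (fun y : Eu n => G (‖y‖ ^ 2)) := by
  refine HasCompactSupport.of_support_subset_isCompact (isCompact_closedBall 0 (√ρ)) ?_
  intro y hy
  by_contra h
  apply hy
  simp only [mem_closedBall, dist_zero_right, not_le] at h
  apply hG
  exact (Real.lt_sq_of_sqrt_lt h).le

lemma radial_contDiff {n : ℕ} {G : ℝ → ℝ} {k : WithTop ℕ∞} (hG : ContDiff ℝ k G) :
    ContDiff ℝ k (fun y : Eu n => G (‖y‖ ^ 2)) :=
  hG.comp (contDiff_norm_sq ℝ)

lemma radial_pd {n : ℕ} {G : ℝ → ℝ} (hG : ContDiff ℝ 1 G) (i : Fin n) (y : Eu n) :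
    pd i (fun y : Eu n => G (‖y‖ ^ 2)) y = 2 * deriv G (‖y‖ ^ 2) * y i := by
  have h1 : HasDerivAt G (deriv G (‖y‖ ^ 2)) (‖y‖ ^ 2) :=
    ((hG.differentiable (by simp)) _).hasDerivAt
  have h2 := h1.comp_hasFDerivAt y (hasStrictFDerivAt_norm_sq y).hasFDerivAt
  unfold pd
  have h3 := h2.fderiv
  rw [show (fun y : Eu n => G (‖y‖ ^ 2)) = G ∘ (fun y : Eu n => ‖y‖ ^ 2) from rfl, h3]
  simp [EuclideanSpace.inner_single_right]
  ring

lemma fderiv_eq_sum {n : ℕ} (w : Eu n → ℝ) (z y : Eu n) :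
    fderiv ℝ w z y = ∑ i, y i * pd i w z := by
  have hy : y = ∑ i, y i • EuclideanSpace.single i (1:ℝ) := by
    have := (EuclideanSpace.basisFun (Fin n) ℝ).sum_repr y
    simpa using this.symm
  conv_lhs => rw [hy]
  simp [pd]

/-- Lemma A. -/
lemma lemA {n : ℕ} {G : ℝ → ℝ} {ρ : ℝ} (hG : ContDiff ℝ 1 G) (hGz : ∀ s, ρ ≤ s → G s = 0)
    (hGz' : ∀ s, ρ ≤ s → deriv G s = 0)
    {w : Eu n → ℝ} (hw : ContDiff ℝ (⊤ : ℕ∞) w) (x : Eu n) (s : ℝ) :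
    HasDerivAt (fun s : ℝ => ∫ y, (-2 * deriv G (‖y‖ ^ 2)) * w (x + s • y))
      (s * ∫ y, G (‖y‖ ^ 2) * laplacian w (x + s • y)) s := by
  have hcφ : HasCompactSupport (fun y : Eu n => G (‖y‖ ^ 2)) := radial_hasCompactSupport hGz
  have hφ : ContDiff ℝ 1 (fun y : Eu n => G (‖y‖ ^ 2)) := radial_contDiff hG
  have hdG : Continuous (deriv G) := hG.continuous_deriv (by simp)
  have hw1 : ContDiff ℝ 1 w := hw.of_le (by exact_mod_cast le_top)
  have h := param_deriv (n := n) (φ := fun y => -2 * deriv G (‖y‖ ^ 2)) (w := w)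
    (by fun_prop) (radial_hasCompactSupport (G := fun s => -2 * deriv G s) (ρ := ρ)
      (fun s hs => by simp [hGz' s hs])) hw1 x s
  convert h using 1
  have e1 : ∀ y : Eu n, (-2 * deriv G (‖y‖ ^ 2)) * fderiv ℝ w (x + s • y) y
      = ∑ i, - (pd i (fun y : Eu n => G (‖y‖ ^ 2)) y * pd i w (x + s • y)) := by
    intro y
    rw [fderiv_eq_sum, Finset.mul_sum]
    refine Finset.sum_congr rfl fun i _ => ?_
    rw [radial_pd hG]; ring
  simp only [e1]
  have hpdw : ∀ i : Fin n, ContDiff ℝ 1 (pd i w) := fun i =>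
    (pd_smooth i hw).of_le (by exact_mod_cast le_top)
  rw [integral_finsetSum]
  swap
  · intro i _
    refine Integrable.neg ?_
    refine cpt_integrable (pd_continuous i hφ) (hcφ.fderiv_apply ℝ _) ?_
    exact (hpdw i).continuous.comp (by fun_prop)
  simp only [laplacian_eq hw, Finset.mul_sum]
  rw [integral_finsetSum]
  swap
  · intro i _
    refine cpt_integrable hφ.continuous hcφ ?_
    exact (pd_continuous i (hpdw i)).comp (by fun_prop)
  rw [Finset.mul_sum]
  refine Finset.sum_congr rfl fun i _ => ?_
  rw [integral_neg, ibp i hφ hcφ (hpdw i)]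
  ring

/-- Lemma B. -/
lemma lemB {n : ℕ} {φ : Eu n → ℝ} (hφ : ContDiff ℝ (⊤ : ℕ∞) φ) (hc : HasCompactSupport φ)
    {w : Eu n → ℝ} (hw : ContDiff ℝ (⊤ : ℕ∞) w) (x : Eu n) (s : ℝ) :
    ∫ y, laplacian φ y * w (x + s • y) = s ^ 2 * ∫ y, φ y * laplacian w (x + s • y) := by
  have l1 : ∀ {w : Eu n → ℝ}, ContDiff ℝ (⊤ : ℕ∞) w → ContDiff ℝ 1 w := fun h =>
    h.of_le (by exact_mod_cast le_top)
  simp only [laplacian_eq hw, laplacian_eq hφ, Finset.mul_sum, Finset.sum_mul]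
  have hcd : ∀ i : Fin n, HasCompactSupport (pd i φ) := fun i => hc.fderiv_apply ℝ _
  rw [integral_finsetSum, integral_finsetSum, Finset.mul_sum]
  · refine Finset.sum_congr rfl fun i _ => ?_
    rw [ibp i (l1 (pd_smooth i hφ)) (hcd i) (l1 hw), ibp i (l1 hφ) hc (l1 (pd_smooth i hw))]
    ring
  · intro i _
    refine cpt_integrable hφ.continuous hc ?_
    exact (pd_continuous i (l1 (pd_smooth i hw))).comp (by fun_prop)
  · intro i _
    refine cpt_integrable (pd_continuous i (l1 (pd_smooth i hφ))) ((hcd i).fderiv_apply ℝ _) ?_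
    exact hw.continuous.comp (by fun_prop)

/-- Radial version of `-Δ` in dimension `2m`, in the variable `s = |y|^2`. -/
noncomputable def Lop (m : ℕ) (h : ℝ → ℝ) : ℝ → ℝ :=
  fun s => -(4 * (s * deriv (deriv h) s + m * deriv h s))

/-- Smooth cutoff. -/
noncomputable def g0 : ℝ → ℝ := fun s => Real.smoothTransition (1 - s)

noncomputable def Gk (m : ℕ) : ℕ → ℝ → ℝ
  | 0 => g0
  | k + 1 => Lop m (Gk m k)

lemma g0_smooth : ContDiff ℝ (⊤ : ℕ∞) g0 :=
  (Real.smoothTransition.contDiff (n := ⊤)).comp (contDiff_const.sub contDiff_id)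

lemma deriv_smooth {h : ℝ → ℝ} (hh : ContDiff ℝ (⊤ : ℕ∞) h) : ContDiff ℝ (⊤ : ℕ∞) (deriv h) := by
  have := (contDiff_infty_iff_deriv (𝕜 := ℝ) (f := h)).1 hh
  exact this.2

lemma Gk_smooth (m k : ℕ) : ContDiff ℝ (⊤ : ℕ∞) (Gk m k) := by
  induction k with
  | zero => exact g0_smooth
  | succ k ih =>
    have h1 := deriv_smooth ih
    have h2 := deriv_smooth h1
    unfold Gk Lop
    exact (contDiff_const.mul ((contDiff_id.mul h2).add (contDiff_const.mul h1))).neg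

lemma deriv_vanish {h : ℝ → ℝ} (hh : ContDiff ℝ (⊤ : ℕ∞) h) {ρ : ℝ} (hz : ∀ s, ρ ≤ s → h s = 0)
    (s : ℝ) (hs : ρ ≤ s) : deriv h s = 0 := by
  have h1 : HasDerivWithinAt h (deriv h s) (Set.Ici ρ) s :=
    ((hh.differentiable (by simp)) s).hasDerivAt.hasDerivWithinAt
  have h2 : HasDerivWithinAt h 0 (Set.Ici ρ) s :=
    (hasDerivWithinAt_const s (Set.Ici ρ) (0:ℝ)).congr (fun x hx => hz x hx) (hz s hs)
  exact (uniqueDiffOn_Ici ρ s hs).eq_deriv _ h1 h2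

lemma Gk_vanish (m k : ℕ) : ∀ s, 1 ≤ s → Gk m k s = 0 := by
  induction k with
  | zero => intro s hs; exact Real.smoothTransition.zero_of_nonpos (by linarith)
  | succ k ih =>
    intro s hs
    have h1 := deriv_vanish (Gk_smooth m k) ih
    have h2 := deriv_vanish (deriv_smooth (Gk_smooth m k)) h1
    unfold Gk Lop
    simp [h1 s hs, h2 s hs]

lemma radial_laplacian {m n : ℕ} (hn : n = 2 * m) {h : ℝ → ℝ} (hh : ContDiff ℝ (⊤ : ℕ∞) h)
    (y : Eu n) : laplacian (fun y : Eu n => h (‖y‖ ^ 2)) y = - Lop m h (‖y‖ ^ 2) := by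
  have l1 : ∀ {w : ℝ → ℝ}, ContDiff ℝ (⊤ : ℕ∞) w → ContDiff ℝ 1 w := fun h =>
    h.of_le (by exact_mod_cast le_top)
  rw [laplacian_eq (radial_contDiff hh)]
  have e : ∀ i : Fin n, pd i (pd i (fun y : Eu n => h (‖y‖ ^ 2))) y
      = 2 * deriv h (‖y‖ ^ 2) + 4 * deriv (deriv h) (‖y‖ ^ 2) * (y i) ^ 2 := by
    intro i
    have e1 : pd i (fun y : Eu n => h (‖y‖ ^ 2))
        = fun y => (fun y : Eu n => (fun s => 2 * deriv h s) (‖y‖ ^ 2)) y * (EuclideanSpace.proj (𝕜 := ℝ) i : Eu n →L[ℝ] ℝ) y := by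
      ext y; rw [radial_pd (l1 hh)]; rfl
    have hs : ContDiff ℝ (⊤ : ℕ∞) (fun s => 2 * deriv h s) := contDiff_const.mul (deriv_smooth hh)
    rw [e1]
    have hd : DifferentiableAt ℝ (fun y : Eu n => (fun s => 2 * deriv h s) (‖y‖ ^ 2)) y :=
      (radial_contDiff hs).differentiable (by simp) y
    have e2 := radial_pd (l1 hs) i y
    unfold pd at e2 ⊢
    rw [fderiv_fun_mul hd (ContinuousLinearMap.differentiableAt _), ContinuousLinearMap.fderiv]
    rw [_root_.add_apply, _root_.smul_apply,
      _root_.smul_apply, e2]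
    rw [deriv_const_mul _ ((deriv_smooth hh).differentiable (by simp) _)]
    simp
    ring
  simp only [e]
  rw [Finset.sum_add_distrib, ← Finset.mul_sum (f := fun i => y i ^ 2), ← EuclideanSpace.real_norm_sq_eq]
  simp [Lop, hn]
  ring

lemma rep_iter {m n : ℕ} (hn : n = 2 * m) (k : ℕ) {w : Eu n → ℝ} (hw : ContDiff ℝ (⊤ : ℕ∞) w)
    (x : Eu n) (s : ℝ) :
    ∫ y, Gk m k (‖y‖ ^ 2) * w (x + s • y)
      = s ^ (2 * k) * ∫ y, g0 (‖y‖ ^ 2) * negLapIter k w (x + s • y) := by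
  induction k generalizing w with
  | zero => simp [Gk, negLapIter]
  | succ k ih =>
    have h := lemB (n := n) (radial_contDiff (Gk_smooth m k))
      (radial_hasCompactSupport (Gk_vanish m k)) hw x s
    have h2 := ih (w := fun x => -laplacian w x) (laplacian_smooth hw).neg
    rw [← negLapIter_succ] at h2
    have e : ∀ y : Eu n, Gk m (k+1) (‖y‖ ^ 2) * w (x + s • y)
        = -(laplacian (fun y : Eu n => Gk m k (‖y‖ ^ 2)) y * w (x + s • y)) := by
      intro y; rw [radial_laplacian hn (Gk_smooth m k)]; simp [Gk]
    simp only [e]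
    rw [integral_neg, h]
    simp only [mul_neg, integral_neg] at h2
    rw [neg_eq_iff_eq_neg] at h2
    rw [h2]; ring

/-- The averaging kernel. -/
noncomputable def psi (m n : ℕ) (y : Eu n) : ℝ := -2 * deriv (Gk m (m - 1)) (‖y‖ ^ 2)

noncomputable def chi (n : ℕ) (y : Eu n) : ℝ := g0 (‖y‖ ^ 2)

lemma psi_smooth (m n : ℕ) : ContDiff ℝ (⊤ : ℕ∞) (psi m n) :=
  radial_contDiff (G := fun s => -2 * deriv (Gk m (m - 1)) s)
    (contDiff_const.mul (deriv_smooth (Gk_smooth m _)))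

lemma psi_zero (m n : ℕ) {y : Eu n} (hy : 1 ≤ ‖y‖) : psi m n y = 0 := by
  unfold psi
  rw [deriv_vanish (Gk_smooth m _) (Gk_vanish m _) _ (by nlinarith)]; simp

lemma psi_cpt (m n : ℕ) : HasCompactSupport (psi m n) :=
  radial_hasCompactSupport (G := fun s => -2 * deriv (Gk m (m - 1)) s) (ρ := 1)
    (fun s hs => by simp [deriv_vanish (Gk_smooth m _) (Gk_vanish m _) s hs])

lemma psi_deriv {m n : ℕ} (hm : 1 ≤ m) (hn : n = 2 * m) {w : Eu n → ℝ}
    (hw : ContDiff ℝ (⊤ : ℕ∞) w) (x : Eu n) (s : ℝ) :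
    HasDerivAt (fun s : ℝ => ∫ y, psi m n y * w (x + s • y))
      (-(s ^ (n - 1) * ∫ y, chi n y * negLapIter m w (x + s • y))) s := by
  have h := lemA (n := n) ((Gk_smooth m (m-1)).of_le (by exact_mod_cast le_top))
    (Gk_vanish m (m-1)) (deriv_vanish (Gk_smooth m _) (Gk_vanish m _)) hw x s
  refine HasDerivAt.congr_deriv h ?_
  rw [rep_iter hn (m-1) (laplacian_smooth hw)]
  obtain ⟨k, rfl⟩ : ∃ k, m = k + 1 := ⟨m - 1, by omega⟩
  have e : ∀ z, negLapIter (k+1) w z = - negLapIter k (laplacian w) z := by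
    intro z
    rw [negLapIter_succ]
    have : ∀ (k : ℕ) (v : Eu n → ℝ), ContDiff ℝ (⊤ : ℕ∞) v →
        negLapIter k (fun x => - v x) = fun x => - negLapIter k v x := by
      intro k v hv
      induction k with
      | zero => simp [negLapIter]
      | succ k ih =>
        rw [negLapIter_succ', negLapIter_succ', ih]
        ext x
        have hs := negLap_smooth k hv
        have hs' : ContDiff ℝ (⊤ : ℕ∞) (fun x => - negLapIter k v x) := hs.neg
        have e1 : ∀ (w : Eu n → ℝ) (i : Fin n), pd i (fun x => - w x) = fun x => - pd i w x := by
          intro w i; ext x; unfold pd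
          rw [fderiv_fun_neg]; simp
        show -laplacian (fun x => -negLapIter k v x) x = -(-laplacian (negLapIter k v) x)
        rw [laplacian_eq hs, laplacian_eq hs']
        simp [e1]
    rw [this k _ (laplacian_smooth hw)]
  simp only [e, mul_neg, integral_neg, neg_neg, chi]
  have : n - 1 = 2 * k + 1 := by omega
  simp [this]
  ring

lemma b_rec (m i : ℕ) :
    ∫ r in (0:ℝ)..1, r ^ (2 * i + 3) * deriv (Gk m (i + 1)) (r ^ 2)
      = 4 * ((m:ℝ) - 1 - i) * (i + 1) * ∫ r in (0:ℝ)..1, r ^ (2 * i + 1) * deriv (Gk m i) (r ^ 2) := by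
  set k := deriv (Gk m i) with hk
  have hk0 : ContDiff ℝ (⊤ : ℕ∞) k := deriv_smooth (Gk_smooth m i)
  have hk1 : ContDiff ℝ (⊤ : ℕ∞) (deriv k) := deriv_smooth hk0
  have hk2 : ContDiff ℝ (⊤ : ℕ∞) (deriv (deriv k)) := deriv_smooth hk1
  have z0 := deriv_vanish (Gk_smooth m i) (Gk_vanish m i)
  have z1 := deriv_vanish hk0 z0
  have hd0 : ∀ s, HasDerivAt k (deriv k s) s := fun s => (hk0.differentiable (by simp) s).hasDerivAt
  have hd1 : ∀ s, HasDerivAt (deriv k) (deriv (deriv k) s) s :=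
    fun s => (hk1.differentiable (by simp) s).hasDerivAt
  have e : ∀ s, deriv (Gk m (i+1)) s = -4 * (s * deriv (deriv k) s + (m + 1) * deriv k s) := by
    intro s
    have : HasDerivAt (Gk m (i+1)) (-(4 * ((1 * deriv k s + s * deriv (deriv k) s) + m * deriv k s))) s := by
      unfold Gk Lop
      exact ((((hasDerivAt_id s).mul (hd1 s)).add ((hd0 s).const_mul _)).const_mul 4).neg
    rw [this.deriv]; ring
  have hA : ∀ r : ℝ, HasDerivAt (fun r : ℝ => -2 * (r ^ (2*i+4) * deriv k (r^2))
        - 2 * (m - 1 - i) * (r ^ (2*i+2) * k (r^2)))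
      (r ^ (2*i+3) * deriv (Gk m (i+1)) (r^2) - 4 * ((m:ℝ) - 1 - i) * (i + 1) * (r ^ (2 * i + 1) * k (r ^ 2))) r := by
    intro r
    have hsq : HasDerivAt (fun r : ℝ => r ^ 2) (2 * r) r := by simpa using hasDerivAt_pow 2 r
    have c1 : HasDerivAt (fun r : ℝ => deriv k (r^2)) (deriv (deriv k) (r^2) * (2 * r)) r :=
      HasDerivAt.comp (h₂ := deriv k) r (hd1 (r^2)) hsq
    have c0 : HasDerivAt (fun r : ℝ => k (r^2)) (deriv k (r^2) * (2 * r)) r :=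
      HasDerivAt.comp (h₂ := k) r (hd0 (r^2)) hsq
    have := (((hasDerivAt_pow (2*i+4) r).mul c1).const_mul (-2)).sub
      (((hasDerivAt_pow (2*i+2) r).mul c0).const_mul (2 * ((m:ℝ) - 1 - i)))
    refine HasDerivAt.congr_deriv this ?_
    rw [e]
    simp only [show 2*i+4-1 = 2*i+3 by omega, show 2*i+2-1 = 2*i+1 by omega]
    push_cast
    ring
  have hc : Continuous fun r : ℝ => r ^ (2*i+3) * deriv (Gk m (i+1)) (r^2) := by
    have := (deriv_smooth (Gk_smooth m (i+1))).continuous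
    fun_prop
  have hc2 : Continuous fun r : ℝ => 4 * ((m:ℝ) - 1 - i) * (i + 1) * (r ^ (2 * i + 1) * k (r ^ 2)) := by
    have := hk0.continuous
    fun_prop
  have := intervalIntegral.integral_eq_sub_of_hasDerivAt (a := 0) (b := 1) (fun r _ => hA r)
    ((hc.sub hc2).intervalIntegrable _ _)
  rw [intervalIntegral.integral_sub (hc.intervalIntegrable _ _) (hc2.intervalIntegrable _ _),
    intervalIntegral.integral_const_mul] at this
  have z0' : k 1 = 0 := z0 1 le_rfl
  simp [z0', z1 1 le_rfl] at this
  linarith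

lemma b_val (m i : ℕ) (hi : i + 1 ≤ m) :
    ∫ r in (0:ℝ)..1, r ^ (2 * i + 1) * deriv (Gk m i) (r ^ 2)
      = - (1/2) * 4 ^ i * (Nat.factorial (m - 1)) / (Nat.factorial (m - 1 - i)) * Nat.factorial i := by
  induction i with
  | zero =>
    have hA : ∀ r : ℝ, HasDerivAt (fun r : ℝ => (1/2) * g0 (r^2)) (r ^ (2 * 0 + 1) * deriv (Gk m 0) (r ^ 2)) r := by
      intro r
      have hsq : HasDerivAt (fun r : ℝ => r ^ 2) (2 * r) r := by simpa using hasDerivAt_pow 2 r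
      have := ((g0_smooth.differentiable (by simp) (r^2)).hasDerivAt.comp r hsq).const_mul (1/2)
      refine HasDerivAt.congr_deriv this ?_
      simp [Gk]; ring
    have hc : Continuous fun r : ℝ => r ^ (2*0+1) * deriv (Gk m 0) (r^2) := by
      have := (deriv_smooth (Gk_smooth m 0)).continuous
      fun_prop
    rw [intervalIntegral.integral_eq_sub_of_hasDerivAt (fun r _ => hA r) (hc.intervalIntegrable _ _)]
    have : (Nat.factorial (m-1) : ℝ) ≠ 0 := by positivity
    simp [g0]
    field_simp
  | succ i ih =>
    have := b_rec m i
    rw [show 2 * (i+1) + 1 = 2 * i + 3 by ring, this, ih (by omega)]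
    obtain ⟨j, rfl⟩ : ∃ j, m = j + i + 2 := ⟨m - i - 2, by omega⟩
    simp only [show j + i + 2 - 1 - (i+1) = j by omega, show j + i + 2 - 1 - i = j + 1 by omega,
      Nat.factorial_succ]
    push_cast
    field_simp
    ring

lemma psi_integral {m n : ℕ} (hm : 1 ≤ m) (hn : n = 2 * m) : ∫ y, psi m n y = 2 * cconst n := by
  have hfin : Module.finrank ℝ (Eu n) = n := by simp
  have hne : Nonempty (Fin n) := ⟨⟨0, by omega⟩⟩
  have hnt : Nontrivial (Eu n) := Module.nontrivial_of_finrank_pos (R := ℝ) (by rw [hfin]; omega)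
  have h := integral_fun_norm_addHaar (volume : Measure (Eu n))
    (fun r : ℝ => -2 * deriv (Gk m (m-1)) (r^2))
  have e : ∫ y, psi m n y = ∫ y : Eu n, (fun r : ℝ => -2 * deriv (Gk m (m-1)) (r^2)) ‖y‖ := rfl
  rw [e, h, hfin]
  have hv : (volume : Measure (Eu n)).real (ball 0 1) = π ^ m / Nat.factorial m := by
    rw [Measure.real, InnerProductSpace.volume_ball_of_dim_even (k := m) (by rw [hfin, hn])]
    simp
    positivity
  rw [hv]
  have e2 : ∫ y in Set.Ioi (0:ℝ), y ^ (n - 1) • (-2 * deriv (Gk m (m-1)) (y^2))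
      = -2 * ∫ r in (0:ℝ)..1, r ^ (2 * (m-1) + 1) * deriv (Gk m (m-1)) (r ^ 2) := by
    rw [← intervalIntegral.integral_const_mul, intervalIntegral.integral_of_le (by norm_num)]
    rw [← integral_indicator measurableSet_Ioi, ← integral_indicator measurableSet_Ioc]
    congr 1
    ext r
    by_cases h0 : 0 < r
    · by_cases h1 : r ≤ 1
      · rw [Set.indicator_of_mem (show r ∈ Set.Ioi 0 from h0),
          Set.indicator_of_mem (show r ∈ Set.Ioc 0 1 from ⟨h0, h1⟩)]
        rw [show n - 1 = 2 * (m-1) + 1 by omega, smul_eq_mul]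
        ring
      · rw [Set.indicator_of_mem (show r ∈ Set.Ioi 0 from h0),
          Set.indicator_of_notMem (fun hh => h1 hh.2)]
        rw [deriv_vanish (Gk_smooth m _) (Gk_vanish m _) _ (by push Not at h1; nlinarith)]
        simp
    · rw [Set.indicator_of_notMem (by simpa using h0),
        Set.indicator_of_notMem (fun hh => h0 hh.1)]
  rw [e2, b_val m (m-1) (by omega)]
  obtain ⟨k, rfl⟩ : ∃ k, m = k + 1 := ⟨m - 1, by omega⟩
  subst hn
  unfold cconst
  simp only [show 2 * (k+1) - 2 = 2 * k by omega, show 2 * k / 2 = k by omega,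
    show 2 * (k+1)/2 = k+1 by omega, show k + 1 - 1 = k by omega, Nat.sub_self, Nat.factorial_succ,
    nsmul_eq_mul, smul_eq_mul, pow_mul]
  push_cast
  field_simp
  norm_num

lemma polar {n : ℕ} (hn : 2 ≤ n) {Ψ : Eu n → ℝ≥0∞} (hΨ : Measurable Ψ) (h : ∫⁻ x, Ψ x ≠ ⊤) :
    ∃ θ : Eu n, ‖θ‖ = 1 ∧ ∫⁻ r in Set.Ioi (0:ℝ), ENNReal.ofReal (r ^ (n-1)) * Ψ (r • θ) < ⊤ := by
  have : Nonempty (Fin n) := ⟨⟨0, by omega⟩⟩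
  have : Nontrivial (Eu n) := inferInstance
  have hd : Module.finrank ℝ (Eu n) = n := by simp
  set μ : Measure (Eu n) := volume
  have mp := μ.measurePreserving_homeomorphUnitSphereProd
  rw [hd] at mp
  have hm2 : Measurable (fun p : sphere (0:Eu n) 1 × Set.Ioi (0:ℝ) => Ψ (p.2.1 • p.1.1)) :=
    hΨ.comp (by fun_prop)
  have e1 : ∫⁻ x, Ψ x ∂μ = ∫⁻ x : ({(0)}ᶜ : Set (Eu n)), Ψ x.1 ∂(μ.comap (↑)) := by
    rw [lintegral_subtype_comap (measurableSet_singleton _).compl fun x ↦ Ψ x,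
        restrict_compl_singleton]
  have e2 := mp.lintegral_comp hm2
  have e3 : ∀ x : ({(0)}ᶜ : Set (Eu n)), Ψ (((homeomorphUnitSphereProd (Eu n)) x).2.1 •
      ((homeomorphUnitSphereProd (Eu n)) x).1.1) = Ψ x.1 := by
    intro x
    congr 1
    have := congrArg Subtype.val ((homeomorphUnitSphereProd (Eu n)).symm_apply_apply x)
    rwa [homeomorphUnitSphereProd_symm_apply_coe] at this
  simp only [e3] at e2
  rw [e1, e2, lintegral_prod _ hm2.aemeasurable] at h
  have hae := ae_lt_top hm2.lintegral_prod_right' h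
  have : NeZero μ.toSphere := ⟨Measure.toSphere_ne_zero μ⟩
  obtain ⟨θ, hθ⟩ := hae.exists
  refine ⟨θ.1, by simp, ?_⟩
  rw [Measure.volumeIoiPow, lintegral_withDensity_eq_lintegral_mul _ (by fun_prop)
    (show Measurable (fun y : Set.Ioi (0:ℝ) => Ψ (y.1 • θ.1)) from hΨ.comp (by fun_prop))] at hθ
  simp only [Pi.mul_apply] at hθ
  rwa [lintegral_subtype_comap measurableSet_Ioi
    (fun r : ℝ => ENNReal.ofReal (r ^ (n-1)) * Ψ (r • θ.1))] at hθ

/-- Pointwise limits of polynomials of bounded degree are polynomials. -/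
lemma poly_limit {N : ℕ} {q : ℕ → ℝ → ℝ} {P : ℝ → ℝ}
    (hq : ∀ j, ∃ a : ℕ → ℝ, ∀ t, q j t = ∑ i ∈ Finset.range N, a i * t ^ i)
    (hl : ∀ t, Tendsto (fun j => q j t) atTop (𝓝 (P t))) :
    ∃ p : Polynomial ℝ, ∀ t, P t = p.eval t := by
  choose a ha using hq
  let pol : ℕ → Polynomial ℝ := fun j => ∑ i ∈ Finset.range N, Polynomial.C (a j i) * Polynomial.X ^ i
  have hpol : ∀ j t, q j t = (pol j).eval t := by
    intro j t; simp [pol, ha, Polynomial.eval_finsetSum]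
  have hinj : Set.InjOn (fun i : ℕ => (i:ℝ)) (Finset.range N : Set ℕ) := by
    intro i _ j _ h; simpa using h
  have hdeg : ∀ j, (pol j).degree < (Finset.range N).card := by
    intro j
    rw [Finset.card_range, Polynomial.degree_lt_iff_coeff_zero]
    intro k hk
    simp only [pol, Polynomial.finsetSum_coeff, Polynomial.coeff_C_mul, Polynomial.coeff_X_pow]
    apply Finset.sum_eq_zero
    intro i hi
    rw [Finset.mem_range] at hi
    rw [if_neg (by omega)]; simp
  refine ⟨∑ i ∈ Finset.range N, Polynomial.C (P i) * Lagrange.basis (Finset.range N) (fun i : ℕ => (i:ℝ)) i, ?_⟩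
  intro t
  refine tendsto_nhds_unique (hl t) ?_
  have : ∀ j, q j t = ∑ i ∈ Finset.range N, q j i * (Lagrange.basis (Finset.range N) (fun i : ℕ => (i:ℝ)) i).eval t := by
    intro j
    rw [hpol]
    conv_lhs => rw [Lagrange.eq_interpolate hinj (hdeg j)]
    rw [Lagrange.interpolate_apply, Polynomial.eval_finsetSum]
    simp [hpol]
  simp only [this, Polynomial.eval_finsetSum, Polynomial.eval_mul, Polynomial.eval_C]
  exact tendsto_finsetSum _ fun i _ => (hl i).mul_const _

/-- Taylor expansion for compactly supported functions along a direction. -/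
lemma taylor {n : ℕ} (e : Eu n) (k : ℕ) : ∀ {ψ : Eu n → ℝ} (_ : ContDiff ℝ (⊤ : ℕ∞) ψ)
    (_ : HasCompactSupport ψ),
    ∃ (a : ℕ → Eu n → ℝ) (C : ℝ), (∀ j, Continuous (a j)) ∧ (∀ j, HasCompactSupport (a j)) ∧ 0 ≤ C ∧
      (∀ j y, y ∉ tsupport ψ → a j y = 0) ∧ ∀ y (t : ℝ), |ψ (y + t • e) - ∑ j ∈ Finset.range k, a j y * t ^ j| ≤ C * |t| ^ k := by
  induction k with
  | zero =>
    intro ψ hψ hc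
    obtain ⟨C, hC⟩ := hc.exists_bound_of_continuous hψ.continuous
    refine ⟨fun _ => 0, C, fun _ => continuous_const, fun _ => HasCompactSupport.zero, 
      (norm_nonneg _).trans (hC 0), fun _ _ _ => rfl, ?_⟩
    intro y t; simpa using hC _
  | succ k ih =>
    intro ψ hψ hc
    have hd : ContDiff ℝ (⊤ : ℕ∞) (fun x => fderiv ℝ ψ x e) :=
      (hψ.fderiv_right (by exact_mod_cast le_top)).clm_apply contDiff_const
    obtain ⟨a, C, h1, h2, h3, h5, h4⟩ := ih hd (hc.fderiv_apply ℝ e)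
    refine ⟨fun j => match j with
      | 0 => ψ
      | j+1 => fun y => a j y / (j+1), C, ?_, ?_, h3, ?_, ?_⟩
    · rintro (_ | j)
      · exact hψ.continuous
      · exact (h1 j).div_const _
    · rintro (_ | j)
      · exact hc
      · have := (h2 j).mul_right (f' := fun _ => ((j:ℝ)+1)⁻¹)
        simp only [div_eq_mul_inv]; exact this
    · rintro (_ | j) y hy
      · exact image_eq_zero_of_notMem_tsupport hy
      · simp [h5 j y (fun h => hy (tsupport_fderiv_apply_subset ℝ e h))]
    · intro y t
      rw [Finset.sum_range_succ']
      let g : ℝ → ℝ := fun t => ψ (y + t • e) - ∑ j ∈ Finset.range k, a j y / (j+1) * t ^ (j+1)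
      let g' : ℝ → ℝ := fun t => fderiv ℝ ψ (y + t • e) e - ∑ j ∈ Finset.range k, a j y * t ^ j
      have hg : ∀ s, HasDerivAt g (g' s) s := by
        intro s
        apply HasDerivAt.sub
        · have h := (hψ.differentiable (by simp) (y + s • e)).hasFDerivAt
          have h' : HasDerivAt (fun s : ℝ => y + s • e) e s := by
            simpa using ((hasDerivAt_id s).smul_const e).const_add y
          exact h.comp_hasDerivAt s h'
        · apply HasDerivAt.fun_sum
          intro j _
          refine ((hasDerivAt_pow (j+1) s).const_mul (a j y / (j+1))).congr_deriv ?_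
          have : (j:ℝ) + 1 ≠ 0 := by positivity
          push_cast
          field_simp
      have hb : ∀ s ∈ Set.uIcc 0 t, ‖g' s‖ ≤ C * |t| ^ k := by
        intro s hs
        refine (h4 y s).trans ?_
        have : |s| ≤ |t| := by
          rcases Set.mem_uIcc.1 hs with h | h
          · rw [abs_of_nonneg h.1, abs_of_nonneg (h.1.trans h.2)]; exact h.2
          · rw [abs_of_nonpos h.2, abs_of_nonpos (h.1.trans h.2)]; linarith [h.1]
        gcongr
      have := (convex_uIcc 0 t).norm_image_sub_le_of_norm_hasDerivWithin_le
        (fun s _ => (hg s).hasDerivWithinAt) hb Set.left_mem_uIcc Set.right_mem_uIcc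
      simp only [sub_zero, Real.norm_eq_abs] at this
      have e0 : g t - g 0 = ψ (y + t • e) - ((∑ j ∈ Finset.range k, a j y / (j+1) * t ^ (j+1)) + ψ y * t ^ 0) := by
        simp [g]; ring
      rw [e0] at this
      rw [pow_succ, ← mul_assoc]
      exact this

lemma chi_nonneg (n : ℕ) (y : Eu n) : 0 ≤ chi n y := Real.smoothTransition.nonneg _
lemma chi_le_one (n : ℕ) (y : Eu n) : chi n y ≤ 1 := Real.smoothTransition.le_one _
lemma chi_abs (n : ℕ) (y : Eu n) : ‖chi n y‖ ≤ 1 := by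
  rw [Real.norm_of_nonneg (chi_nonneg n y)]; exact chi_le_one n y
lemma chi_origin (n : ℕ) : chi n 0 = 1 := by simp [chi, g0]
lemma chi_zero {n : ℕ} {y : Eu n} (hy : 1 ≤ ‖y‖) : chi n y = 0 := by
  unfold chi g0
  exact Real.smoothTransition.zero_of_nonpos (by nlinarith)
lemma chi_smooth (n : ℕ) : ContDiff ℝ (⊤ : ℕ∞) (chi n) := radial_contDiff g0_smooth
lemma chi_cont (n : ℕ) : Continuous (chi n) := (chi_smooth n).continuous
lemma chi_cpt (n : ℕ) : HasCompactSupport (chi n) :=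
  radial_hasCompactSupport (G := g0) (ρ := 1)
    (fun s hs => Real.smoothTransition.zero_of_nonpos (by linarith))
lemma chi_lip (n : ℕ) : ∃ L : ℝ, 0 ≤ L ∧ ∀ x y, |chi n x - chi n y| ≤ L * ‖x - y‖ := by
  obtain ⟨C, hC⟩ := ContDiff.lipschitzWith_of_hasCompactSupport (chi_cpt n) (chi_smooth n) (by simp)
  exact ⟨C, C.2, fun x y => by simpa [Real.dist_eq, dist_eq_norm] using hC.dist_le_mul x y⟩

/-- The density `B(x,s)`. -/
noncomputable def Bf {n : ℕ} (f : Eu n → ℝ) (x : Eu n) (s : ℝ) : ℝ :=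
  s ^ (n - 1) * ∫ y, chi n y * f (x + s • y)

lemma Bf_cont {n : ℕ} {f : Eu n → ℝ} (hf : Continuous f) : 
    Continuous (fun p : Eu n × ℝ => Bf f p.1 p.2) := by
  unfold Bf
  refine (continuous_snd.pow _).mul ?_
  exact param_cont (w := fun (p : Eu n × ℝ) y => f (p.1 + p.2 • y)) (chi_cont n) (chi_cpt n)
    (hf.comp (by fun_prop))

lemma Bf_cont1 {n : ℕ} {f : Eu n → ℝ} (hf : Continuous f) (x : Eu n) : 
    Continuous (fun s : ℝ => Bf f x s) := 
  (Bf_cont hf).comp (Continuous.prodMk_right x)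

lemma Bf_eq {n : ℕ} (hn : 1 ≤ n) (f : Eu n → ℝ) (x : Eu n) {s : ℝ} (hs : 0 < s) :
    s * Bf f x s = ∫ z, chi n (s⁻¹ • (z - x)) * f z := by
  have h := Measure.integral_comp_smul (volume : Measure (Eu n))
    (fun z => chi n (s⁻¹ • z) * f (x + z)) s
  simp only [inv_smul_smul₀ hs.ne'] at h
  have h2 := integral_sub_right_eq_self (μ := (volume : Measure (Eu n)))
    (fun z => chi n (s⁻¹ • z) * f (x + z)) x
  simp only [add_sub_cancel] at h2
  rw [h2, ← mul_left_cancel_iff_of_pos (a := (s^n)⁻¹) (by positivity)]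
  unfold Bf
  rw [h]
  have : Module.finrank ℝ (Eu n) = n := by simp
  rw [this, abs_of_pos (by positivity)]
  obtain ⟨k, rfl⟩ : ∃ k, n = k + 1 := ⟨n - 1, by omega⟩
  simp only [add_tsub_cancel_right, smul_eq_mul]
  field_simp
  ring

lemma chi_int {n : ℕ} {f : Eu n → ℝ} (hf : Integrable f) (x : Eu n) (s : ℝ) :
    Integrable (fun z => chi n (s⁻¹ • (z - x)) * f z) :=
  hf.bdd_mul (c := 1) (Continuous.aestronglyMeasurable ((chi_cont n).comp (by fun_prop)))
    (ae_of_all _ fun _ => chi_abs n _)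

lemma abs_int_le {α : Type*} [MeasurableSpace α] {μ : Measure α} {g G : α → ℝ} (hG : Integrable G μ)
    (h : ∀ᵐ z ∂μ, ‖g z‖ ≤ G z) : |∫ z, g z ∂μ| ≤ ∫ z, G z ∂μ :=
  norm_integral_le_of_norm_le hG h

lemma Bf_bound {n : ℕ} (hn : 1 ≤ n) {f : Eu n → ℝ} (hf : Integrable f) (x : Eu n) {s : ℝ}
    (hs : 0 < s) : |Bf f x s| ≤ (∫ z, |f z|) / s := by
  rw [le_div_iff₀ hs, mul_comm]
  calc s * |Bf f x s| = |s * Bf f x s| := by rw [abs_mul, abs_of_pos hs]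
    _ = |∫ z, chi n (s⁻¹ • (z - x)) * f z| := by rw [Bf_eq hn f x hs]
    _ ≤ ∫ z, |f z| := by
      refine abs_int_le hf.abs (ae_of_all _ fun z => ?_)
      rw [norm_mul]
      exact mul_le_of_le_one_left (norm_nonneg _) (chi_abs n _)

lemma Bf_diff {n : ℕ} (hn : 1 ≤ n) {f : Eu n → ℝ} (hf : Integrable f) {L : ℝ}
    (hL : ∀ x y, |chi n x - chi n y| ≤ L * ‖x - y‖) (x : Eu n) {s : ℝ}
    (hs : 0 < s) : |Bf f x s - Bf f 0 s| ≤ (L * ‖x‖ * ∫ z, |f z|) / s ^ 2 := by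
  rw [le_div_iff₀ (by positivity), mul_comm, pow_two, mul_assoc]
  calc s * (s * |Bf f x s - Bf f 0 s|) = s * |s * Bf f x s - s * Bf f 0 s| := by
        rw [← mul_sub, abs_mul, abs_of_pos hs]
    _ = s * |∫ z, (chi n (s⁻¹ • (z - x)) * f z - chi n (s⁻¹ • (z - 0)) * f z)| := by
        rw [Bf_eq hn f x hs, Bf_eq hn f 0 hs, integral_sub (chi_int hf _ _) (chi_int hf _ _)]
    _ ≤ s * ∫ z, (L * (s⁻¹ * ‖x‖)) * |f z| := by
      gcongr
      refine abs_int_le (hf.abs.const_mul _) (ae_of_all _ fun z => ?_)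
      rw [← sub_mul, norm_mul]
      refine mul_le_mul_of_nonneg_right ((hL _ _).trans_eq ?_) (norm_nonneg _)
      rw [← smul_sub, norm_smul, norm_inv, Real.norm_of_nonneg hs.le]
      simp
    _ = _ := by rw [integral_const_mul]; field_simp

lemma Bf_limit {n : ℕ} (hn : 1 ≤ n) {f : Eu n → ℝ} (hf : Integrable f) {ε : ℝ} (hε : 0 < ε) :
    ∃ S : ℝ, 1 ≤ S ∧ ∀ s, S ≤ s → |s * Bf f 0 s - ∫ z, f z| ≤ ε := by
  have h : Tendsto (fun s : ℝ => ∫ z, chi n (s⁻¹ • (z - 0)) * f z) atTop (𝓝 (∫ z, f z)) := by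
    refine tendsto_integral_filter_of_dominated_convergence (fun z => |f z|) 
      (Eventually.of_forall fun s => (chi_int hf _ _).aestronglyMeasurable) 
      (Eventually.of_forall fun s => ae_of_all _ fun z => ?_) hf.abs (ae_of_all _ fun z => ?_)
    · rw [norm_mul]
      exact mul_le_of_le_one_left (norm_nonneg _) (chi_abs n _)
    · have h1 : Tendsto (fun s : ℝ => s⁻¹ • (z - 0)) atTop (𝓝 ((0:ℝ) • (z - 0))) :=
        tendsto_inv_atTop_zero.smul_const _
      have h2 := ((chi_cont n).tendsto _).comp h1
      rw [zero_smul, chi_origin] at h2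
      simpa using h2.mul_const (f z)
  obtain ⟨S, hS⟩ := (Metric.tendsto_atTop.1 h) ε hε
  refine ⟨max S 1, le_max_right _ _, fun s hs => ?_⟩
  rw [Bf_eq hn f 0 (by linarith [le_max_right S 1])]
  exact (hS s ((le_max_left _ _).trans hs)).le

lemma Bf_small {n : ℕ} (hn : 1 ≤ n) {f : Eu n → ℝ} (hf : Integrable f) {ε : ℝ} (hε : 0 < ε) :
    ∃ r : ℝ, 1 ≤ r ∧ ∀ x : Eu n, r ≤ ‖x‖ → ∀ s, 0 < s → s ≤ ‖x‖ / 2 → |s * Bf f x s| ≤ ε := by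
  have h : Tendsto (fun r : ℝ => ∫ z, Set.indicator {z : Eu n | r ≤ ‖z‖} (fun z => |f z|) z) atTop
      (𝓝 (∫ _ : Eu n, (0:ℝ))) := by
    have hms : ∀ r : ℝ, MeasurableSet {z : Eu n | r ≤ ‖z‖} := fun r =>
      measurableSet_le measurable_const measurable_norm
    refine tendsto_integral_filter_of_dominated_convergence (fun z => |f z|) 
      (Eventually.of_forall fun s => (hf.abs.indicator (hms s)).aestronglyMeasurable) 
      (Eventually.of_forall fun s => ae_of_all _ fun z => ?_) hf.abs (ae_of_all _ fun z => ?_)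
    · refine (norm_indicator_le_norm_self _ _).trans_eq (by simp)
    · refine tendsto_const_nhds.congr' ?_
      filter_upwards [eventually_gt_atTop ‖z‖] with r hr
      simp [Set.indicator, hr]
  rw [integral_zero] at h
  obtain ⟨S, hS⟩ := (Metric.tendsto_atTop.1 h) ε hε
  refine ⟨max (2 * S) 1, le_max_right _ _, fun x hx s hs hs2 => ?_⟩
  have h1 := hS (‖x‖ / 2) (by linarith [le_max_left (2*S) 1])
  rw [Real.dist_eq, sub_zero] at h1
  refine le_trans ?_ ((le_abs_self _).trans h1.le)
  rw [Bf_eq hn f x hs]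
  have hms : MeasurableSet {z : Eu n | ‖x‖ / 2 ≤ ‖z‖} := 
      measurableSet_le measurable_const measurable_norm
  refine abs_int_le (hf.abs.indicator hms) (ae_of_all _ fun z => ?_)
  by_cases hz : ‖x‖ / 2 ≤ ‖z‖
  · rw [Set.indicator_of_mem (by exact hz), norm_mul]
    exact mul_le_of_le_one_left (norm_nonneg _) (chi_abs n _)
  · rw [Set.indicator_of_notMem (by exact hz), chi_zero]
    · simp
    · rw [norm_smul, norm_inv, Real.norm_of_nonneg hs.le, ← div_eq_inv_mul, le_div_iff₀ hs]
      have := norm_sub_norm_le x z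
      rw [norm_sub_rev] at this
      linarith

lemma Bf_nonneg {n : ℕ} {f : Eu n → ℝ} {R0 : ℝ} (hf : ∀ z : Eu n, R0 ≤ ‖z‖ → 0 ≤ f z)
    {x : Eu n} (hx : R0 + 1 ≤ ‖x‖) {s : ℝ} (hs : 0 ≤ s) (hs1 : s ≤ 1) : 0 ≤ Bf f x s := by
  refine mul_nonneg (by positivity) (integral_nonneg fun y => ?_)
  by_cases hy : 1 ≤ ‖y‖
  · simp [chi_zero hy]
  · refine mul_nonneg (chi_nonneg n y) (hf _ ?_)
    have := norm_sub_norm_le x (-(s • y))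
    rw [norm_neg, sub_neg_eq_add, norm_smul, Real.norm_of_nonneg hs] at this
    push Not at hy
    nlinarith [norm_nonneg y]

/-- The potential (up to the factor `1/c_n`). -/
noncomputable def Vf {n : ℕ} (f : Eu n → ℝ) (x : Eu n) : ℝ :=
  ∫ s in Set.Ioi (0:ℝ), (Bf f x s - Bf f 0 s)

lemma tail_int {K r : ℝ} (hr : 0 < r) : 
    IntegrableOn (fun s : ℝ => K / s ^ 2) (Set.Ioi r) ∧ ∫ s in Set.Ioi r, K / s ^ 2 = K / r := by
  have h1 := integrableOn_Ioi_rpow_of_lt (a := -2) (by norm_num) hr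
  have h2 := integral_Ioi_rpow_of_lt (a := -2) (by norm_num) hr
  have e : ∀ s ∈ Set.Ioi r, K * s ^ (-2:ℝ) = K / s ^ 2 := by
    intro s hs
    have hs0 : 0 < s := hr.trans hs
    rw [Real.rpow_neg hs0.le, div_eq_mul_inv]
    norm_num
  constructor
  · exact (integrableOn_congr_fun e measurableSet_Ioi).1 (h1.const_mul K)
  · rw [← setIntegral_congr_fun measurableSet_Ioi e, integral_const_mul, h2]
    norm_num
    rw [Real.rpow_neg hr.le, Real.rpow_one]
    field_simp

lemma Vf_int {n : ℕ} (hn : 1 ≤ n) {f : Eu n → ℝ} (hc : Continuous f) (hf : Integrable f) (x : Eu n) :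
    IntegrableOn (fun s => Bf f x s - Bf f 0 s) (Set.Ioi 0) := by
  obtain ⟨L, hL0, hL⟩ := chi_lip n
  have hcont : Continuous (fun s => Bf f x s - Bf f 0 s) := (Bf_cont1 hc x).sub (Bf_cont1 hc 0)
  rw [← Set.Ioc_union_Ioi_eq_Ioi (zero_le_one' ℝ)]
  refine IntegrableOn.union (hcont.integrableOn_Ioc) ?_
  refine Integrable.mono' (tail_int (K := L * ‖x‖ * ∫ z, |f z|) one_pos).1 
    hcont.aestronglyMeasurable ?_
  filter_upwards [ae_restrict_mem measurableSet_Ioi] with s hs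
  exact Bf_diff hn hf hL x (one_pos.trans hs)

lemma Vf_tail {n : ℕ} (hn : 1 ≤ n) {f : Eu n → ℝ} (hc : Continuous f) (hf : Integrable f) {L : ℝ}
    (hL : ∀ x y, |chi n x - chi n y| ≤ L * ‖x - y‖) (x : Eu n) {r : ℝ} (hr : 0 < r) :
    |Vf f x - ∫ s in (0:ℝ)..r, (Bf f x s - Bf f 0 s)| ≤ (L * ‖x‖ * ∫ z, |f z|) / r := by
  have h := Vf_int hn hc hf x
  have e : Vf f x - ∫ s in (0:ℝ)..r, (Bf f x s - Bf f 0 s) 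
      = ∫ s in Set.Ioi r, (Bf f x s - Bf f 0 s) := by
    unfold Vf
    rw [← intervalIntegral.integral_interval_add_Ioi h (h.mono_set (Set.Ioi_subset_Ioi hr.le))]
    ring
  rw [e, ← (tail_int hr).2]
  refine abs_int_le (tail_int hr).1 ?_
  filter_upwards [ae_restrict_mem measurableSet_Ioi] with s hs
  exact Bf_diff hn hf hL x (hr.trans hs)

lemma Vf_tendsto {n : ℕ} (hn : 1 ≤ n) {f : Eu n → ℝ} (hc : Continuous f) (hf : Integrable f) 
    (x : Eu n) :
    Tendsto (fun R : ℝ => ∫ s in (0:ℝ)..R, (Bf f x s - Bf f 0 s)) atTop (𝓝 (Vf f x)) :=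
  intervalIntegral_tendsto_integral_Ioi 0 (Vf_int hn hc hf x) tendsto_id

lemma log_upper {g : ℝ → ℝ} (hg : Continuous g) {α β K : ℝ} (hα : 0 < α) (hβ : α ≤ β)
    (h : ∀ s, α ≤ s → s ≤ β → s * g s ≤ K) :
    ∫ s in α..β, g s ≤ K * (Real.log β - Real.log α) := by
  have hβ0 : 0 < β := hα.trans_le hβ
  rw [← Real.log_div hβ0.ne' hα.ne', ← integral_inv_of_pos hα hβ0,
    ← intervalIntegral.integral_const_mul]
  have hi : IntervalIntegrable (fun s : ℝ => K * s⁻¹) volume α β := by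
    apply ContinuousOn.intervalIntegrable
    apply continuousOn_const.mul
    apply continuousOn_id.inv₀
    intro s hs
    rw [Set.uIcc_of_le hβ] at hs
    exact (hα.trans_le hs.1).ne'
  refine intervalIntegral.integral_mono_on hβ (hg.intervalIntegrable _ _) hi ?_
  intro s hs
  rw [← div_eq_mul_inv, le_div_iff₀ (hα.trans_le hs.1), mul_comm]
  exact h s hs.1 hs.2

lemma log_lower {g : ℝ → ℝ} (hg : Continuous g) {α β K : ℝ} (hα : 0 < α) (hβ : α ≤ β)
    (h : ∀ s, α ≤ s → s ≤ β → K ≤ s * g s) :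
    K * (Real.log β - Real.log α) ≤ ∫ s in α..β, g s := by
  have := log_upper (g := fun s => - g s) hg.neg hα hβ (K := -K) (fun s h1 h2 => by
    have := h s h1 h2
    linarith)
  rw [intervalIntegral.integral_neg] at this
  linarith

/-- Local mass function. -/
noncomputable def Mf {n : ℕ} (f : Eu n → ℝ) (x : Eu n) : ℝ :=
  ∫ s in (0:ℝ)..1, s ^ (n - 2) * ∫ y, chi n y * |f (x + s • y)|

lemma Mf_inner_cont {n : ℕ} {f : Eu n → ℝ} (hf : Continuous f) : 
    Continuous (fun p : Eu n × ℝ => p.2 ^ (n - 2) * ∫ y, chi n y * |f (p.1 + p.2 • y)|) := by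
  refine (continuous_snd.pow _).mul ?_
  exact param_cont (w := fun (p : Eu n × ℝ) y => |f (p.1 + p.2 • y)|) (chi_cont n) (chi_cpt n)
    ((continuous_abs.comp hf).comp (by fun_prop))

lemma Mf_inner_cont1 {n : ℕ} {f : Eu n → ℝ} (hf : Continuous f) (x : Eu n) : 
    Continuous (fun s : ℝ => s ^ (n - 2) * ∫ y, chi n y * |f (x + s • y)|) := 
  (Mf_inner_cont hf).comp (Continuous.prodMk_right x)

lemma Mf_inner_nonneg {n : ℕ} (f : Eu n → ℝ) (x : Eu n) {s : ℝ} (hs : 0 ≤ s) :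
    0 ≤ s ^ (n - 2) * ∫ y, chi n y * |f (x + s • y)| :=
  mul_nonneg (by positivity) (integral_nonneg fun y => mul_nonneg (chi_nonneg n y) (abs_nonneg _))

lemma Mf_nonneg {n : ℕ} (f : Eu n → ℝ) (x : Eu n) : 0 ≤ Mf f x :=
  intervalIntegral.integral_nonneg zero_le_one fun _ hs => Mf_inner_nonneg f x hs.1

lemma Mf_cont {n : ℕ} {f : Eu n → ℝ} (hf : Continuous f) : Continuous (Mf f) := by
  unfold Mf
  exact intervalIntegral.continuous_parametric_intervalIntegral_of_continuous' 
    (f := fun (x : Eu n) (s : ℝ) => s ^ (n - 2) * ∫ y, chi n y * |f (x + s • y)|) (Mf_inner_cont hf) 0 1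

lemma Bf_le_Mf {n : ℕ} (hn : 2 ≤ n) {f : Eu n → ℝ} (hf : Continuous f) (x : Eu n) {τ : ℝ}
    (h0 : 0 ≤ τ) (h1 : τ ≤ 1) : ∫ s in (0:ℝ)..τ, Bf f x s ≤ τ * Mf f x := by
  have hc := Mf_inner_cont1 hf x
  have : ∫ s in (0:ℝ)..τ, Bf f x s ≤ 
      ∫ s in (0:ℝ)..τ, τ * (s ^ (n - 2) * ∫ y, chi n y * |f (x + s • y)|) := by
    refine intervalIntegral.integral_mono_on h0 ((Bf_cont1 hf x).intervalIntegrable _ _)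
      ((hc.const_mul τ).intervalIntegrable _ _) ?_
    intro s hs
    have e : Bf f x s = s * (s ^ (n - 2) * ∫ y, chi n y * f (x + s • y)) := by
      unfold Bf
      rw [← mul_assoc, ← pow_succ']
      congr 2
      omega
    rw [e]
    have h2 : (s ^ (n - 2) * ∫ y, chi n y * f (x + s • y)) ≤ 
        (s ^ (n - 2) * ∫ y, chi n y * |f (x + s • y)|) := by
      refine mul_le_mul_of_nonneg_left ?_ (pow_nonneg hs.1 _)
      refine integral_mono (cpt_integrable (chi_cont n) (chi_cpt n) (hf.comp (by fun_prop)))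
        (cpt_integrable (chi_cont n) (chi_cpt n) ((continuous_abs.comp hf).comp (by fun_prop))) ?_
      intro y
      exact mul_le_mul_of_nonneg_left (le_abs_self _) (chi_nonneg n y)
    exact (mul_le_mul_of_nonneg_left h2 hs.1).trans 
      (mul_le_mul_of_nonneg_right hs.2 (Mf_inner_nonneg f x hs.1))
  refine this.trans ?_
  rw [intervalIntegral.integral_const_mul]
  refine mul_le_mul_of_nonneg_left ?_ h0
  unfold Mf
  rw [← intervalIntegral.integral_add_adjacent_intervals (hc.intervalIntegrable 0 τ) 
    (hc.intervalIntegrable τ 1)]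
  have : 0 ≤ ∫ s in τ..1, s ^ (n - 2) * ∫ y, chi n y * |f (x + s • y)| :=
    intervalIntegral.integral_nonneg h1 fun s hs => Mf_inner_nonneg f x (h0.trans hs.1)
  linarith

lemma V_upper {n : ℕ} (hn : 2 ≤ n) {f : Eu n → ℝ} (hc : Continuous f) (hf : Integrable f) {ε : ℝ}
    (hε : 0 < ε) : ∃ K r0 : ℝ, 1 ≤ r0 ∧ ∀ x : Eu n, r0 ≤ ‖x‖ → 
      Vf f x ≤ K + ε * Real.log (1 + Mf f x) - ((∫ z, f z) - 2 * ε) * Real.log ‖x‖ := by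
  obtain ⟨L, hL0, hL⟩ := chi_lip n
  obtain ⟨S, hS1, hS⟩ := Bf_limit (by omega) hf hε
  obtain ⟨r1, hr1, hB⟩ := Bf_small (by omega) hf hε
  set a := ∫ z, f z
  set A := ∫ z, |f z|
  have hA : 0 ≤ A := integral_nonneg fun _ => abs_nonneg _
  refine ⟨L * A + (1 + A * Real.log 2 - (∫ s in (0:ℝ)..S, Bf f 0 s) + (a - ε) * Real.log S), 
    max (max S r1) 2, by linarith [le_max_right (max S r1) 2], fun x hx => ?_⟩
  set r := ‖x‖ with hr
  have hrS : S ≤ r := (le_max_left _ _).trans ((le_max_left _ _).trans hx)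
  have hrr : r1 ≤ r := (le_max_right _ _).trans ((le_max_left _ _).trans hx)
  have hr2 : 2 ≤ r := (le_max_right _ _).trans hx
  have hM := Mf_nonneg f x
  set M := Mf f x
  set τ := 1 / (1 + M) with hτ
  have hτ0 : 0 < τ := by positivity
  have hτ1 : τ ≤ 1 := by rw [hτ, div_le_one (by positivity)]; linarith
  have hlogτ : Real.log τ = - Real.log (1 + M) := by rw [hτ, one_div, Real.log_inv]
  have c1 := Bf_cont1 hc x
  have c0 := Bf_cont1 hc 0
  have t := Vf_tail (by omega) hc hf hL x (r := r) (by linarith)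
  have t1 : L * r * A / r = L * A := by field_simp
  rw [t1, intervalIntegral.integral_sub (c1.intervalIntegrable _ _) (c0.intervalIntegrable _ _)] at t
  have s1 := intervalIntegral.integral_add_adjacent_intervals (c1.intervalIntegrable 0 τ) 
    (c1.intervalIntegrable (μ := volume) τ (r/2))
  have s2 := intervalIntegral.integral_add_adjacent_intervals (c1.intervalIntegrable 0 (r/2)) 
    (c1.intervalIntegrable (μ := volume) (r/2) r)
  have s3 := intervalIntegral.integral_add_adjacent_intervals (c0.intervalIntegrable 0 S) 
    (c0.intervalIntegrable (μ := volume) S r)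
  have b1 := Bf_le_Mf hn hc x hτ0.le hτ1
  have b1' : τ * M ≤ 1 := by
    rw [hτ, one_div, ← div_eq_inv_mul, div_le_one (by positivity)]; linarith
  have b2 := log_upper c1 hτ0 (by linarith : τ ≤ r / 2) (K := ε) (fun s h1 h2 => 
    (le_abs_self _).trans (hB x hrr s (by linarith) h2))
  have b3 := log_upper c1 (by linarith : 0 < r / 2) (by linarith : r / 2 ≤ r) (K := A) 
    (fun s h1 h2 => by
      have hs : 0 < s := by linarith
      have := (le_abs_self _).trans (Bf_bound (by omega) hf x hs)
      rwa [le_div_iff₀ hs, mul_comm] at this)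
  have b4 := log_lower c0 (by linarith : 0 < S) hrS (K := a - ε) (fun s h1 h2 => by
      have := (abs_le.1 (hS s h1)).1
      linarith)
  have l2 : Real.log (r / 2) = Real.log r - Real.log 2 := Real.log_div (by linarith) (by norm_num)
  have l3 : 0 < Real.log 2 := Real.log_pos (by norm_num)
  rw [l2] at b2 b3
  rw [hlogτ] at b2
  have t2 := (abs_le.1 t).2
  have : 0 < ε * Real.log 2 := by positivity
  linarith

lemma V_lower {n : ℕ} (hn : 2 ≤ n) {f : Eu n → ℝ} (hc : Continuous f) (hf : Integrable f) {R0 : ℝ}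
    (hf0 : ∀ z : Eu n, R0 ≤ ‖z‖ → 0 ≤ f z) : ∃ K r0 : ℝ, 1 ≤ r0 ∧ ∀ x : Eu n, r0 ≤ ‖x‖ → 
      - K - 2 * (∫ z, |f z|) * Real.log ‖x‖ ≤ Vf f x := by
  obtain ⟨L, hL0, hL⟩ := chi_lip n
  set A := ∫ z, |f z|
  refine ⟨L * A + (∫ s in (0:ℝ)..1, Bf f 0 s), max (R0 + 1) 1, le_max_right _ _, fun x hx => ?_⟩
  set r := ‖x‖ with hr
  have hrS : R0 + 1 ≤ r := (le_max_left _ _).trans hx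
  have hr2 : 1 ≤ r := (le_max_right _ _).trans hx
  have c1 := Bf_cont1 hc x
  have c0 := Bf_cont1 hc 0
  have t := Vf_tail (by omega) hc hf hL x (r := r) (by linarith)
  have t1 : L * r * A / r = L * A := by field_simp
  rw [t1, intervalIntegral.integral_sub (c1.intervalIntegrable _ _) (c0.intervalIntegrable _ _)] at t
  have s2 := intervalIntegral.integral_add_adjacent_intervals (c1.intervalIntegrable 0 1) 
    (c1.intervalIntegrable (μ := volume) 1 r)
  have s3 := intervalIntegral.integral_add_adjacent_intervals (c0.intervalIntegrable 0 1) 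
    (c0.intervalIntegrable (μ := volume) 1 r)
  have b1 : 0 ≤ ∫ s in (0:ℝ)..1, Bf f x s := 
    intervalIntegral.integral_nonneg zero_le_one fun s hs => Bf_nonneg hf0 hrS hs.1 hs.2
  have bb : ∀ (x : Eu n) s, 1 ≤ s → |s * Bf f x s| ≤ A := by
    intro x s hs
    have hs : 0 < s := by linarith
    have := (Bf_bound (by omega) hf x hs)
    rwa [le_div_iff₀ hs, mul_comm, ← abs_of_pos hs, ← abs_mul, abs_of_pos hs] at this
  have b3 := log_lower c1 one_pos hr2 (K := -A) (fun s h1 h2 => (abs_le.1 (bb x s h1)).1)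
  have b4 := log_upper c0 one_pos hr2 (K := A) (fun s h1 h2 => (abs_le.1 (bb 0 s h1)).2)
  rw [Real.log_one] at b3 b4
  have t2 := (abs_le.1 t).1
  linarith

lemma V_exp {n : ℕ} (hn : 2 ≤ n) {f : Eu n → ℝ} (hc : Continuous f) (hf : Integrable f) {c : ℝ}
    (hc0 : 0 < c) (hca : c < ∫ z, f z) : ∃ C η r0 : ℝ, 0 < C ∧ 0 < η ∧ 1 ≤ r0 ∧ ∀ x : Eu n, r0 ≤ ‖x‖ → 
      Real.exp (Vf f x / c) ≤ C * (1 + Mf f x) * ‖x‖ ^ (-1 - η) := by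
  set a := ∫ z, f z
  set ε := min ((a - c) / 4) c with hε
  have hε0 : 0 < ε := lt_min (by linarith) hc0
  obtain ⟨K, r0, hr0, h⟩ := V_upper hn hc hf hε0
  refine ⟨Real.exp (K / c), (a - c) / (2 * c), r0, Real.exp_pos _, 
    div_pos (by linarith) (by linarith), hr0, fun x hx => ?_⟩
  have hr : 0 < ‖x‖ := by linarith
  have hM := Mf_nonneg f x
  have hl1 : 0 ≤ Real.log (1 + Mf f x) := Real.log_nonneg (by linarith)
  have hl2 : 0 ≤ Real.log ‖x‖ := Real.log_nonneg (by linarith)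
  have e : Real.exp (K / c) * (1 + Mf f x) * ‖x‖ ^ (-1 - (a - c) / (2 * c)) = 
      Real.exp (K / c + Real.log (1 + Mf f x) + Real.log ‖x‖ * (-1 - (a - c) / (2 * c))) := by
    rw [Real.exp_add, Real.exp_add, Real.exp_log (by linarith), Real.rpow_def_of_pos hr]
  rw [e, Real.exp_le_exp]
  have h1 := h x hx
  rw [div_le_iff₀ hc0]
  have e2 : (K / c + Real.log (1 + Mf f x) + Real.log ‖x‖ * (-1 - (a - c) / (2 * c))) * c = 
      K + c * Real.log (1 + Mf f x) - ((a + c) / 2) * Real.log ‖x‖ := by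
    field_simp; ring
  rw [e2]
  have h2 : ε * Real.log (1 + Mf f x) ≤ c * Real.log (1 + Mf f x) := 
    mul_le_mul_of_nonneg_right (min_le_right _ _) hl1
  have h3 : (a + c) / 2 * Real.log ‖x‖ ≤ (a - 2 * ε) * Real.log ‖x‖ :=
    mul_le_mul_of_nonneg_right (by linarith [min_le_left ((a - c) / 4) c]) hl2
  change Vf f x ≤ K + ε * Real.log (1 + Mf f x) - (a - 2 * ε) * Real.log ‖x‖ at h1
  linarith

lemma tonelli3 {X S Y : Type*} [MeasurableSpace X] [MeasurableSpace S] [MeasurableSpace Y]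
    {μ : Measure X} {ν : Measure S} {ρ : Measure Y} [SFinite μ] [SFinite ν] [SFinite ρ]
    {K : X → S → Y → ℝ≥0∞} (hK : Measurable (fun p : X × (S × Y) => K p.1 p.2.1 p.2.2)) :
    ∫⁻ x, ∫⁻ s, ∫⁻ y, K x s y ∂ρ ∂ν ∂μ = ∫⁻ s, ∫⁻ y, ∫⁻ x, K x s y ∂μ ∂ρ ∂ν := by
  have m0 : Measurable (fun q : (X × S) × Y => K q.1.1 q.1.2 q.2) := 
    hK.comp (by fun_prop : Measurable (fun q : (X × S) × Y => (q.1.1, (q.1.2, q.2))))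
  rw [lintegral_lintegral_swap (m0.lintegral_prod_right').aemeasurable]
  refine lintegral_congr fun s => ?_
  have m2 : Measurable (fun p : X × Y => K p.1 s p.2) := 
      hK.comp (by fun_prop : Measurable (fun p : X × Y => (p.1, (s, p.2))))
  rw [lintegral_lintegral_swap m2.aemeasurable]

lemma Mf_lint {n : ℕ} {f : Eu n → ℝ} (hc : Continuous f) (hf : Integrable f) :
    ∫⁻ x, ‖Mf f x‖ₑ ≠ ⊤ := by
  have hmeas : Measurable (fun p : Eu n × (ℝ × Eu n) => ‖chi n p.2.2 * |f (p.1 + p.2.1 • p.2.2)|‖ₑ) := by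
    have : Continuous (fun p : Eu n × (ℝ × Eu n) => chi n p.2.2 * |f (p.1 + p.2.1 • p.2.2)|) :=
      ((chi_cont n).comp (by fun_prop)).mul ((continuous_abs.comp hc).comp (by fun_prop))
    exact this.measurable.enorm
  have hb : ∀ x, ‖Mf f x‖ₑ ≤ ∫⁻ s in Set.Ioc (0:ℝ) 1, ∫⁻ y, ‖chi n y * |f (x + s • y)|‖ₑ := by
    intro x
    unfold Mf
    rw [intervalIntegral.integral_of_le zero_le_one]
    refine (enorm_integral_le_lintegral_enorm _).trans ?_
    refine setLIntegral_mono' measurableSet_Ioc fun s hs => ?_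
    rw [enorm_mul]
    have : ‖s ^ (n - 2)‖ₑ ≤ 1 := by
      rw [Real.enorm_eq_ofReal (pow_nonneg hs.1.le _), ENNReal.ofReal_le_one]
      exact pow_le_one₀ hs.1.le hs.2
    calc _ ≤ 1 * ‖∫ y, chi n y * |f (x + s • y)|‖ₑ := by gcongr
      _ ≤ _ := by rw [one_mul]; exact enorm_integral_le_lintegral_enorm _
  refine ne_top_of_le_ne_top ?_ (lintegral_mono hb)
  have e1 : ∫⁻ x, ∫⁻ s in Set.Ioc (0:ℝ) 1, ∫⁻ y, ‖chi n y * |f (x + s • y)|‖ₑ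
      = ∫⁻ s in Set.Ioc (0:ℝ) 1, ∫⁻ y : Eu n, ∫⁻ x, ‖chi n y * |f (x + s • y)|‖ₑ := by
    exact tonelli3 (μ := volume) (ν := volume.restrict (Set.Ioc (0:ℝ) 1)) (ρ := volume)
      (K := fun (x : Eu n) (s : ℝ) (y : Eu n) => ‖chi n y * |f (x + s • y)|‖ₑ) hmeas
  rw [e1]
  have e2 : ∀ (s : ℝ) (y : Eu n), ∫⁻ x, ‖chi n y * |f (x + s • y)|‖ₑ = ‖chi n y‖ₑ * ∫⁻ x, ‖f x‖ₑ := by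
    intro s y
    simp only [enorm_mul]
    rw [lintegral_const_mul _ (Continuous.measurable (by fun_prop)).enorm]
    congr 1
    rw [← lintegral_add_right_eq_self (fun x => ‖f x‖ₑ) (s • y)]
    simp
  simp only [e2]
  rw [lintegral_mul_const _ (chi_cont n).measurable.enorm]
  simp only [lintegral_const, MeasurableSet.univ, Measure.restrict_apply, Set.univ_inter, 
    Real.volume_Ioc]
  have hchi := ((chi_cont n).integrable_of_hasCompactSupport (μ := volume) (chi_cpt n)).2
  have hf2 := hf.2
  refine ENNReal.mul_ne_top (ENNReal.mul_ne_top hchi.ne hf2.ne) (by simp)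

lemma growth_base {n : ℕ} {h : Eu n → ℝ} (hc : Continuous h) (hi : Integrable h) {φ : ℝ → ℝ} {ρ : ℝ}
    (hφ : Continuous φ) (hρ : ∀ s, ρ ≤ s → φ s = 0) :
    ∃ C : ℝ, 0 ≤ C ∧ ∀ R : ℝ, 0 ≤ R → |∫ y : Eu n, φ (‖y‖ ^ 2) * h (R • y)| ≤ C := by
  have hcpt := radial_hasCompactSupport (n := n) hρ
  have hcont : Continuous (fun y : Eu n => φ (‖y‖ ^ 2)) := by fun_prop
  obtain ⟨K, hK⟩ := hcpt.exists_bound_of_continuous hcont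
  have hK0 : 0 ≤ K := (norm_nonneg _).trans (hK 0)
  have hI : Continuous (fun R : ℝ => ∫ y : Eu n, φ (‖y‖ ^ 2) * h (R • y)) :=
    param_cont (w := fun (R : ℝ) (y : Eu n) => h (R • y)) hcont hcpt (hc.comp (by fun_prop))
  obtain ⟨C1, hC1⟩ := isCompact_Icc.exists_bound_of_continuousOn (s := Set.Icc (0:ℝ) 1) hI.continuousOn
  have hA : 0 ≤ ∫ z, |h z| := integral_nonneg fun _ => abs_nonneg _
  refine ⟨max C1 (K * ∫ z, |h z|), le_max_of_le_right (by positivity), fun R hR => ?_⟩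
  rcases le_total R 1 with h1 | h1
  · exact (hC1 R ⟨hR, h1⟩).trans (le_max_left _ _)
  · refine le_trans ?_ (le_max_right _ _)
    have hR0 : R ≠ 0 := by positivity
    have e := Measure.integral_comp_smul (volume : Measure (Eu n)) (fun z => |h z|) R
    have hi2 : Integrable (fun y : Eu n => |h (R • y)|) := (hi.abs).comp_smul hR0
    calc |∫ y : Eu n, φ (‖y‖ ^ 2) * h (R • y)| ≤ ∫ y : Eu n, K * |h (R • y)| := by
          refine abs_int_le (hi2.const_mul K) (ae_of_all _ fun y => ?_)
          rw [norm_mul]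
          exact mul_le_mul_of_nonneg_right (hK y) (norm_nonneg _)
      _ = K * ∫ y : Eu n, |h (R • y)| := integral_const_mul _ _
      _ ≤ K * ∫ z, |h z| := by
          refine mul_le_mul_of_nonneg_left ?_ hK0
          rw [e, smul_eq_mul]
          refine mul_le_of_le_one_left hA ?_
          rw [abs_of_pos (by positivity)]
          exact inv_le_one_of_one_le₀ (one_le_pow₀ h1)

lemma growth {n m : ℕ} {u : Eu n → ℝ} (hu : ContDiff ℝ (⊤ : ℕ∞) u)
    (hNint : Integrable (negLapIter m u)) (k : ℕ) : ∀ j, j + k = m → ∀ (φ : ℝ → ℝ) (ρ : ℝ), 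
    Continuous φ → (∀ s, ρ ≤ s → φ s = 0) → ∃ C : ℝ, 0 ≤ C ∧ ∀ R : ℝ, 0 ≤ R → 
      |∫ y : Eu n, φ (‖y‖ ^ 2) * negLapIter j u (R • y)| ≤ C * (1 + R ^ 2) ^ k := by
  induction k with
  | zero =>
    intro j hj φ ρ hφ hρ
    obtain rfl : j = m := by omega
    obtain ⟨C, h0, hC⟩ := growth_base (negLap_smooth j hu).continuous hNint hφ hρ
    exact ⟨C, h0, fun R hR => by simpa using hC R hR⟩
  | succ k ih =>
    intro j hj φ ρ hφ hρ
    let G : ℝ → ℝ := fun s => -(1/2) * ∫ t in ρ..s, φ t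
    have hGd : ∀ s, HasDerivAt G (-(1/2) * φ s) s := fun s =>
      (intervalIntegral.integral_hasDerivAt_right (hφ.intervalIntegrable _ _)
        (hφ.stronglyMeasurableAtFilter _ _) hφ.continuousAt).const_mul _
    have hGd' : deriv G = fun s => -(1/2) * φ s := funext fun s => (hGd s).deriv
    have hGz : ∀ s, ρ ≤ s → G s = 0 := by
      intro s hs
      have : ∫ t in ρ..s, φ t = ∫ t in ρ..s, 0 := intervalIntegral.integral_congr (fun t ht => by
        rw [Set.uIcc_of_le hs] at ht
        exact hρ t ht.1)
      simp [G, this]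
    have hG1 : ContDiff ℝ 1 G := by
      rw [contDiff_one_iff_deriv]
      refine ⟨fun s => (hGd s).differentiableAt, ?_⟩
      rw [hGd']; fun_prop
    obtain ⟨C, hC0, hC⟩ := ih (j+1) (by omega) G ρ hG1.continuous hGz
    have hw := negLap_smooth j hu
    have hD := fun s => lemA (n := n) hG1 hGz (by intro s hs; simp [hGd', hρ s hs]) hw 0 s
    have e1 : ∀ s, -2 * deriv G s = φ s := by intro s; rw [hGd']; ring
    simp only [e1, zero_add] at hD
    refine ⟨|∫ y : Eu n, φ (‖y‖ ^ 2) * negLapIter j u ((0:ℝ) • y)| + C, by positivity, fun R hR => ?_⟩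
    have hb : ∀ s ∈ Set.Icc 0 R, ‖s * ∫ y, G (‖y‖ ^ 2) * laplacian (negLapIter j u) (s • y)‖ ≤ 
        R * (C * (1 + R ^ 2) ^ k) := by
      intro s hs
      have h1 := hC s hs.1
      rw [negLapIter_succ'] at h1
      simp only [mul_neg, integral_neg, abs_neg] at h1
      rw [norm_mul, Real.norm_of_nonneg hs.1, Real.norm_eq_abs]
      have h2 : s ^ 2 ≤ R ^ 2 := pow_le_pow_left₀ hs.1 hs.2 2
      have h3 : C * (1 + s ^ 2) ^ k ≤ C * (1 + R ^ 2) ^ k := by gcongr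
      exact mul_le_mul hs.2 (h1.trans h3) (abs_nonneg _) hR
    have := (convex_Icc 0 R).norm_image_sub_le_of_norm_hasDerivWithin_le
        (fun s _ => (hD s).hasDerivWithinAt) hb (Set.left_mem_Icc.2 hR) (Set.right_mem_Icc.2 hR)
    simp only [sub_zero, Real.norm_eq_abs, abs_of_nonneg hR] at this
    set I0 := ∫ y : Eu n, φ (‖y‖ ^ 2) * negLapIter j u ((0:ℝ) • y)
    set IR := ∫ y : Eu n, φ (‖y‖ ^ 2) * negLapIter j u (R • y)
    have t := abs_sub_abs_le_abs_sub IR I0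
    have p1 : 1 ≤ (1 + R ^ 2) ^ (k+1) := one_le_pow₀ (by nlinarith)
    have p2 : R * (C * (1 + R ^ 2) ^ k) * R ≤ C * (1 + R ^ 2) ^ (k+1) := by
      have h0 : 0 ≤ C * (1 + R ^ 2) ^ k := by positivity
      have h1 : C * (1 + R ^ 2) ^ (k+1) = R * (C * (1 + R ^ 2) ^ k) * R + C * (1 + R ^ 2) ^ k := by
        rw [pow_succ]; ring
      linarith
    nlinarith [abs_nonneg I0]

lemma u_plus {n : ℕ} (hn : 1 ≤ n) {u Q : Eu n → ℝ} (hu : Continuous u)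
    (hQ : ∀ δ > (0 : ℝ), ∃ Rδ : ℝ, ∀ x : Eu n, Rδ ≤ ‖x‖ → Real.exp (-δ * ‖x‖ ^ 2) ≤ Q x) :
    ∃ C : ℝ, 0 ≤ C ∧ ∀ x, max (u x) 0 ≤ |Q x * Real.exp (n * u x)| + C + ‖x‖ ^ 2 := by
  obtain ⟨R, hR⟩ := hQ 1 one_pos
  obtain ⟨C, hC⟩ := (isCompact_closedBall (0 : Eu n) R).exists_bound_of_continuousOn hu.continuousOn
  refine ⟨|C|, abs_nonneg _, fun x => ?_⟩
  refine max_le ?_ (by positivity)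
  rcases le_total R ‖x‖ with h | h
  · have h1 := hR x h
    have h2 : Real.exp (-1 * ‖x‖ ^ 2) * Real.exp (n * u x) ≤ Q x * Real.exp (n * u x) :=
      mul_le_mul_of_nonneg_right h1 (Real.exp_pos _).le
    rw [← Real.exp_add] at h2
    have h3 := Real.add_one_le_exp (-1 * ‖x‖ ^ 2 + n * u x)
    have h4 := le_abs_self (Q x * Real.exp (n * u x))
    have hn' : (1:ℝ) ≤ n := by exact_mod_cast hn
    rcases le_total (u x) 0 with h5 | h5
    · have : 0 ≤ |Q x * Real.exp (n * u x)| + |C| + ‖x‖ ^ 2 := by positivity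
      linarith
    · have : u x ≤ n * u x := by nlinarith
      linarith [abs_nonneg C]
  · have h1 := hC x (by simpa using h)
    have := (le_abs_self _).trans h1
    have h4 := abs_nonneg (Q x * Real.exp (n * u x))
    have := le_abs_self C
    nlinarith [norm_nonneg x]

lemma abs_growth {m n : ℕ} (hn : 1 ≤ n) (hm : 1 ≤ m) {u Q : Eu n → ℝ} (hu : ContDiff ℝ (⊤ : ℕ∞) u)
    (hc : Continuous (fun y => Q y * Real.exp (n * u y)))
    (hNint : Integrable (negLapIter m u))
    (hf : Integrable (fun y => Q y * Real.exp (n * u y)))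
    (hQ : ∀ δ > (0 : ℝ), ∃ Rδ : ℝ, ∀ x : Eu n, Rδ ≤ ‖x‖ → Real.exp (-δ * ‖x‖ ^ 2) ≤ Q x) :
    ∃ C : ℝ, 0 ≤ C ∧ ∀ R : ℝ, 0 ≤ R → 
      ∫ y : Eu n, max 0 (5 - ‖y‖ ^ 2) * |u (R • y)| ≤ C * (1 + R ^ 2) ^ m := by
  have hφ : Continuous (fun s : ℝ => max 0 (5 - s)) := by fun_prop
  have hρ : ∀ s : ℝ, 5 ≤ s → max 0 (5 - s) = 0 := fun s hs => max_eq_left (by linarith)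
  obtain ⟨C1, h1, hC1⟩ := growth hu hNint m 0 (by omega) _ 5 hφ hρ
  obtain ⟨C2, h2, hC2⟩ := growth_base (continuous_abs.comp hc) hf.abs hφ hρ
  obtain ⟨C3, h3, hC3⟩ := u_plus hn hu.continuous hQ
  have hΦ : Continuous (fun y : Eu n => max 0 (5 - ‖y‖ ^ 2)) := by fun_prop
  have hΦc : HasCompactSupport (fun y : Eu n => max 0 (5 - ‖y‖ ^ 2)) := 
    radial_hasCompactSupport (G := fun s : ℝ => max 0 (5 - s)) hρ
  have hΦi := hΦ.integrable_of_hasCompactSupport (μ := volume) hΦc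
  have hΦ0 : ∀ y : Eu n, 0 ≤ max 0 (5 - ‖y‖ ^ 2) := fun y => le_max_left _ _
  set T := ∫ y : Eu n, max 0 (5 - ‖y‖ ^ 2) with hT
  have hT0 : 0 ≤ T := integral_nonneg hΦ0
  refine ⟨C1 + 2 * C2 + 2 * (C3 + 5) * T, by positivity, fun R hR => ?_⟩
  have huc : Continuous (fun y : Eu n => u (R • y)) := hu.continuous.comp (by fun_prop)
  have hfc : Continuous (fun y : Eu n => |Q (R • y) * Real.exp (n * u (R • y))|) := 
    (continuous_abs.comp hc).comp (by fun_prop : Continuous (fun y : Eu n => R • y))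
  have i1 := cpt_integrable hΦ hΦc huc
  have i2 := cpt_integrable hΦ hΦc hfc
  have key : ∫ y : Eu n, max 0 (5 - ‖y‖ ^ 2) * |u (R • y)| ≤ 
      ∫ y : Eu n, (2 * (max 0 (5 - ‖y‖ ^ 2) * |Q (R • y) * Real.exp (n * u (R • y))|) 
        + 2 * (C3 + 5 * R ^ 2) * max 0 (5 - ‖y‖ ^ 2)
        - max 0 (5 - ‖y‖ ^ 2) * u (R • y)) := by
    refine integral_mono (cpt_integrable hΦ hΦc (continuous_abs.comp huc)) 
      (((i2.const_mul 2).add (hΦi.const_mul _)).sub i1) fun y => ?_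
    have a1 : |u (R • y)| = 2 * max (u (R • y)) 0 - u (R • y) := by
      rcases le_total (u (R • y)) 0 with h | h
      · rw [abs_of_nonpos h, max_eq_right h]; ring
      · rw [abs_of_nonneg h, max_eq_left h]; ring
    have a2 := hC3 (R • y)
    rw [norm_smul, Real.norm_of_nonneg hR] at a2
    simp only [a1]
    rcases le_total (5 - ‖y‖ ^ 2) 0 with h | h
    · rw [max_eq_left h]; simp
    · rw [max_eq_right h]
      have : (R * ‖y‖) ^ 2 ≤ 5 * R ^ 2 := by
        rw [mul_pow]; nlinarith [sq_nonneg R]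
      have a3 : max (u (R • y)) 0 ≤ |Q (R • y) * Real.exp (n * u (R • y))| + C3 + 5 * R ^ 2 := by
        linarith
      nlinarith [mul_le_mul_of_nonneg_left a3 h]
  refine key.trans ?_
  have i3 : Integrable (fun y : Eu n => 2 * (max 0 (5 - ‖y‖ ^ 2) * |Q (R • y) * Real.exp (n * u (R • y))|) 
        + 2 * (C3 + 5 * R ^ 2) * max 0 (5 - ‖y‖ ^ 2)) := (i2.const_mul 2).add (hΦi.const_mul _)
  rw [integral_sub i3 i1, integral_add (i2.const_mul 2) (hΦi.const_mul _), integral_const_mul, integral_const_mul]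
  have b1 := (abs_le.1 (hC1 R hR)).1
  have b2 := (abs_le.1 (hC2 R hR)).2
  have e0 : negLapIter 0 u = u := rfl
  rw [e0] at b1
  simp only [Function.comp] at b2
  rw [← hT]
  have p : 1 + R ^ 2 ≤ (1 + R ^ 2) ^ m := le_self_pow₀ (by nlinarith) (by omega)
  have p1 : 1 ≤ (1 + R ^ 2) ^ m := by nlinarith
  have q1 : C2 ≤ C2 * (1 + R ^ 2) ^ m := by nlinarith
  have q2 : (C3 + 5 * R ^ 2) * T ≤ (C3 + 5) * T * (1 + R ^ 2) ^ m := by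
    calc (C3 + 5 * R ^ 2) * T ≤ ((C3 + 5) * (1 + R ^ 2)) * T := by gcongr; nlinarith
      _ = (C3 + 5) * T * (1 + R ^ 2) := by ring
      _ ≤ _ := by gcongr
  nlinarith

lemma cconst_pos (n : ℕ) : 0 < cconst n := by unfold cconst; positivity

lemma psi_tsupport (m n : ℕ) {y : Eu n} (hy : 1 < ‖y‖) : y ∉ tsupport (psi m n) := by
  intro h
  have : tsupport (psi m n) ⊆ closedBall 0 1 := by
    refine closure_minimal ?_ isClosed_closedBall
    intro z hz
    by_contra h2
    simp only [mem_closedBall, dist_zero_right, not_le] at h2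
    exact hz (psi_zero m n h2.le)
  have := this h
  simp only [mem_closedBall, dist_zero_right] at this
  linarith

lemma p_identity {m n : ℕ} (hm : 1 ≤ m) (hn : n = 2 * m) {u f : Eu n → ℝ} (hu : ContDiff ℝ (⊤ : ℕ∞) u)
    (hf : ∀ x, negLapIter m u x = 2 * f x) (hc : Continuous f) (x : Eu n) (R : ℝ) :
    2 * cconst n * u x = (∫ y, psi m n y * u (x + R • y)) + 2 * ∫ s in (0:ℝ)..R, Bf f x s := by
  have hd := fun s => psi_deriv hm hn hu x s
  have e : ∀ s, -(s ^ (n - 1) * ∫ y, chi n y * negLapIter m u (x + s • y)) = -2 * Bf f x s := by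
    intro s
    unfold Bf
    simp only [hf]
    have : ∀ y : Eu n, chi n y * (2 * f (x + s • y)) = 2 * (chi n y * f (x + s • y)) := fun y => by ring
    simp only [this, integral_const_mul]
    ring
  simp only [e] at hd
  have h := intervalIntegral.integral_eq_sub_of_hasDerivAt (fun s _ => hd s) 
    (((Bf_cont1 hc x).const_mul (-2)).intervalIntegrable 0 R)
  rw [intervalIntegral.integral_const_mul] at h
  simp only [zero_smul, add_zero] at h
  rw [integral_mul_const, psi_integral hm hn] at h
  linarith

lemma rep_line {m n : ℕ} (hm : 1 ≤ m) (hn : n = 2 * m) {u Q : Eu n → ℝ} (hu : ContDiff ℝ (⊤ : ℕ∞) u)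
    (hPDE : ∀ x, negLapIter m u x = 2 * (Q x * Real.exp (n * u x)))
    (hc : Continuous (fun y => Q y * Real.exp (n * u y)))
    (hf : Integrable (fun y => Q y * Real.exp (n * u y)))
    (hQ : ∀ δ > (0 : ℝ), ∃ Rδ : ℝ, ∀ x : Eu n, Rδ ≤ ‖x‖ → Real.exp (-δ * ‖x‖ ^ 2) ≤ Q x) 
    {θ : Eu n} (hθ : ‖θ‖ = 1) :
    ∃ p : Polynomial ℝ, ∀ t : ℝ, u (t • θ) = u 0 + 
      Vf (fun y => Q y * Real.exp (n * u y)) (t • θ) / cconst n + p.eval t := by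
  set f : Eu n → ℝ := fun y => Q y * Real.exp (n * u y) with hfdef
  have hc0 := cconst_pos n
  have hNint : Integrable (negLapIter m u) := by
    have : negLapIter m u = fun x => 2 * f x := funext hPDE
    rw [this]; exact hf.const_mul 2
  obtain ⟨CG, hCG0, hCG⟩ := abs_growth (by omega) hm hu hc hNint hf hQ
  obtain ⟨a, C, ha1, ha2, hC0, ha3, hC⟩ := taylor (-θ) (n+1) (psi_smooth m n) (psi_cpt m n)
  -- the polynomials
  let b : ℕ → ℕ → ℝ := fun j i => (∫ y, a i y * u (((j:ℝ)+1) • y)) / ((j:ℝ)+1) ^ i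
  let p0 : ℕ → ℝ := fun j => ∫ y, psi m n y * u (0 + ((j:ℝ)+1) • y)
  let q : ℕ → ℝ → ℝ := fun j t => (∑ i ∈ Finset.range (n+1), b j i * t ^ i) - p0 j
  have hq : ∀ j, ∃ c : ℕ → ℝ, ∀ t, q j t = ∑ i ∈ Finset.range (n+1), c i * t ^ i := by
    intro j
    refine ⟨fun i => b j i - if i = 0 then p0 j else 0, fun t => ?_⟩
    simp only [q, sub_mul, Finset.sum_sub_distrib]
    congr 1
    simp
  have herr : ∀ (t : ℝ) (j : ℕ), |t| ≤ (j:ℝ) + 1 → 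
      |(∫ y, psi m n y * u (t • θ + ((j:ℝ)+1) • y)) - ∑ i ∈ Finset.range (n+1), b j i * t ^ i| ≤ 
        (C * CG * 2 ^ m * |t| ^ (n+1)) / ((j:ℝ)+1) := by
    intro t j htj
    set R : ℝ := (j:ℝ) + 1 with hR
    have hR1 : 1 ≤ R := by rw [hR]; linarith [(Nat.cast_nonneg j : (0:ℝ) ≤ j)]
    have hR0 : 0 < R := by linarith
    set τ := t / R with hτ
    have hτ1 : |τ| ≤ 1 := by rw [hτ, abs_div, abs_of_pos hR0, div_le_one hR0]; exact htj
    have hvc : Continuous (fun y : Eu n => u (R • y)) := hu.continuous.comp (by fun_prop)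
    have e1 : ∫ y, psi m n y * u (t • θ + R • y) = ∫ y, psi m n (y + τ • (-θ)) * u (R • y) := by
      rw [← integral_sub_right_eq_self (fun y => psi m n y * u (t • θ + R • y)) (τ • θ)]
      refine integral_congr_ae (ae_of_all _ fun y => ?_)
      have : t • θ + R • (y - τ • θ) = R • y := by
        rw [smul_sub, smul_smul, hτ, mul_div_cancel₀ _ hR0.ne']; abel
      change psi m n (y - τ • θ) * u (t • θ + R • (y - τ • θ)) = psi m n (y + τ • (-θ)) * u (R • y)
      rw [this, smul_neg, ← sub_eq_add_neg]
    have e2 : ∑ i ∈ Finset.range (n+1), b j i * t ^ i = 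
        ∫ y, (∑ i ∈ Finset.range (n+1), a i y * τ ^ i) * u (R • y) := by
      simp only [Finset.sum_mul]
      rw [integral_finsetSum]
      · refine Finset.sum_congr rfl fun i _ => ?_
        have : ∀ y, a i y * τ ^ i * u (R • y) = τ ^ i * (a i y * u (R • y)) := fun y => by ring
        simp only [this, integral_const_mul]
        simp only [b, hτ, div_pow]
        ring
      · intro i _
        have := (cpt_integrable (ha1 i) (ha2 i) hvc).const_mul (τ ^ i)
        refine this.congr (ae_of_all _ fun y => by ring)
    have i1 : Integrable (fun y => psi m n (y + τ • (-θ)) * u (R • y)) := by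
      refine cpt_integrable ((psi_smooth m n).continuous.comp (by fun_prop)) ?_ hvc
      exact (psi_cpt m n).comp_homeomorph (Homeomorph.addRight (τ • (-θ)))
    have i2 : Integrable (fun y => (∑ i ∈ Finset.range (n+1), a i y * τ ^ i) * u (R • y)) := by
      simp only [Finset.sum_mul]
      refine integrable_finsetSum _ fun i _ => ?_
      have := (cpt_integrable (ha1 i) (ha2 i) hvc).const_mul (τ ^ i)
      refine this.congr (ae_of_all _ fun y => by ring)
    rw [e1, e2, ← integral_sub i1 i2]
    have hΦ : Continuous (fun y : Eu n => max 0 (5 - ‖y‖ ^ 2)) := by fun_prop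
    have hΦc : HasCompactSupport (fun y : Eu n => max 0 (5 - ‖y‖ ^ 2)) := 
      radial_hasCompactSupport (G := fun s : ℝ => max 0 (5 - s)) (ρ := 5)
        fun s hs => max_eq_left (by linarith)
    have i3 := (cpt_integrable hΦ hΦc (continuous_abs.comp hvc)).const_mul (C * |τ| ^ (n+1))
    refine (abs_int_le i3 (ae_of_all _ fun y => ?_)).trans ?_
    · rw [← sub_mul, norm_mul]
      simp only [Function.comp, Real.norm_eq_abs]
      rw [← mul_assoc]
      refine mul_le_mul_of_nonneg_right ?_ (abs_nonneg _)
      by_cases hy : ‖y‖ ≤ 2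
      · have : 1 ≤ max 0 (5 - ‖y‖ ^ 2) := le_max_of_le_right (by nlinarith [norm_nonneg y])
        exact (hC y τ).trans (le_mul_of_one_le_right (by positivity) this)
      · push Not at hy
        have z1 : ∀ i, a i y = 0 := fun i => ha3 i y (psi_tsupport m n (by linarith))
        have z2 : psi m n (y + τ • (-θ)) = 0 := by
          refine psi_zero m n ?_
          have := norm_sub_norm_le y (τ • θ)
          rw [norm_smul, hθ, mul_one, Real.norm_eq_abs] at this
          rw [smul_neg, ← sub_eq_add_neg]
          linarith
        simp only [z1, z2, zero_mul, Finset.sum_const_zero, sub_zero, abs_zero]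
        exact mul_nonneg (by positivity) (le_max_left _ _)
    · rw [integral_const_mul]
      have g := hCG R hR0.le
      have g2 : (1 + R ^ 2) ^ m ≤ 2 ^ m * R ^ n := by
        rw [hn, pow_mul, ← mul_pow]
        gcongr
        nlinarith
      calc C * |τ| ^ (n+1) * ∫ y : Eu n, max 0 (5 - ‖y‖ ^ 2) * |u (R • y)| 
          ≤ C * |τ| ^ (n+1) * (CG * (2 ^ m * R ^ n)) := by
            refine mul_le_mul_of_nonneg_left (g.trans ?_) (by positivity)
            gcongr
        _ = _ := by
            rw [hτ, abs_div, abs_of_pos hR0, div_pow, pow_succ R n]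
            field_simp
  have hcast : Tendsto (fun j : ℕ => (j:ℝ) + 1) atTop atTop := 
    tendsto_atTop_add_const_right _ _ tendsto_natCast_atTop_atTop
  have hl : ∀ t, Tendsto (fun j => q j t) atTop 
      (𝓝 (2 * cconst n * u (t • θ) - 2 * cconst n * u 0 - 2 * Vf f (t • θ))) := by
    intro t
    have h1 := ((Vf_tendsto (by omega) hc hf (t • θ)).comp hcast).const_mul 2
    have h2 : Tendsto (fun j : ℕ => (∑ i ∈ Finset.range (n+1), b j i * t ^ i) - 
        ∫ y, psi m n y * u (t • θ + ((j:ℝ)+1) • y)) atTop (𝓝 0) := by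
      refine squeeze_zero_norm' ?_ ((tendsto_const_nhds (x := C * CG * 2 ^ m * |t| ^ (n+1))).div_atTop hcast)
      filter_upwards [hcast.eventually_ge_atTop |t|] with j hj
      rw [Real.norm_eq_abs, abs_sub_comm]
      exact herr t j hj
    have h3 := (tendsto_const_nhds (x := 2 * cconst n * u (t • θ) - 2 * cconst n * u 0)).sub h1
    have h4 := h3.add h2
    rw [add_zero] at h4
    refine h4.congr fun j => ?_
    have p1 := p_identity hm hn hu hPDE hc (t • θ) ((j:ℝ)+1)
    have p2 := p_identity hm hn hu hPDE hc 0 ((j:ℝ)+1)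
    simp only [Function.comp, q, p0]
    rw [intervalIntegral.integral_sub ((Bf_cont1 hc _).intervalIntegrable _ _) 
      ((Bf_cont1 hc _).intervalIntegrable _ _)]
    linarith
  obtain ⟨p, hp⟩ := poly_limit hq hl
  refine ⟨Polynomial.C (1 / (2 * cconst n)) * p, fun t => ?_⟩
  rw [Polynomial.eval_mul, Polynomial.eval_C, ← hp t]
  field_simp
  ring

lemma ray_finite {n : ℕ} {g M : ℝ → ℝ} (hg : Continuous g) (hM : ∀ t, 0 ≤ M t) {C η r0 : ℝ}
    (hC : 0 ≤ C) (hη : 0 < η) (hr0 : 1 ≤ r0)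
    (h : ∀ t, r0 ≤ t → Real.exp (g t) ≤ C * (1 + M t) * t ^ (-1 - η))
    (hfin : ∫⁻ t in Set.Ioi (0:ℝ), ENNReal.ofReal (t ^ (n-1)) * ‖M t‖ₑ < ⊤) :
    ∫⁻ t in Set.Ioi (0:ℝ), ENNReal.ofReal (Real.exp (g t)) < ⊤ := by
  have hr : 0 < r0 := by linarith
  rw [← Set.Ioc_union_Ioi_eq_Ioi hr.le, lintegral_union measurableSet_Ioi Set.Ioc_disjoint_Ioi_same]
  refine ENNReal.add_lt_top.2 ⟨?_, ?_⟩
  · have hi : IntegrableOn (fun t => Real.exp (g t)) (Set.Ioc 0 r0) := 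
      (Real.continuous_exp.comp hg).integrableOn_Ioc
    have := hi.2
    unfold HasFiniteIntegral at this
    simpa [Real.enorm_eq_ofReal (Real.exp_pos _).le] using this
  · have hb : ∀ t ∈ Set.Ioi r0, ENNReal.ofReal (Real.exp (g t)) ≤ 
        ENNReal.ofReal C * (ENNReal.ofReal (t ^ (-1 - η)) + ENNReal.ofReal (t ^ (n-1)) * ‖M t‖ₑ) := by
      intro t ht
      have ht' : r0 < t := ht
      have ht0 : 0 < t := by linarith
      have ht1 : 1 ≤ t := by linarith
      rw [Real.enorm_eq_ofReal (hM t), ← ENNReal.ofReal_mul (by positivity), 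
        ← ENNReal.ofReal_add (by positivity) (mul_nonneg (by positivity) (hM t)), 
        ← ENNReal.ofReal_mul hC]
      refine ENNReal.ofReal_le_ofReal ((h t ht'.le).trans ?_)
      rw [mul_assoc]
      refine mul_le_mul_of_nonneg_left ?_ hC
      have a1 : t ^ (-1 - η) ≤ 1 := Real.rpow_le_one_of_one_le_of_nonpos ht1 (by linarith)
      have a2 : 1 ≤ t ^ (n-1) := one_le_pow₀ ht1
      have := hM t
      have := mul_le_mul_of_nonneg_right (a1.trans a2) (hM t)
      linarith
    refine (setLIntegral_mono' measurableSet_Ioi hb).trans_lt ?_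
    rw [lintegral_const_mul' _ _ ENNReal.ofReal_ne_top]
    refine ENNReal.mul_lt_top ENNReal.ofReal_lt_top ?_
    rw [lintegral_add_left (by fun_prop)]
    refine ENNReal.add_lt_top.2 ⟨?_, ?_⟩
    · have hi := (integrableOn_Ioi_rpow_of_lt (a := -1 - η) (by linarith) hr).2
      unfold HasFiniteIntegral at hi
      refine lt_of_le_of_lt (setLIntegral_mono' measurableSet_Ioi fun t ht => ?_) hi
      have ht' : r0 < t := ht
      have ht0 : 0 < t := by linarith
      rw [Real.enorm_eq_ofReal (by positivity)]
    · exact (lintegral_mono_set (Set.Ioi_subset_Ioi hr.le)).trans_lt hfin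

lemma poly_quad (p : Polynomial ℝ) (h1 : ∀ K T : ℝ, ∃ t ≥ T, K < p.eval t)
    (h2 : ∀ K T : ℝ, ∃ t ≥ T, K < p.eval (-t)) : 
    ∃ c > (0:ℝ), ∃ T : ℝ, ∀ t ≥ T, c * t ^ 2 ≤ p.eval t := by
  by_cases hd : p.natDegree ≤ 1
  · exfalso
    rw [Polynomial.eq_X_add_C_of_natDegree_le_one hd] at h1 h2
    simp only [Polynomial.eval_add, Polynomial.eval_mul, Polynomial.eval_C, Polynomial.eval_X] at h1 h2
    rcases le_total (p.coeff 1) 0 with h | h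
    · obtain ⟨t, ht, hk⟩ := h1 (p.coeff 0) 0
      nlinarith
    · obtain ⟨t, ht, hk⟩ := h2 (p.coeff 0) 0
      nlinarith
  · push Not at hd
    have hdeg : 0 < p.degree := by rw [← Polynomial.natDegree_pos_iff_degree_pos]; omega
    have hlc : 0 ≤ p.leadingCoeff := by
      by_contra hneg
      push Not at hneg
      have := Polynomial.tendsto_atBot_of_leadingCoeff_nonpos p hdeg hneg.le
      obtain ⟨T, hT⟩ := eventually_atTop.1 (this.eventually_le_atBot 0)
      obtain ⟨t, ht, hk⟩ := h1 0 T
      linarith [hT t ht]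
    have hpos := Polynomial.tendsto_atTop_of_leadingCoeff_nonneg p hdeg hlc
    have hO := Polynomial.isBigO_atTop_of_degree_le (Polynomial.X ^ 2) p (by
      rw [Polynomial.degree_X_pow]
      rw [Polynomial.degree_eq_natDegree (by rintro rfl; simp at hd)]
      exact_mod_cast hd)
    obtain ⟨K, hK0, hK⟩ := hO.exists_pos
    have hK' := hK.bound
    obtain ⟨T, hT⟩ := eventually_atTop.1 (hK'.and (hpos.eventually_ge_atTop 0))
    refine ⟨K⁻¹, by positivity, T, fun t ht => ?_⟩
    obtain ⟨b1, b2⟩ := hT t ht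
    simp only [Polynomial.eval_pow, Polynomial.eval_X, Real.norm_eq_abs] at b1
    rw [abs_of_nonneg b2, abs_of_nonneg (by positivity)] at b1
    rw [← div_eq_inv_mul, div_le_iff₀ hK0, mul_comm]
    exact b1

lemma not_fin {n : ℕ} {F : ℝ → ℝ} {T : ℝ} (hT : 1 ≤ T) (h : ∀ t, T ≤ t → 1 ≤ F t) :
    ∫⁻ t in Set.Ioi (0:ℝ), ENNReal.ofReal (t ^ (n-1)) * ‖F t‖ₑ = ⊤ := by
  rw [eq_top_iff]
  calc (⊤ : ℝ≥0∞) = ∫⁻ t in Set.Ioi T, 1 := by simp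
    _ ≤ ∫⁻ t in Set.Ioi T, ENNReal.ofReal (t ^ (n-1)) * ‖F t‖ₑ := by
      refine setLIntegral_mono' measurableSet_Ioi fun t ht => ?_
      have ht' : T < t := ht
      have h1 := h t ht'.le
      rw [Real.enorm_eq_ofReal (by linarith), ← ENNReal.ofReal_mul (pow_nonneg (by linarith) _)]
      rw [ENNReal.one_le_ofReal]
      have a2 : 1 ≤ t ^ (n-1) := one_le_pow₀ (by linarith)
      nlinarith
    _ ≤ _ := lintegral_mono_set (Set.Ioi_subset_Ioi (by linarith))

lemma main_bound (m n : ℕ) (hm : 2 ≤ m) (hn : n = 2 * m)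
    (u Q : Eu n → ℝ) (hu : ContDiff ℝ (⊤ : ℕ∞) u)
    (hPDE : ∀ x, negLapIter m u x = 2 * Q x * Real.exp (n * u x))
    (hf : MeasureTheory.Integrable (fun y => Q y * Real.exp (n * u y)))
    (hQ : ∀ δ > (0 : ℝ), ∃ Rδ : ℝ, ∀ x : Eu n, Rδ ≤ ‖x‖ →
      Real.exp (-δ * ‖x‖ ^ 2) ≤ Q x)
    (hcomplete : ∀ θ : Eu n, ‖θ‖ = 1 →
      ∫⁻ r in Set.Ioi (0 : ℝ), ENNReal.ofReal (Real.exp (u (r • θ))) = ⊤) :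
    (∫ y, Q y * Real.exp (n * u y)) ≤ cconst n := by
  by_contra hcon
  push Not at hcon
  have hPDE' : ∀ x, negLapIter m u x = 2 * (Q x * Real.exp (n * u x)) := fun x => by
    rw [hPDE x]; ring
  have hc : Continuous (fun y => Q y * Real.exp (n * u y)) := by
    have : (fun y => Q y * Real.exp (n * u y)) = fun y => (1/2) * negLapIter m u y := by
      ext y; rw [hPDE' y]; ring
    rw [this]
    exact (negLap_smooth m hu).continuous.const_mul _
  have hrep := fun θ (hθ : ‖θ‖ = 1) => rep_line (by omega) hn hu hPDE' hc hf hQ (θ := θ) hθ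
  have hc0 := cconst_pos n
  set c := cconst n
  obtain ⟨R0, hR0⟩ := hQ 1 one_pos
  have hfpos : ∀ z : Eu n, R0 ≤ ‖z‖ → 0 ≤ Q z * Real.exp (n * u z) := fun z hz =>
    mul_nonneg ((Real.exp_pos _).le.trans (hR0 z hz)) (Real.exp_pos _).le
  obtain ⟨f, hfdef⟩ : ∃ f : Eu n → ℝ, f = fun y => Q y * Real.exp (n * u y) := ⟨_, rfl⟩
  have hfpos' : ∀ z : Eu n, R0 ≤ ‖z‖ → 0 ≤ f z := by rw [hfdef]; exact hfpos
  simp only [← hfdef] at hf hc hrep hcon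
  obtain ⟨C, η, r0, hC, hη, hr0, hV⟩ := V_exp (by omega) hc hf hc0 hcon
  obtain ⟨K, r1, hr1, hVl⟩ := V_lower (by omega) hc hf hfpos'
  have hMc := Mf_cont hc
  have hMm : Measurable (fun x => ‖Mf f x‖ₑ) := hMc.measurable.enorm
  have hMm' : Measurable (fun x => ‖Mf f (-x)‖ₑ) := (hMc.comp continuous_neg).measurable.enorm
  have hMi := Mf_lint hc hf
  have hMi' : ∫⁻ x, ‖Mf f (-x)‖ₑ ≠ ⊤ := by
    rw [lintegral_neg_eq_self (fun x => ‖Mf f x‖ₑ)]; exact hMi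
  have hfm : Measurable (fun x => ‖f x‖ₑ) := hc.measurable.enorm
  obtain ⟨θ, hθ, hfin⟩ := polar (n := n) (by omega) (Ψ := fun x => ‖Mf f x‖ₑ + ‖Mf f (-x)‖ₑ + ‖f x‖ₑ)
    ((hMm.add hMm').add hfm) (by
      rw [lintegral_add_right _ hfm, lintegral_add_right _ hMm']
      exact ENNReal.add_ne_top.2 ⟨ENNReal.add_ne_top.2 ⟨hMi, hMi'⟩, hf.2.ne⟩)
  have hfin1 : ∫⁻ r in Set.Ioi (0:ℝ), ENNReal.ofReal (r ^ (n-1)) * ‖Mf f (r • θ)‖ₑ < ⊤ := by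
    refine lt_of_le_of_lt (lintegral_mono fun r => ?_) hfin
    refine mul_le_mul_right ?_ _
    rw [add_assoc]; exact le_self_add
  have hfin2 : ∫⁻ r in Set.Ioi (0:ℝ), ENNReal.ofReal (r ^ (n-1)) * ‖Mf f (r • (-θ))‖ₑ < ⊤ := by
    refine lt_of_le_of_lt (lintegral_mono fun r => ?_) hfin
    refine mul_le_mul_right ?_ _
    rw [smul_neg]
    exact le_trans le_add_self le_self_add
  have hfin3 : ∫⁻ r in Set.Ioi (0:ℝ), ENNReal.ofReal (r ^ (n-1)) * ‖f (r • θ)‖ₑ < ⊤ := by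
    refine lt_of_le_of_lt (lintegral_mono fun r => ?_) hfin
    refine mul_le_mul_right ?_ _
    exact le_add_self
  obtain ⟨p, hp⟩ := hrep θ hθ
  have key : ∀ ω : Eu n, ‖ω‖ = 1 → 
      (∫⁻ r in Set.Ioi (0:ℝ), ENNReal.ofReal (r ^ (n-1)) * ‖Mf f (r • ω)‖ₑ < ⊤) → 
      ∀ g : ℝ → ℝ, (∀ t : ℝ, u (t • ω) = u 0 + Vf f (t • ω) / c + g t) → 
      ∀ K T : ℝ, ∃ t ≥ T, K < g t := by
    intro ω hω hfinω g hg K T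
    by_contra hno
    push Not at hno
    refine (ray_finite (n := n) (g := fun t => u (t • ω)) (M := fun t => Mf f (t • ω)) 
      (hu.continuous.comp (by fun_prop)) (fun t => Mf_nonneg f _) (C := Real.exp (u 0 + K) * C) 
      (η := η) (r0 := max r0 T) (by positivity) hη (hr0.trans (le_max_left _ _)) ?_ hfinω).ne 
      (hcomplete ω hω)
    intro t ht
    have t0 : r0 ≤ t := (le_max_left _ _).trans ht
    have t1 : T ≤ t := (le_max_right _ _).trans ht
    have hnorm : ‖t • ω‖ = t := by
      rw [norm_smul, hω, mul_one, Real.norm_of_nonneg (by linarith)]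
    have v := hV (t • ω) (by rw [hnorm]; exact t0)
    rw [hnorm] at v
    simp only [hg]
    calc Real.exp (u 0 + Vf f (t • ω) / c + g t) ≤ Real.exp (u 0 + K + Vf f (t • ω) / c) :=
          Real.exp_le_exp.2 (by linarith [hno t t1])
      _ = Real.exp (u 0 + K) * Real.exp (Vf f (t • ω) / c) := Real.exp_add _ _
      _ ≤ Real.exp (u 0 + K) * (C * (1 + Mf f (t • ω)) * t ^ (-1 - η)) := by gcongr
      _ = _ := by ring
  have k1 := key θ hθ hfin1 (fun t => p.eval t) hp
  have k2 := key (-θ) (by rw [norm_neg, hθ]) hfin2 (fun t => p.eval (-t)) (fun t => by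
    have := hp (-t)
    rwa [neg_smul, ← smul_neg] at this)
  obtain ⟨c', hc', T, hT⟩ := poly_quad p k1 k2
  have hn1 : (1:ℝ) ≤ n := by exact_mod_cast (by omega : 1 ≤ n)
  obtain ⟨Rδ, hRδ⟩ := hQ (n * c' / 2) (by positivity)
  set A := ∫ z, |f z| with hA
  have hA0 : 0 ≤ A := integral_nonneg fun _ => abs_nonneg _
  set D := n * (2 * A / c) with hD
  have hD0 : 0 ≤ D := by positivity
  set E := n * (u 0 - K / c) with hE
  set al := n * c' / 2 with hal
  have hal0 : 0 < al := by positivity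
  set T' := max (max r1 T) (max Rδ ((D + |E|) / al)) with hT'
  refine hfin3.ne (not_fin (n := n) (F := fun t => f (t • θ)) (T := T') 
    (hr1.trans ((le_max_left _ _).trans (le_max_left _ _))) fun t ht => ?_)
  have t1 : r1 ≤ t := ((le_max_left _ _).trans (le_max_left _ _)).trans ht
  have t2 : T ≤ t := ((le_max_right _ _).trans (le_max_left _ _)).trans ht
  have t3 : Rδ ≤ t := ((le_max_left _ _).trans (le_max_right _ _)).trans ht
  have t4 : (D + |E|) / al ≤ t := ((le_max_right _ _).trans (le_max_right _ _)).trans ht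
  have t5 : 1 ≤ t := hr1.trans t1
  have hnorm : ‖t • θ‖ = t := by
      rw [norm_smul, hθ, mul_one, Real.norm_of_nonneg (by linarith)]
  have q1 := hRδ (t • θ) (by rw [hnorm]; exact t3)
  have q2 := hVl (t • θ) (by rw [hnorm]; exact t1)
  rw [hnorm] at q1 q2
  have q3 := hT t t2
  have q4 := hp t
  have q5 : Real.log t ≤ t := (Real.log_le_sub_one_of_pos (by linarith)).trans (by linarith)
  rw [div_le_iff₀ hal0] at t4
  have q6 : - K / c - (2 * A / c) * t ≤ Vf f (t • θ) / c := by
    rw [le_div_iff₀ hc0]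
    have : (- K / c - (2 * A / c) * t) * c = -K - 2 * A * t := by field_simp
    rw [this]
    have : 2 * A * Real.log t ≤ 2 * A * t := by gcongr
    linarith
  have q7 : E - D * t + 2 * al * t ^ 2 ≤ n * u (t • θ) := by
    have : E - D * t + 2 * al * t ^ 2 = n * (u 0 + (- K / c - (2 * A / c) * t) + c' * t ^ 2) := by
      rw [hE, hD, hal]; ring
    rw [this]
    refine mul_le_mul_of_nonneg_left ?_ (by linarith)
    rw [q4]; linarith
  have q8 : 0 ≤ -al * t ^ 2 + n * u (t • θ) := by
    have w1 : (D + |E|) * t ≤ al * t ^ 2 := by nlinarith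
    have w2 : |E| ≤ |E| * t := by nlinarith [abs_nonneg E]
    have w3 := neg_abs_le E
    linarith
  have : f (t • θ) = Q (t • θ) * Real.exp (n * u (t • θ)) := by rw [hfdef]
  change 1 ≤ f (t • θ)
  rw [this]
  calc (1:ℝ) ≤ Real.exp (-al * t ^ 2 + n * u (t • θ)) := Real.one_le_exp q8
    _ = Real.exp (-al * t ^ 2) * Real.exp (n * u (t • θ)) := Real.exp_add _ _
    _ ≤ _ := by gcongr

/-- Under completeness and the decay assumption on `Q`, the total `Q`-curvature satisfies
`(1/c_n) * ∫ Q e^{nu} ≤ 1`, equivalently `∫ Q e^{nu} ≤ c_n`. -/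
theorem stmt6 (m n : ℕ) (hm : 2 ≤ m) (hn : n = 2 * m)
    (u Q : EuclideanSpace ℝ (Fin n) → ℝ) (hu : ContDiff ℝ (⊤ : ℕ∞) u)
    (hPDE : ∀ x, negLapIter m u x = 2 * Q x * Real.exp (n * u x))
    (hf : MeasureTheory.Integrable (fun y => Q y * Real.exp (n * u y)))
    (hQ : ∀ δ > (0 : ℝ), ∃ Rδ : ℝ, ∀ x : EuclideanSpace ℝ (Fin n), Rδ ≤ ‖x‖ →
      Real.exp (-δ * ‖x‖ ^ 2) ≤ Q x)
    (hcomplete : ∀ θ : EuclideanSpace ℝ (Fin n), ‖θ‖ = 1 →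
      ∫⁻ r in Set.Ioi (0 : ℝ), ENNReal.ofReal (Real.exp (u (r • θ))) = ⊤) :
    (1 / cconst n) * (∫ y, Q y * Real.exp (n * u y)) ≤ 1 ∧
      (∫ y, Q y * Real.exp (n * u y)) ≤ cconst n := by
  have h := main_bound m n hm hn u Q hu hPDE hf hQ hcomplete
  refine ⟨?_, h⟩
  rw [one_div, ← div_eq_inv_mul, div_le_one (cconst_pos n)]
  exact h
end

section
/- Let n = 2m ≥ 4 be an even integer and c_n = 2^{n-2}((n-2)/2)! π^{n/2}. Let f ∈ L¹(ℝⁿ) be a continuous radial function (f(y) depends only on |y|), and let u(x) = (1/c_n)∫_{ℝⁿ} log(|y|/|x-y|) f(y) dy + C, which is a radial function u = u(r). Then lim_{r→∞} r u'(r) = -(1/c_n)∫_{ℝⁿ} f(y) dy. Equivalently, lim_{|x|→∞} ∫_{ℝⁿ} (y·(y-x)/|y-x|²) f(y) dy = 0. -/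
open MeasureTheory Real Filter Metric
open scoped ENNReal Topology

section
open scoped RealInnerProductSpace
variable {E : Type*} [NormedAddCommGroup E] [InnerProductSpace ℝ E] [FiniteDimensional ℝ E]
  [MeasurableSpace E] [BorelSpace E]

lemma locint (hd : 4 ≤ Module.finrank ℝ E) :
    IntegrableOn (fun z : E => (‖z‖ ^ 2)⁻¹) (ball 0 1) volume := by
  have : Nontrivial E := Module.nontrivial_of_finrank_pos (R := ℝ) (by omega)
  rw [integrableOn_fun_norm_addHaar (E := E) volume (f := fun r : ℝ => (r ^ 2)⁻¹)]
  have h : IntegrableOn (fun y : ℝ => y ^ (Module.finrank ℝ E - 3)) (Set.Ioo 0 1) :=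
    ((continuous_pow _).integrableOn_Icc).mono_set Set.Ioo_subset_Icc_self
  refine h.congr_fun ?_ measurableSet_Ioo
  intro y hy
  have hy0 : y ≠ 0 := hy.1.ne'
  obtain ⟨k, hk⟩ := Nat.exists_eq_add_of_le hd
  rw [hk]
  simp only [smul_eq_mul]
  have e1 : 4 + k - 3 = k + 1 := by omega
  have e2 : 4 + k - 1 = k + 3 := by omega
  rw [e1, e2]
  field_simp
  ring

lemma master (hd : 4 ≤ Module.finrank ℝ E) {f : E → ℝ} (hf : Integrable f) (x : E) (M : ℝ)
    (hM : ∀ y ∈ ball x 1, |f y| ≤ M) :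
    Integrable (fun y => |f y| * (‖x - y‖ ^ 2)⁻¹) ∧
    ∫ y, |f y| * (‖x - y‖ ^ 2)⁻¹ ≤ M * (∫ z in ball (0:E) 1, (‖z‖ ^ 2)⁻¹) + ∫ y, |f y| := by
  have h1 := (locint hd).integrable_indicator measurableSet_ball
  have h2 := h1.comp_sub_left x
  have hle : ∀ y, |f y| * (‖x - y‖ ^ 2)⁻¹ ≤
      M * (ball (0:E) 1).indicator (fun z : E => (‖z‖ ^ 2)⁻¹) (x - y) + |f y| := by
    intro y
    by_cases hy : x - y ∈ ball (0:E) 1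
    · rw [Set.indicator_of_mem hy]
      have := hM y (by rw [mem_ball_zero_iff] at hy; rwa [mem_ball, dist_comm, dist_eq_norm])
      have := mul_le_mul_of_nonneg_right this (by positivity : 0 ≤ (‖x - y‖ ^ 2)⁻¹)
      linarith [abs_nonneg (f y)]
    · rw [Set.indicator_of_notMem hy, mul_zero, zero_add]
      rw [mem_ball_zero_iff, not_lt] at hy
      apply mul_le_of_le_one_right (abs_nonneg _)
      apply inv_le_one_of_one_le₀
      nlinarith
  have hint := (h2.const_mul M).add hf.abs
  have hI : Integrable (fun y => |f y| * (‖x - y‖ ^ 2)⁻¹) := by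
    refine hint.mono ?_ ?_
    · apply AEStronglyMeasurable.mul hf.abs.aestronglyMeasurable
      exact (by fun_prop : Measurable fun y : E => (‖x - y‖ ^ 2)⁻¹).aestronglyMeasurable
    · refine Eventually.of_forall fun y => ?_
      rw [Real.norm_of_nonneg (by positivity)]
      exact (hle y).trans (le_abs_self _)
  refine ⟨hI, (integral_mono hI hint hle).trans ?_⟩
  simp only [Pi.add_apply]
  rw [integral_add (h2.const_mul M) hf.abs, integral_const_mul,
    integral_sub_left_eq_self (fun z => (ball (0:E) 1).indicator (fun z : E => (‖z‖ ^ 2)⁻¹) z) volume x,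
    integral_indicator measurableSet_ball]

lemma remainder (z h : E) (hz : z ≠ 0) (hzh : z + h ≠ 0) :
    |Real.log ‖z + h‖ - Real.log ‖z‖ - ⟪z, h⟫ * (‖z‖ ^ 2)⁻¹| ≤
      ‖h‖ ^ 2 * ((‖z + h‖ ^ 2)⁻¹ + (‖z‖ ^ 2)⁻¹) := by
  have ha : 0 < ‖z + h‖ := norm_pos_iff.2 hzh
  have hb : 0 < ‖z‖ := norm_pos_iff.2 hz
  have hexp : ‖z + h‖ ^ 2 = ‖z‖ ^ 2 + 2 * ⟪z, h⟫ + ‖h‖ ^ 2 := norm_add_sq_real z h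
  have hab : |‖z + h‖ - ‖z‖| ≤ ‖h‖ := by
    simpa using abs_norm_sub_norm_le (z + h) z
  generalize ‖z + h‖ = a at *
  generalize ‖z‖ = b at *
  generalize ‖h‖ = t at *
  have hs : ⟪z, h⟫ = (a ^ 2 - b ^ 2 - t ^ 2) / 2 := by linarith
  rw [hs]
  have l1 : Real.log (a ^ 2 / b ^ 2) ≤ a ^ 2 / b ^ 2 - 1 := Real.log_le_sub_one_of_pos (by positivity)
  have l2 : Real.log (b ^ 2 / a ^ 2) ≤ b ^ 2 / a ^ 2 - 1 := Real.log_le_sub_one_of_pos (by positivity)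
  rw [Real.log_div (by positivity) (by positivity), Real.log_pow, Real.log_pow] at l1 l2
  push_cast at l1 l2
  have ht : (a - b) ^ 2 ≤ t ^ 2 := by
    rw [← sq_abs (a - b)]; exact pow_le_pow_left₀ (abs_nonneg _) hab 2
  have h3 : (a ^ 2 - b ^ 2) ^ 2 ≤ t ^ 2 * (2 * (a ^ 2 + b ^ 2)) := by
    have : (a ^ 2 - b ^ 2) ^ 2 = (a - b) ^ 2 * (a + b) ^ 2 := by ring
    rw [this]
    apply mul_le_mul ht _ (by positivity) (by positivity)
    nlinarith [sq_nonneg (a - b)]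
  have h4 : (a ^ 2 - b ^ 2) ^ 2 * ((a ^ 2)⁻¹ * (b ^ 2)⁻¹) ≤ 2 * t ^ 2 * ((a ^ 2)⁻¹ + (b ^ 2)⁻¹) := by
    have := mul_le_mul_of_nonneg_right h3 (by positivity : 0 ≤ (a ^ 2)⁻¹ * (b ^ 2)⁻¹)
    refine this.trans (le_of_eq ?_)
    field_simp
    ring
  have h5 : (a ^ 2 - b ^ 2) ^ 2 * ((a ^ 2)⁻¹ * (b ^ 2)⁻¹) = a ^ 2 / b ^ 2 + b ^ 2 / a ^ 2 - 2 := by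
    field_simp
    ring
  have h6 : (a ^ 2 - b ^ 2 - t ^ 2) / 2 * (b ^ 2)⁻¹ = (a ^ 2 / b ^ 2 - 1 - t ^ 2 * (b ^ 2)⁻¹) / 2 := by
    field_simp
  have h7 : 0 ≤ t ^ 2 * (a ^ 2)⁻¹ := by positivity
  have h8 : 0 ≤ t ^ 2 * (b ^ 2)⁻¹ := by positivity
  rw [h6, abs_le]
  constructor <;> nlinarith

lemma bddball {f : E → ℝ} (hc : Continuous f) (x : E) (R : ℝ) :
    ∃ M, ∀ y ∈ ball x R, |f y| ≤ M := by
  obtain ⟨M, hM⟩ := (isCompact_closedBall x R).exists_bound_of_continuousOn hc.continuousOn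
  exact ⟨M, fun y hy => hM y (ball_subset_closedBall hy)⟩

lemma int_sq (hd : 4 ≤ Module.finrank ℝ E) {f : E → ℝ} (hf : Integrable f) (hc : Continuous f)
    (x : E) : Integrable (fun y => |f y| * (‖x - y‖ ^ 2)⁻¹) := by
  obtain ⟨M, hM⟩ := bddball hc x 1
  exact (master hd hf x M hM).1

lemma int_vec (hd : 4 ≤ Module.finrank ℝ E) {f : E → ℝ} (hf : Integrable f) (hc : Continuous f)
    (x : E) : Integrable (fun y => (f y * (‖x - y‖ ^ 2)⁻¹) • (x - y)) := by
  refine (hf.abs.add (int_sq hd hf hc x)).mono ?_ ?_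
  · have hm := hc.measurable
    exact (by fun_prop : Measurable _).aestronglyMeasurable
  · refine Eventually.of_forall fun y => ?_
    simp only [Pi.add_apply]
    rw [norm_smul, norm_mul, Real.norm_of_nonneg (by positivity : 0 ≤ |f y| + |f y| * (‖x - y‖ ^ 2)⁻¹),
      Real.norm_of_nonneg (by positivity : 0 ≤ (‖x - y‖ ^ 2)⁻¹), Real.norm_eq_abs, mul_assoc,
      ← mul_one_add]
    apply mul_le_mul_of_nonneg_left _ (abs_nonneg _)
    rcases (norm_nonneg (x - y)).eq_or_lt with h | h
    · rw [← h]; simp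
    · generalize ‖x - y‖ = a at h
      field_simp
      nlinarith [sq_nonneg (a - 1)]

lemma int_inner (hd : 4 ≤ Module.finrank ℝ E) {f : E → ℝ} (hf : Integrable f) (hc : Continuous f)
    (x h : E) : Integrable (fun y => ⟪x - y, h⟫ * (‖x - y‖ ^ 2)⁻¹ * f y) := by
  refine ((int_vec hd hf hc x).inner_const (𝕜 := ℝ) h).congr (Eventually.of_forall fun y => ?_)
  simp only [real_inner_smul_left]
  ring

lemma ae_ne' (hd : 4 ≤ Module.finrank ℝ E) (x : E) : ∀ᵐ y : E, y ≠ x := by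
  have : Nontrivial E := Module.nontrivial_of_finrank_pos (R := ℝ) (by omega)
  exact Measure.ae_ne volume x

lemma int_log (hd : 4 ≤ Module.finrank ℝ E) {f : E → ℝ} (hf : Integrable f) (hc : Continuous f)
    (x : E) : Integrable (fun y => Real.log (‖y‖ / ‖x - y‖) * f y) := by
  have h1 := (int_inner hd hf hc 0 x).abs
  have h2 := ((int_sq hd hf hc x).add (int_sq hd hf hc 0)).const_mul (‖x‖ ^ 2)
  refine (h1.add h2).mono ?_ ?_
  · have hm := hc.measurable
    exact (by fun_prop : Measurable _).aestronglyMeasurable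
  · filter_upwards [ae_ne' hd (0:E), ae_ne' hd x] with y hy0 hyx
    have hxy : -y + x ≠ 0 := fun h => hyx (by rw [neg_add_eq_sub, sub_eq_zero] at h; exact h.symm)
    have r := remainder (-y) x (neg_ne_zero.2 hy0) hxy
    rw [neg_add_eq_sub] at r hxy
    rw [Real.log_div (norm_ne_zero_iff.2 hy0) (norm_ne_zero_iff.2 hxy)]
    simp only [Pi.add_apply, zero_sub]
    rw [norm_neg] at r ⊢
    rw [norm_mul, Real.norm_eq_abs, Real.norm_eq_abs, Real.norm_eq_abs, abs_mul]
    refine le_trans ?_ (le_abs_self _)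
    rw [show ∀ A B C D F: ℝ, A * B + C * (B * D + B * F) = (A + C * (D + F)) * B by intros; ring]
    apply mul_le_mul_of_nonneg_right _ (abs_nonneg _)
    have := abs_sub_abs_le_abs_sub (Real.log ‖x - y‖ - Real.log ‖y‖) (⟪-y, x⟫ * (‖y‖ ^ 2)⁻¹)
    rw [abs_sub_comm (Real.log ‖y‖)]
    linarith

lemma grad (hd : 4 ≤ Module.finrank ℝ E) {f : E → ℝ} (hf : Integrable f) (hc : Continuous f)
    (u : E → ℝ) (a C : ℝ) (hu : ∀ x, u x = a * (∫ y, Real.log (‖y‖ / ‖x - y‖) * f y) + C) (x : E) :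
    HasGradientAt u ((-a) • ∫ y, (f y * (‖x - y‖ ^ 2)⁻¹) • (x - y)) x := by
  rw [hasGradientAt_iff_isLittleO_nhds_zero]
  obtain ⟨M, hM⟩ := bddball hc x 2
  set K := M * (∫ z in ball (0:E) 1, (‖z‖ ^ 2)⁻¹) + ∫ y, |f y|
  have key : ∀ h : E, ‖h‖ < 1 → ‖u (x + h) - u x -
      ⟪(-a) • ∫ y, (f y * (‖x - y‖ ^ 2)⁻¹) • (x - y), h⟫‖ ≤ (|a| * (2 * K)) * ‖‖h‖ ^ 2‖ := by
    intro h hh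
    have m1 := master hd hf x M (fun y hy => hM y (ball_subset_ball (by norm_num) hy))
    have m2 := master hd hf (x + h) M (fun y hy => hM y (by
      rw [mem_ball] at hy ⊢
      have := dist_triangle y (x + h) x
      rw [dist_self_add_left] at this
      linarith))
    have e : u (x + h) - u x - ⟪(-a) • ∫ y, (f y * (‖x - y‖ ^ 2)⁻¹) • (x - y), h⟫ =
        a * ∫ y, (Real.log (‖y‖ / ‖x + h - y‖) * f y - Real.log (‖y‖ / ‖x - y‖) * f y +
          ⟪x - y, h⟫ * (‖x - y‖ ^ 2)⁻¹ * f y) := by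
      have i1 := int_log hd hf hc (x + h)
      have i2 := int_log hd hf hc x
      have i3 := int_inner hd hf hc x h
      have i4 := i1.sub i2
      simp only [Pi.sub_def] at i4
      rw [integral_add i4 i3, integral_sub i1 i2, hu, hu, real_inner_smul_left,
        real_inner_comm, ← integral_inner (int_vec hd hf hc x)]
      have : ∀ y, ⟪h, (f y * (‖x - y‖ ^ 2)⁻¹) • (x - y)⟫ = ⟪x - y, h⟫ * (‖x - y‖ ^ 2)⁻¹ * f y := by
        intro y
        rw [real_inner_smul_right, real_inner_comm]; ring
      simp only [this]
      ring
    rw [e, norm_mul, Real.norm_eq_abs a, mul_assoc]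
    apply mul_le_mul_of_nonneg_left _ (abs_nonneg _)
    have hg := ((m2.1.add m1.1).const_mul (‖h‖ ^ 2))
    refine (norm_integral_le_of_norm_le hg ?_).trans ?_
    · filter_upwards [ae_ne' hd (0:E), ae_ne' hd x, ae_ne' hd (x + h)] with y hy0 hyx hyxh
      have r := remainder (x - y) h (sub_ne_zero.2 hyx.symm)
        (by rw [sub_add_eq_add_sub]; exact sub_ne_zero.2 hyxh.symm)
      rw [sub_add_eq_add_sub] at r
      rw [Real.log_div (norm_ne_zero_iff.2 hy0) (norm_ne_zero_iff.2 (sub_ne_zero.2 hyx.symm)),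
        Real.log_div (norm_ne_zero_iff.2 hy0) (norm_ne_zero_iff.2 (sub_ne_zero.2 hyxh.symm))]
      simp only [Pi.add_apply]
      have := mul_le_mul_of_nonneg_right r (abs_nonneg (f y))
      rw [← abs_mul] at this
      rw [Real.norm_eq_abs, ← abs_neg]
      refine (le_of_eq ?_).trans (this.trans (le_of_eq ?_))
      · congr 1; ring
      · ring
    · rw [integral_const_mul]
      simp only [Pi.add_apply]
      rw [integral_add m2.1 m1.1, Real.norm_of_nonneg (by positivity), mul_comm]
      apply mul_le_mul_of_nonneg_right _ (by positivity)
      linarith [m1.2, m2.2]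
  have hO : (fun h => u (x + h) - u x - ⟪(-a) • ∫ y, (f y * (‖x - y‖ ^ 2)⁻¹) • (x - y), h⟫) =O[𝓝 0]
      fun h : E => ‖h‖ ^ 2 := by
    apply Asymptotics.IsBigO.of_bound (|a| * (2 * K))
    filter_upwards [ball_mem_nhds (0:E) one_pos] with h hh
    exact key h (mem_ball_zero_iff.1 hh)
  exact hO.trans_isLittleO (Asymptotics.isLittleO_norm_pow_id (by norm_num))
lemma polar_s8 (hd : 4 ≤ Module.finrank ℝ E) {G : E → ℝ≥0∞} (hG : Measurable G) :
    ∫⁻ y, G y = ∫⁻ p : sphere (0:E) 1 × Set.Ioi (0:ℝ), G (p.2.1 • p.1.1)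
      ∂((volume : Measure E).toSphere.prod (Measure.volumeIoiPow (Module.finrank ℝ E - 1))) := by
  have : Nontrivial E := Module.nontrivial_of_finrank_pos (R := ℝ) (by omega)
  rw [← (volume : Measure E).measurePreserving_homeomorphUnitSphereProd.lintegral_comp_emb
    (Homeomorph.measurableEmbedding _)]
  have e : ∀ a : ({0}ᶜ : Set E), ((homeomorphUnitSphereProd E) a).2.1 •
      ((homeomorphUnitSphereProd E) a).1.1 = a.1 := by
    intro a
    rw [← homeomorphUnitSphereProd_symm_apply_coe, Homeomorph.symm_apply_apply]
  simp only [e]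
  rw [lintegral_subtype_comap (measurableSet_singleton _).compl, restrict_compl_singleton]

lemma lint_pow (N : ℕ) {g : ℝ → ℝ≥0∞} (hg : Measurable g) :
    ∫⁻ r : Set.Ioi (0:ℝ), g r.1 ∂(Measure.volumeIoiPow N) =
      ∫⁻ r in Set.Ioi (0:ℝ), ENNReal.ofReal (r ^ N) * g r := by
  rw [Measure.volumeIoiPow, lintegral_withDensity_eq_lintegral_mul _ (by fun_prop) (by fun_prop),
    ← lintegral_subtype_comap measurableSet_Ioi]
  rfl

lemma oneD (N : ℕ) {d : ℝ} (hd : 0 < d) (g : ℝ → ℝ≥0∞) (hg : Measurable g)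
    (h : ∀ r ∈ Set.Ioo (1:ℝ) 2, ENNReal.ofReal (((d + r - 1) ^ 2)⁻¹) ≤ g r) :
    ENNReal.ofReal d⁻¹ ≤ 1 + ∫⁻ r : Set.Ioi (0:ℝ), g r.1 ∂(Measure.volumeIoiPow N) := by
  rw [lint_pow N hg]
  have h1 : ∫⁻ r in Set.Ioo (1:ℝ) 2, ENNReal.ofReal (((d + r - 1) ^ 2)⁻¹) ≤
      ∫⁻ r in Set.Ioi (0:ℝ), ENNReal.ofReal (r ^ N) * g r := by
    refine le_trans ?_ (lintegral_mono_set (s := Set.Ioo (1:ℝ) 2) ?_)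
    · apply setLIntegral_mono' measurableSet_Ioo
      intro r hr
      refine (h r hr).trans (le_mul_of_one_le_left zero_le ?_)
      rw [ENNReal.one_le_ofReal]
      exact one_le_pow₀ hr.1.le
    · intro r hr; exact lt_trans one_pos hr.1
  have hcont : ContinuousOn (fun r : ℝ => ((d + r - 1) ^ 2)⁻¹) (Set.Icc 1 2) := by
    apply ContinuousOn.inv₀ (by fun_prop)
    intro r hr
    have : 0 < d + r - 1 := by linarith [hr.1]
    positivity
  have hii : IntervalIntegrable (fun r : ℝ => ((d + r - 1) ^ 2)⁻¹) volume 1 2 :=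
    ContinuousOn.intervalIntegrable_of_Icc (by norm_num) hcont
  have h2 : ∫ r in (1:ℝ)..2, ((d + r - 1) ^ 2)⁻¹ = d⁻¹ - (d + 1)⁻¹ := by
    rw [intervalIntegral.integral_eq_sub_of_hasDerivAt (f := fun r => -(d + r - 1)⁻¹) _ hii]
    · have : d + 2 - 1 = d + 1 := by ring
      rw [this]
      simp only [add_sub_cancel_right]
      ring
    · intro r hr
      rw [Set.uIcc_of_le (by norm_num)] at hr
      have hp : d + r - 1 ≠ 0 := by linarith [hr.1]
      have h4 : HasDerivAt (fun x : ℝ => d + x - 1) 1 r :=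
        ((hasDerivAt_id' r).const_add d).sub_const 1
      have h5 : HasDerivAt (fun x : ℝ => -(d + x - 1)⁻¹) (-(-1 / (d + r - 1) ^ 2)) r :=
        (h4.fun_inv hp).fun_neg
      rwa [neg_div, neg_neg, one_div] at h5
  have h3 : ∫⁻ r in Set.Ioo (1:ℝ) 2, ENNReal.ofReal (((d + r - 1) ^ 2)⁻¹) =
      ENNReal.ofReal (d⁻¹ - (d + 1)⁻¹) := by
    rw [← h2, intervalIntegral.integral_of_le (by norm_num), Measure.restrict_congr_set Ioo_ae_eq_Ioc,
      ofReal_integral_eq_lintegral_ofReal hii.1]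
    exact Eventually.of_forall fun r => by positivity
  refine le_trans ?_ (add_le_add_right h1 1)
  rw [h3, ← ENNReal.ofReal_one, ← ENNReal.ofReal_add zero_le_one]
  · apply ENNReal.ofReal_le_ofReal
    have : (d + 1)⁻¹ ≤ 1 := inv_le_one_of_one_le₀ (by linarith)
    linarith
  · rw [sub_nonneg]
    exact inv_anti₀ hd (by linarith)

lemma sphere_bound (hd : 4 ≤ Module.finrank ℝ E) : ∃ A : ℝ≥0∞, A ≠ ∞ ∧ ∀ e : E,
    ∫⁻ w : sphere (0:E) 1, ENNReal.ofReal (‖w.1 - e‖⁻¹) ∂(volume : Measure E).toSphere ≤ A := by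
  set σ := (volume : Measure E).toSphere
  set N := Module.finrank ℝ E - 1
  have hk : ∫⁻ z in ball (0:E) 1, (‖z‖ₑ ^ 2)⁻¹ ≠ ∞ := by
    have := (locint hd).2
    rw [hasFiniteIntegral_iff_enorm] at this
    refine ne_of_lt (lt_of_le_of_lt (le_of_eq ?_) this)
    apply lintegral_congr_ae
    filter_upwards [ae_restrict_of_ae (ae_ne' hd (0:E))] with z hz
    rw [enorm_inv (by simpa using hz), enorm_pow, enorm_norm]
  refine ⟨σ Set.univ + ((∫⁻ z in ball (0:E) 1, (‖z‖ₑ ^ 2)⁻¹) + volume (ball (0:E) 2)),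
    by simp [hk, measure_ball_lt_top.ne, measure_ne_top], fun e => ?_⟩
  set G : E → ℝ≥0∞ := (ball (0:E) 2).indicator (fun y => (‖y - e‖ₑ ^ 2)⁻¹)
  have hG : Measurable G := Measurable.indicator (by fun_prop) measurableSet_ball
  have hp : ∀ w : sphere (0:E) 1, ENNReal.ofReal (‖w.1 - e‖⁻¹) ≤
      1 + ∫⁻ r : Set.Ioi (0:ℝ), G (r.1 • w.1) ∂(Measure.volumeIoiPow N) := by
    intro w
    rcases (norm_nonneg (w.1 - e)).eq_or_lt with h | h
    · rw [← h]; simp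
    refine oneD N h (fun r => G (r • w.1)) (by fun_prop) ?_
    intro r hr
    have hw : ‖w.1‖ = 1 := by simpa using w.2
    have hmem : r • w.1 ∈ ball (0:E) 2 := by
      rw [mem_ball_zero_iff, norm_smul, hw, Real.norm_of_nonneg (by linarith [hr.1])]
      linarith [hr.2]
    simp only [G]
    rw [Set.indicator_of_mem hmem]
    have hpos : 0 < ‖w.1 - e‖ + r - 1 := by linarith [hr.1]
    rw [ENNReal.ofReal_inv_of_pos (by positivity), ENNReal.ofReal_pow hpos.le]
    refine ENNReal.inv_le_inv' (pow_le_pow_left' ?_ 2)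
    rw [← ofReal_norm]
    apply ENNReal.ofReal_le_ofReal
    have : r • w.1 - e = (w.1 - e) + (r - 1) • w.1 := by rw [sub_smul, one_smul]; abel
    rw [this]
    refine (norm_add_le _ _).trans ?_
    rw [norm_smul, hw, Real.norm_of_nonneg (by linarith [hr.1])]
    linarith
  refine (lintegral_mono hp).trans ?_
  rw [lintegral_add_left measurable_const, lintegral_const, one_mul]
  gcongr
  have hmeas : Measurable fun p : sphere (0:E) 1 × Set.Ioi (0:ℝ) => G (p.2.1 • p.1.1) := by
    apply hG.comp; fun_prop
  rw [← lintegral_prod (fun p : sphere (0:E) 1 × Set.Ioi (0:ℝ) => G (p.2.1 • p.1.1)) hmeas.aemeasurable, ← polar_s8 hd hG]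
  have hle : ∀ y, G y ≤ (ball (0:E) 1).indicator (fun z => (‖z‖ₑ ^ 2)⁻¹) (y - e) +
      (ball (0:E) 2).indicator 1 y := by
    intro y
    simp only [G]
    by_cases hy : y ∈ ball (0:E) 2
    · rw [Set.indicator_of_mem hy, Set.indicator_of_mem hy]
      by_cases h1 : y - e ∈ ball (0:E) 1
      · rw [Set.indicator_of_mem h1]; exact le_self_add
      · rw [Set.indicator_of_notMem h1, zero_add, Pi.one_apply]
        rw [mem_ball_zero_iff, not_lt] at h1
        rw [ENNReal.inv_le_one]
        apply one_le_pow₀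
        rw [← ofReal_norm, ENNReal.one_le_ofReal]
        exact h1
    · rw [Set.indicator_of_notMem hy]; exact zero_le
  refine (lintegral_mono hle).trans ?_
  rw [lintegral_add_right _ (measurable_one.indicator measurableSet_ball),
    lintegral_sub_right_eq_self (fun z => (ball (0:E) 1).indicator (fun z => (‖z‖ₑ ^ 2)⁻¹) z) e,
    lintegral_indicator measurableSet_ball, lintegral_indicator_one measurableSet_ball]

lemma radial_bound (hd : 4 ≤ Module.finrank ℝ E) : ∃ B : ℝ≥0∞, B ≠ ∞ ∧ ∀ F : E → ℝ≥0∞,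
    Measurable F → (∀ x y, ‖x‖ = ‖y‖ → F x = F y) → ∀ x : E,
    ∫⁻ y, ENNReal.ofReal (‖y‖ * ‖y - x‖⁻¹) * F y ≤ B * ∫⁻ y, F y := by
  have : Nontrivial E := Module.nontrivial_of_finrank_pos (R := ℝ) (by omega)
  obtain ⟨A, hA, hAe⟩ := sphere_bound hd
  set σ := (volume : Measure E).toSphere
  set N := Module.finrank ℝ E - 1
  have hσ0 : σ Set.univ ≠ 0 := by
    rw [Ne, Measure.measure_univ_eq_zero]; exact Measure.toSphere_ne_zero _
  have hσt : σ Set.univ ≠ ∞ := measure_ne_top _ _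
  refine ⟨A / σ Set.univ, ENNReal.div_ne_top hA hσ0, fun F hF hrad x => ?_⟩
  obtain ⟨w0, hw0⟩ := exists_norm_eq E zero_le_one
  have hFr : ∀ (r : Set.Ioi (0:ℝ)) (w : sphere (0:E) 1), F (r.1 • w.1) = F (r.1 • w0) := by
    intro r w
    apply hrad
    have hw : ‖w.1‖ = 1 := by simpa using w.2
    rw [norm_smul, norm_smul, hw, hw0]
  have hm1 : Measurable fun p : sphere (0:E) 1 × Set.Ioi (0:ℝ) => F (p.2.1 • p.1.1) := by
    apply hF.comp; fun_prop
  have hmG : Measurable fun y : E => ENNReal.ofReal (‖y‖ * ‖y - x‖⁻¹) * F y := by fun_prop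
  have hm2 : Measurable fun p : sphere (0:E) 1 × Set.Ioi (0:ℝ) =>
      ENNReal.ofReal (‖p.2.1 • p.1.1‖ * ‖p.2.1 • p.1.1 - x‖⁻¹) * F (p.2.1 • p.1.1) := by
    apply hmG.comp (f := fun p : sphere (0:E) 1 × Set.Ioi (0:ℝ) => p.2.1 • p.1.1); fun_prop
  have h1 : ∫⁻ y, F y = σ Set.univ * ∫⁻ r : Set.Ioi (0:ℝ), F (r.1 • w0) ∂(Measure.volumeIoiPow N) := by
    rw [polar_s8 hd hF, lintegral_prod_symm _ hm1.aemeasurable]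
    simp only [hFr, lintegral_const]
    rw [lintegral_mul_const _ (by fun_prop), mul_comm]
  rw [h1, ← mul_assoc, ENNReal.div_mul_cancel hσ0 hσt, polar_s8 hd hmG,
    lintegral_prod_symm _ hm2.aemeasurable, ← lintegral_const_mul _ (by fun_prop)]
  apply lintegral_mono
  intro r
  simp only [hFr]
  rw [lintegral_mul_const _ (by fun_prop)]
  gcongr
  refine le_trans (le_of_eq (lintegral_congr fun w => ?_)) (hAe (r.1⁻¹ • x))
  congr 1
  have hr : 0 < r.1 := r.2
  have hw : ‖w.1‖ = 1 := by simpa using w.2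
  have : r.1 • w.1 - x = r.1 • (w.1 - r.1⁻¹ • x) := by
    rw [smul_sub, smul_inv_smul₀ hr.ne']
  rw [this, norm_smul, norm_smul, hw, Real.norm_of_nonneg hr.le, mul_inv, mul_one, ← mul_assoc,
    mul_inv_cancel₀ hr.ne', one_mul]

lemma limit2 (hd : 4 ≤ Module.finrank ℝ E) {f : E → ℝ} (hf : Integrable f) (hc : Continuous f)
    (hrad : ∀ x y, ‖x‖ = ‖y‖ → f x = f y) :
    Tendsto (fun x : E => ∫ y, (⟪y, y - x⟫ / ‖y - x‖ ^ 2) * f y) (comap (fun x : E => ‖x‖) atTop)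
      (𝓝 0) := by
  obtain ⟨B, hB, hBF⟩ := radial_bound hd
  have hm := hc.measurable
  set F : ℕ → E → ℝ≥0∞ := fun k => {y : E | (k:ℝ) < ‖y‖}.indicator (fun y => ‖f y‖ₑ)
  have hset : ∀ k : ℕ, MeasurableSet {y : E | (k:ℝ) < ‖y‖} := fun k =>
    measurableSet_lt measurable_const measurable_norm
  have hFm : ∀ k, Measurable (F k) := fun k => Measurable.indicator (by fun_prop) (hset k)
  have hfin : ∫⁻ y, ‖f y‖ₑ ≠ ∞ := hf.2.ne
  have htail : Tendsto (fun k => B * ∫⁻ y, F k y) atTop (𝓝 0) := by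
    have := tendsto_lintegral_of_dominated_convergence (μ := (volume : Measure E)) (F := F)
      (f := fun _ => 0) (fun y => ‖f y‖ₑ) hFm
      (fun k => Eventually.of_forall fun y => Set.indicator_le_self _ _ y) hfin
      (Eventually.of_forall fun y => ?_)
    · rw [lintegral_zero] at this
      simpa using ENNReal.Tendsto.const_mul this (Or.inr hB)
    · obtain ⟨k0, hk0⟩ := exists_nat_ge ‖y‖
      refine tendsto_const_nhds.congr' ?_
      filter_upwards [eventually_ge_atTop k0] with k hk
      have : (k0:ℝ) ≤ k := by exact_mod_cast hk
      simp only [F]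
      rw [Set.indicator_of_notMem]
      simp only [Set.mem_ofPred_eq, not_lt]
      linarith
  have hbound : ∀ (k : ℕ) (x : E), (k:ℝ) < ‖x‖ → ‖∫ y, (⟪y, y - x⟫ / ‖y - x‖ ^ 2) * f y‖ₑ ≤
      ENNReal.ofReal (k * (‖x‖ - k)⁻¹) * (∫⁻ y, ‖f y‖ₑ) + B * ∫⁻ y, F k y := by
    intro k x hx
    refine (enorm_integral_le_lintegral_enorm _).trans ?_
    have hp : ∀ y, ‖(⟪y, y - x⟫ / ‖y - x‖ ^ 2) * f y‖ₑ ≤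
        ENNReal.ofReal (k * (‖x‖ - k)⁻¹) * ‖f y‖ₑ + ENNReal.ofReal (‖y‖ * ‖y - x‖⁻¹) * F k y := by
      intro y
      have h0 : ‖⟪y, y - x⟫ / ‖y - x‖ ^ 2‖ ≤ ‖y‖ * ‖y - x‖⁻¹ := by
        rw [norm_div, Real.norm_of_nonneg (by positivity : 0 ≤ ‖y - x‖ ^ 2)]
        rcases (norm_nonneg (y - x)).eq_or_lt with h | h
        · rw [← h]; simp
        · rw [div_le_iff₀ (by positivity)]
          refine (norm_inner_le_norm (𝕜 := ℝ) y (y - x)).trans (le_of_eq ?_)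
          field_simp
      have h1 : ‖(⟪y, y - x⟫ / ‖y - x‖ ^ 2)‖ₑ ≤ ENNReal.ofReal (‖y‖ * ‖y - x‖⁻¹) := by
        rw [← ofReal_norm]; exact ENNReal.ofReal_le_ofReal h0
      rw [enorm_mul]
      by_cases hy : (k:ℝ) < ‖y‖
      · simp only [F]
        rw [Set.indicator_of_mem (show y ∈ {y : E | (k:ℝ) < ‖y‖} from hy)]
        exact (mul_le_mul_left h1 _).trans le_add_self
      · refine le_trans ?_ le_self_add
        refine mul_le_mul_left (h1.trans (ENNReal.ofReal_le_ofReal ?_)) _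
        rw [not_lt] at hy
        apply mul_le_mul hy _ (by positivity) (by positivity)
        apply inv_anti₀ (by linarith)
        have := norm_sub_norm_le x y
        rw [norm_sub_rev] at this
        linarith
    refine (lintegral_mono hp).trans ?_
    rw [lintegral_add_left (by fun_prop), lintegral_const_mul _ (by fun_prop)]
    gcongr
    refine hBF (F k) (hFm k) ?_ x
    intro a b hab
    simp only [F, Set.indicator, Set.mem_ofPred_eq, hab, hrad a b hab]
  rw [tendsto_zero_iff_enorm_tendsto_zero, ENNReal.tendsto_nhds_zero]
  intro ε hε
  have hε2 : 0 < ε / 2 := ENNReal.half_pos hε.ne'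
  obtain ⟨k, hk⟩ := (ENNReal.tendsto_nhds_zero.1 htail (ε / 2) hε2).exists
  have hn : Tendsto (fun x : E => ‖x‖) (comap (fun x : E => ‖x‖) atTop) atTop := tendsto_comap
  have t1 : Tendsto (fun x : E => ENNReal.ofReal (k * (‖x‖ - k)⁻¹) * (∫⁻ y, ‖f y‖ₑ))
      (comap (fun x : E => ‖x‖) atTop) (𝓝 0) := by
    have a1 : Tendsto (fun x : E => (k:ℝ) * (‖x‖ - k)⁻¹) (comap (fun x : E => ‖x‖) atTop) (𝓝 0) := by
      have := (tendsto_inv_atTop_zero.comp (tendsto_atTop_add_const_right _ (-(k:ℝ)) hn)).const_mul (k:ℝ)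
      simpa [Function.comp_def, sub_eq_add_neg] using this
    have a2 := ENNReal.tendsto_ofReal a1
    have a3 := ENNReal.Tendsto.mul_const a2 (Or.inr hfin)
    simpa using a3
  filter_upwards [hn.eventually_gt_atTop (k:ℝ), ENNReal.tendsto_nhds_zero.1 t1 (ε / 2) hε2] with x hx h1
  refine (hbound k x hx).trans ?_
  rw [← ENNReal.add_halves ε]
  exact add_le_add h1 hk

lemma final (hd : 4 ≤ Module.finrank ℝ E) {f : E → ℝ} (hf : Integrable f) (hc : Continuous f)
    (u : E → ℝ) (a C : ℝ) (hu : ∀ x, u x = a * (∫ y, Real.log (‖y‖ / ‖x - y‖) * f y) + C) (x : E) :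
    ⟪x, gradient u x⟫ = -a * ((∫ y, f y) - ∫ y, (⟪y, y - x⟫ / ‖y - x‖ ^ 2) * f y) := by
  rw [(grad hd hf hc u a C hu x).gradient, real_inner_smul_right,
    ← integral_inner (int_vec hd hf hc x)]
  congr 1
  have hpt : ∀ᵐ y : E, (⟪y, y - x⟫ / ‖y - x‖ ^ 2) * f y =
      f y - ⟪x, (f y * (‖x - y‖ ^ 2)⁻¹) • (x - y)⟫ := by
    filter_upwards [ae_ne' hd x] with y hy
    have h0 : ‖x - y‖ ≠ 0 := norm_ne_zero_iff.2 (sub_ne_zero.2 hy.symm)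
    have e : ⟪y, y - x⟫ = ‖x - y‖ ^ 2 - ⟪x, x - y⟫ := by
      rw [← real_inner_self_eq_norm_sq, ← inner_sub_left, ← neg_sub x y, inner_neg_right,
        ← inner_neg_left]
      congr 1
      abel
    rw [e, real_inner_smul_right, norm_sub_rev y x]
    field_simp
  rw [integral_congr_ae hpt, integral_sub hf ((int_vec hd hf hc x).const_inner (𝕜 := ℝ) x)]
  ring

end

open scoped RealInnerProductSpace in
/-- For a radial potential `u`, `r u'(r) = x·∇u(x) → -(1/c_n)∫f`; equivalently
`∫ (y·(y-x)/|y-x|²) f(y) dy → 0` as `|x| → ∞`. -/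
theorem stmt8 (m n : ℕ) (hm : 2 ≤ m) (hn : n = 2 * m)
    (f : EuclideanSpace ℝ (Fin n) → ℝ) (hf : MeasureTheory.Integrable f)
    (hcont : Continuous f)
    (hradf : ∀ x y : EuclideanSpace ℝ (Fin n), ‖x‖ = ‖y‖ → f x = f y)
    (u : EuclideanSpace ℝ (Fin n) → ℝ) (C : ℝ)
    (hu : ∀ x, u x = (1 / cconst n) * (∫ y, Real.log (‖y‖ / ‖x - y‖) * f y) + C) :
    Filter.Tendsto (fun x : EuclideanSpace ℝ (Fin n) => ⟪x, gradient u x⟫)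
        (Filter.comap (fun x : EuclideanSpace ℝ (Fin n) => ‖x‖) Filter.atTop)
        (nhds (-(1 / cconst n) * ∫ y, f y)) ∧
      Filter.Tendsto (fun x : EuclideanSpace ℝ (Fin n) => ∫ y, (⟪y, y - x⟫ / ‖y - x‖ ^ 2) * f y)
        (Filter.comap (fun x : EuclideanSpace ℝ (Fin n) => ‖x‖) Filter.atTop)
        (nhds 0) := by
  have hd : 4 ≤ Module.finrank ℝ (EuclideanSpace ℝ (Fin n)) := by
    rw [finrank_euclideanSpace_fin]; omega
  have h2 := limit2 hd hf hcont hradf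
  refine ⟨?_, h2⟩
  have h3 := (tendsto_const_nhds (x := ∫ y, f y)).sub h2 |>.const_mul (-(1 / cconst n))
  rw [sub_zero] at h3
  refine h3.congr fun x => ?_
  exact (final hd hf hcont u (1 / cconst n) C hu x).symm
end

section
/- Let n ≥ 3. For every x ∈ ℝⁿ and every s > 0 (including the cases x inside the ball B_s(0) and x on the sphere ∂B_s(0)), one has ∫_{∂B_s(0)} ∂log|x-y|/∂ν dσ(y) = (n-2)∫_{B_s(0)} 1/|x-y|² dy, where ν is the outward unit normal of ∂B_s(0) and dσ is the surface measure. -/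
open MeasureTheory Real Filter Metric
open scoped ENNReal Topology

/-- The surface measure on the unit sphere of `ℝ^n`, obtained from the polar decomposition of
the Lebesgue measure. -/
noncomputable def sphereMeasure (n : ℕ) :
    MeasureTheory.Measure (Metric.sphere (0 : EuclideanSpace ℝ (Fin n)) 1) :=
  (volume : MeasureTheory.Measure (EuclideanSpace ℝ (Fin n))).toSphere

/-- `ω_{n-1}`, the total surface measure of the unit sphere in `ℝ^n`. -/
noncomputable def omegaN (n : ℕ) : ℝ := (sphereMeasure n Set.univ).toReal

/-- The surface integral `∫_{∂B_s(0)} g dσ`, written in polar coordinates as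
`s^{n-1} ∫_{S^{n-1}} g(sθ) dθ`. -/
noncomputable def sphereIntegral (n : ℕ) (g : EuclideanSpace ℝ (Fin n) → ℝ) (s : ℝ) : ℝ :=
  s ^ (n - 1) * ∫ θ, g (s • (θ : EuclideanSpace ℝ (Fin n))) ∂(sphereMeasure n)

/-- The spherical average `⨍_{∂B_s(0)} g dσ = (1/ω_{n-1}) ∫_{S^{n-1}} g(sθ) dθ`. -/
noncomputable def sphereAvg (n : ℕ) (g : EuclideanSpace ℝ (Fin n) → ℝ) (s : ℝ) : ℝ :=
  (∫ θ, g (s • (θ : EuclideanSpace ℝ (Fin n))) ∂(sphereMeasure n)) / omegaN n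


lemma polar_aux (n : ℕ) (f : EuclideanSpace ℝ (Fin n) → ℝ) (hn : 3 ≤ n) (hf : Integrable f) :
    ∫ y, f y = ∫ r in Set.Ioi (0:ℝ), r ^ (n-1) *
      ∫ θ, f (r • (θ : EuclideanSpace ℝ (Fin n))) ∂(sphereMeasure n) := by
  have hdim : Module.finrank ℝ (EuclideanSpace ℝ (Fin n)) = n := by simp
  have : Nonempty (Fin n) := ⟨⟨0, by omega⟩⟩
  have hmp := (volume : Measure (EuclideanSpace ℝ (Fin n))).measurePreserving_homeomorphUnitSphereProd
  have hme := (homeomorphUnitSphereProd (EuclideanSpace ℝ (Fin n))).measurableEmbedding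
  rw [hdim] at hmp
  let g : (sphere (0 : EuclideanSpace ℝ (Fin n)) 1) × Set.Ioi (0:ℝ) → ℝ :=
    fun p => f (p.2.1 • p.1.1)
  have hg : ∀ y : ({0}ᶜ : Set (EuclideanSpace ℝ (Fin n))),
      g (homeomorphUnitSphereProd _ y) = f y := by
    intro y
    have h := congrArg Subtype.val
      ((homeomorphUnitSphereProd (EuclideanSpace ℝ (Fin n))).symm_apply_apply y)
    simp only [g]
    conv_rhs => rw [← h]
    rfl
  have hint : Integrable g ((sphereMeasure n).prod (Measure.volumeIoiPow (n-1))) := by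
    have := (hmp.integrable_comp_emb hme (g := g)).1
    apply this
    have h2 : g ∘ homeomorphUnitSphereProd (EuclideanSpace ℝ (Fin n)) = f ∘ Subtype.val := by
      funext y; exact hg y
    rw [h2, ← integrableOn_iff_comap_subtypeVal (by measurability)]
    exact hf.integrableOn
  calc ∫ y, f y = ∫ y : ({(0)}ᶜ : Set (EuclideanSpace ℝ (Fin n))), f y.1 ∂(Measure.comap Subtype.val volume) := by
        rw [integral_subtype_comap (measurableSet_singleton _).compl f,
          restrict_compl_singleton]
    _ = ∫ p, g p ∂((sphereMeasure n).prod (Measure.volumeIoiPow (n-1))) := by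
        rw [sphereMeasure, ← hmp.integral_comp hme g]
        simp_rw [hg]
    _ = ∫ r : Set.Ioi (0:ℝ), ∫ θ, g (θ, r) ∂(sphereMeasure n) ∂(Measure.volumeIoiPow (n-1)) := by
        have : SFinite (sphereMeasure n) := by unfold sphereMeasure; infer_instance
        exact integral_prod_symm g hint
    _ = _ := by
        simp only [Measure.volumeIoiPow, ENNReal.ofReal]
        rw [integral_withDensity_eq_integral_smul
          (measurable_subtype_coe.pow_const _).real_toNNReal]
        simp only [g]
        rw [integral_subtype_comap measurableSet_Ioi fun a ↦ Real.toNNReal (a ^ (n - 1)) •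
          ∫ θ, f (a • (θ : EuclideanSpace ℝ (Fin n))) ∂(sphereMeasure n),
          setIntegral_congr_fun measurableSet_Ioi fun x hx ↦ ?_]
        rw [NNReal.smul_def, Real.coe_toNNReal _ (pow_nonneg (le_of_lt hx) _)]
        rfl

lemma polar_ball (n : ℕ) (g : EuclideanSpace ℝ (Fin n) → ℝ) (hn : 3 ≤ n) (hg : Continuous g)
    (s : ℝ) (hs : 0 < s) :
    ∫ y in ball (0 : EuclideanSpace ℝ (Fin n)) s, g y = ∫ r in (0:ℝ)..s, r ^ (n-1) *
      ∫ θ, g (r • (θ : EuclideanSpace ℝ (Fin n))) ∂(sphereMeasure n) := by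
  have hI : IntegrableOn g (ball 0 s) :=
    (hg.continuousOn.integrableOn_compact (isCompact_closedBall 0 s)).mono_set
      ball_subset_closedBall
  rw [← integral_indicator measurableSet_ball, polar_aux n _ hn
    ((integrable_indicator_iff measurableSet_ball).2 hI),
    intervalIntegral.integral_of_le hs.le, integral_Ioc_eq_integral_Ioo,
    ← integral_indicator measurableSet_Ioi, ← integral_indicator measurableSet_Ioo]
  congr 1
  funext r
  by_cases hr : 0 < r
  · have hmem : ∀ θ : sphere (0 : EuclideanSpace ℝ (Fin n)) 1,
        (r • (θ : EuclideanSpace ℝ (Fin n)) ∈ ball (0 : EuclideanSpace ℝ (Fin n)) s) ↔ r < s := by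
      intro θ
      simp [norm_smul, abs_of_pos hr]
    by_cases hrs : r < s
    · simp [Set.indicator, hr, hrs, hmem]
    · simp [Set.indicator, hr, hrs, hmem]
  · simp [Set.indicator, hr]

lemma hasDerivAt_max_sq (t : ℝ) : HasDerivAt (fun t : ℝ => (max t 0)^2) (2 * max t 0) t := by
  rcases lt_trichotomy t 0 with h | h | h
  · have : (fun t : ℝ => (max t 0)^2) =ᶠ[𝓝 t] fun _ => 0 := by
      filter_upwards [Iio_mem_nhds h] with u hu
      simp [max_eq_right (le_of_lt (by simpa using hu))]
    rw [max_eq_right h.le]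
    simpa using (hasDerivAt_const t (0:ℝ)).congr_of_eventuallyEq this
  · subst h
    rw [hasDerivAt_iff_isLittleO]
    simp only [max_self, mul_zero, smul_zero, sub_zero]
    have h1 : (fun x : ℝ => x^2) =o[𝓝 0] fun x => x := by
      simpa using (Asymptotics.isLittleO_pow_pow (𝕜 := ℝ) (m := 1) (n := 2) (by norm_num))
    refine Asymptotics.IsBigO.trans_isLittleO ?_ h1
    apply Asymptotics.IsBigO.of_norm_le
    intro x
    rcases le_total x 0 with h | h
    · simp [max_eq_right h]; positivity
    · simp [max_eq_left h]
  · have : (fun t : ℝ => (max t 0)^2) =ᶠ[𝓝 t] fun u => u^2 := by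
      filter_upwards [Ioi_mem_nhds h] with u hu
      simp [max_eq_left (le_of_lt (by simpa using hu))]
    rw [max_eq_left h.le]
    simpa using (hasDerivAt_pow 2 t).congr_of_eventuallyEq this


lemma ibp_ball (n : ℕ) (V : Fin n → EuclideanSpace ℝ (Fin n) → ℝ)
    (hV : ∀ i, ContDiff ℝ 1 (V i)) (s : ℝ) (hs : 0 < s) :
    ∫ y in ball (0 : EuclideanSpace ℝ (Fin n)) s,
      (s^2 - ‖y‖^2)^2 * ∑ i, fderiv ℝ (V i) y (EuclideanSpace.single i 1)
    = 4 * ∫ y in ball (0 : EuclideanSpace ℝ (Fin n)) s, (s^2 - ‖y‖^2) * ∑ i, y i * V i y := by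
  let ψ : EuclideanSpace ℝ (Fin n) → ℝ := fun y => max (s^2 - ‖y‖^2) 0
  let φ : EuclideanSpace ℝ (Fin n) → ℝ := fun y => (ψ y)^2
  have hψin : ∀ y ∈ ball (0 : EuclideanSpace ℝ (Fin n)) s, ψ y = s^2 - ‖y‖^2 := by
    intro y hy
    have : ‖y‖ < s := by simpa using hy
    apply max_eq_left
    nlinarith [norm_nonneg y]
  have hψout : ∀ y ∉ ball (0 : EuclideanSpace ℝ (Fin n)) s, ψ y = 0 := by
    intro y hy
    have : s ≤ ‖y‖ := by simpa using hy
    apply max_eq_right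
    nlinarith [norm_nonneg y]
  have hψc : Continuous ψ := by fun_prop
  have hφc : Continuous φ := hψc.pow 2
  have hψs : HasCompactSupport ψ := by
    apply HasCompactSupport.intro (isCompact_closedBall (0 : EuclideanSpace ℝ (Fin n)) s)
    intro y hy
    exact hψout y (fun h => hy (ball_subset_closedBall h))
  have hφs : HasCompactSupport φ := by
    apply HasCompactSupport.intro (isCompact_closedBall (0 : EuclideanSpace ℝ (Fin n)) s)
    intro y hy
    simp [φ, hψout y (fun h => hy (ball_subset_closedBall h))]
  have hφd : ∀ y, HasFDerivAt φ ((2 * ψ y) • (-(2 • innerSL ℝ y) : EuclideanSpace ℝ (Fin n) →L[ℝ] ℝ)) y := by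
    intro y
    have h1 : HasFDerivAt (fun y : EuclideanSpace ℝ (Fin n) => s^2 - ‖y‖^2)
        (-(2 • innerSL ℝ y) : EuclideanSpace ℝ (Fin n) →L[ℝ] ℝ) y :=
      (hasStrictFDerivAt_norm_sq y).hasFDerivAt.const_sub (s^2)
    exact (hasDerivAt_max_sq (s^2 - ‖y‖^2)).comp_hasFDerivAt y h1
  have hφd' : ∀ y i, fderiv ℝ φ y (EuclideanSpace.single i 1) = -4 * ψ y * y i := by
    intro y i
    rw [(hφd y).fderiv]
    simp [EuclideanSpace.inner_single_right]
    ring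
  have hVc : ∀ i, Continuous (V i) := fun i => (hV i).continuous
  have hVd : ∀ i, Continuous (fun y => fderiv ℝ (V i) y (EuclideanSpace.single i 1)) := by
    intro i
    exact ((hV i).continuous_fderiv (by norm_num)).clm_apply continuous_const
  have hI1 : ∀ i, Integrable
      (fun y => φ y * fderiv ℝ (V i) y (EuclideanSpace.single i 1)) := fun i =>
    (hφc.mul (hVd i)).integrable_of_hasCompactSupport hφs.mul_right
  have hI2 : ∀ i, Integrable (fun y => ψ y * (y i * V i y)) := fun i =>
    (hψc.mul (Continuous.mul (by fun_prop) (hVc i))).integrable_of_hasCompactSupport hψs.mul_right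
  have hibp : ∀ i, ∫ y, φ y * fderiv ℝ (V i) y (EuclideanSpace.single i 1)
      = 4 * ∫ y, ψ y * (y i * V i y) := by
    intro i
    have hfun : (fun y => fderiv ℝ φ y (EuclideanSpace.single i 1) * V i y)
        = fun y => (-4) * (ψ y * (y i * V i y)) := by
      funext y; rw [hφd']; ring
    rw [integral_mul_fderiv_eq_neg_fderiv_mul_of_integrable]
    · rw [hfun, integral_const_mul]; ring
    · rw [hfun]; exact (hI2 i).const_mul _
    · exact hI1 i
    · exact (hφc.mul (hVc i)).integrable_of_hasCompactSupport hφs.mul_right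
    · intro y _; exact (hφd y).differentiableAt
    · intro y _; exact (hV i).differentiable (by norm_num) y
  rw [← integral_indicator measurableSet_ball, ← integral_indicator measurableSet_ball]
  have e1 : ((ball (0 : EuclideanSpace ℝ (Fin n)) s).indicator fun y =>
      (s^2 - ‖y‖^2)^2 * ∑ i, fderiv ℝ (V i) y (EuclideanSpace.single i 1))
      = fun y => ∑ i, φ y * fderiv ℝ (V i) y (EuclideanSpace.single i 1) := by
    funext y
    rw [← Finset.mul_sum]
    by_cases hy : y ∈ ball (0 : EuclideanSpace ℝ (Fin n)) s
    · rw [Set.indicator_of_mem hy]; simp only [φ]; rw [hψin y hy]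
    · rw [Set.indicator_of_notMem hy]; simp only [φ]; rw [hψout y hy]; simp
  have e2 : ((ball (0 : EuclideanSpace ℝ (Fin n)) s).indicator fun y =>
      (s^2 - ‖y‖^2) * ∑ i, y i * V i y)
      = fun y => ∑ i, ψ y * (y i * V i y) := by
    funext y
    rw [← Finset.mul_sum]
    by_cases hy : y ∈ ball (0 : EuclideanSpace ℝ (Fin n)) s
    · rw [Set.indicator_of_mem hy]; rw [hψin y hy]
    · rw [Set.indicator_of_notMem hy]; rw [hψout y hy]; simp
  rw [e1, e2, integral_finsetSum _ (fun i _ => hI1 i), integral_finsetSum _ (fun i _ => hI2 i),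
    Finset.mul_sum]
  exact Finset.sum_congr rfl (fun i _ => hibp i)

lemma cont_sph (n : ℕ) (g : EuclideanSpace ℝ (Fin n) → ℝ) (hg : Continuous g) :
    Continuous (fun r : ℝ => r ^ (n-1) *
      ∫ θ, g (r • (θ : EuclideanSpace ℝ (Fin n))) ∂(sphereMeasure n)) := by
  have : IsFiniteMeasure (sphereMeasure n) := by unfold sphereMeasure; infer_instance
  have h := continuous_parametric_integral_of_continuous (μ := sphereMeasure n)
    (f := fun (r : ℝ) (θ : sphere (0 : EuclideanSpace ℝ (Fin n)) 1) => g (r • θ.1))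
    (by
      apply hg.comp
      fun_prop) isCompact_univ
  simp only [Measure.restrict_univ] at h
  exact (continuous_pow _).mul h

lemma real_aux (d G : ℝ → ℝ) (hd : Continuous d) (hG : Continuous G)
    (h : ∀ s : ℝ, 0 < s → ∫ r in (0:ℝ)..s, (s^2 - r^2)^2 * d r
      = 4 * ∫ r in (0:ℝ)..s, (s^2 - r^2) * G r) (s : ℝ) (hs : 0 < s) :
    G s = s * ∫ r in (0:ℝ)..s, d r := by
  have key : ∀ f : ℝ → ℝ, Continuous f → ∀ s, HasDerivAt (fun s => ∫ r in (0:ℝ)..s, f r) (f s) s :=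
    fun f hf s => intervalIntegral.integral_hasDerivAt_right (hf.intervalIntegrable _ _)
      (hf.stronglyMeasurableAtFilter _ _) hf.continuousAt
  set A0 : ℝ → ℝ := fun s => ∫ r in (0:ℝ)..s, d r with hA0
  set A2 : ℝ → ℝ := fun s => ∫ r in (0:ℝ)..s, r^2 * d r with hA2
  set A4 : ℝ → ℝ := fun s => ∫ r in (0:ℝ)..s, r^4 * d r with hA4
  set B0 : ℝ → ℝ := fun s => ∫ r in (0:ℝ)..s, G r with hB0
  set B2 : ℝ → ℝ := fun s => ∫ r in (0:ℝ)..s, r^2 * G r with hB2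
  have dA0 := key d hd
  have dA2 := key (fun r => r^2 * d r) (by fun_prop)
  have dA4 := key (fun r => r^4 * d r) (by fun_prop)
  have dB0 := key G hG
  have dB2 := key (fun r => r^2 * G r) (by fun_prop)
  have h1 : ∀ s : ℝ, 0 < s →
      s^4 * A0 s - 2 * s^2 * A2 s + A4 s = 4 * (s^2 * B0 s - B2 s) := by
    intro s hs
    have e1 : ∫ r in (0:ℝ)..s, (s^2 - r^2)^2 * d r = s^4 * A0 s - 2 * s^2 * A2 s + A4 s := by
      simp only [hA0, hA2, hA4]
      rw [← intervalIntegral.integral_const_mul, ← intervalIntegral.integral_const_mul,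
        ← intervalIntegral.integral_sub, ← intervalIntegral.integral_add]
      · congr 1; funext r; ring
      all_goals exact Continuous.intervalIntegrable (by fun_prop) _ _
    have e2 : ∫ r in (0:ℝ)..s, (s^2 - r^2) * G r = s^2 * B0 s - B2 s := by
      simp only [hB0, hB2]
      rw [← intervalIntegral.integral_const_mul, ← intervalIntegral.integral_sub]
      · congr 1; funext r; ring
      all_goals exact Continuous.intervalIntegrable (by fun_prop) _ _
    rw [← e1, ← e2]; exact h s hs
  have h2 : ∀ s : ℝ, 0 < s → s^2 * A0 s - A2 s = 2 * B0 s := by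
    intro s hs
    have l := (((hasDerivAt_pow 4 s).mul (dA0 s)).sub
      (((hasDerivAt_pow 2 s).const_mul 2).mul (dA2 s))).add (dA4 s)
    have r := (((hasDerivAt_pow 2 s).mul (dB0 s)).sub (dB2 s)).const_mul 4
    have e := l.unique (r.congr_of_eventuallyEq (by
      filter_upwards [Ioi_mem_nhds hs] with u hu
      simpa using h1 u hu))
    have : 4 * s * (s^2 * A0 s - A2 s - 2 * B0 s) = 0 := by
      simp only [hA0, hA2, hB0]
      norm_num at e
      linear_combination e
    have := (mul_eq_zero.1 this).resolve_left (by positivity)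
    linarith
  have l := ((hasDerivAt_pow 2 s).mul (dA0 s)).sub (dA2 s)
  have r := (dB0 s).const_mul 2
  have e := l.unique (r.congr_of_eventuallyEq (by
      filter_upwards [Ioi_mem_nhds hs] with u hu
      simpa using h2 u hu))
  norm_num at e
  linear_combination (-1/2) * e

lemma divthm_ball (n : ℕ) (hn : 3 ≤ n) (V : Fin n → EuclideanSpace ℝ (Fin n) → ℝ)
    (hV : ∀ i, ContDiff ℝ 1 (V i)) (s : ℝ) (hs : 0 < s) :
    s ^ (n-1) * ∫ θ, (fun y => ∑ i, y i * V i y) (s • (θ : EuclideanSpace ℝ (Fin n)))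
        ∂(sphereMeasure n) =
      s * ∫ y in ball (0 : EuclideanSpace ℝ (Fin n)) s,
        ∑ i, fderiv ℝ (V i) y (EuclideanSpace.single i 1) := by
  have hVc : ∀ i, Continuous (V i) := fun i => (hV i).continuous
  have hD : Continuous (fun y => ∑ i, fderiv ℝ (V i) y (EuclideanSpace.single i 1)) :=
    continuous_finsetSum _ fun i _ =>
      ((hV i).continuous_fderiv (by norm_num)).clm_apply continuous_const
  have hF : Continuous (fun y : EuclideanSpace ℝ (Fin n) => ∑ i, y i * V i y) :=
    continuous_finsetSum _ fun i _ => Continuous.mul (by fun_prop) (hVc i)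
  rw [polar_ball n _ hn hD s hs]
  refine real_aux _ _ (cont_sph n _ hD) (cont_sph n _ hF) ?_ s hs
  intro s hs
  have := ibp_ball n V hV s hs
  rw [polar_ball n (fun y => (s^2 - ‖y‖^2)^2 *
      ∑ i, fderiv ℝ (V i) y (EuclideanSpace.single i 1)) hn (Continuous.mul (by fun_prop) hD) s hs,
    polar_ball n (fun y => (s^2 - ‖y‖^2) * ∑ i, y i * V i y) hn
      (Continuous.mul (by fun_prop) hF) s hs] at this
  simp only [norm_smul, norm_eq_of_mem_sphere, mul_one, Real.norm_eq_abs, sq_abs,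
    integral_const_mul] at this
  simpa only [mul_left_comm] using this

lemma int_inv_sq (n : ℕ) (hn : 3 ≤ n) (x : EuclideanSpace ℝ (Fin n)) (s : ℝ) :
    IntegrableOn (fun y => 1 / ‖y - x‖^2) (ball (0 : EuclideanSpace ℝ (Fin n)) s) := by
  have h : IntegrableOn (fun z : EuclideanSpace ℝ (Fin n) => 1 / ‖z‖^2) (ball 0 (s + ‖x‖)) := by
    refine integrableOn_ball_of_norm_le_rpow (C := 1) (α := 2) ?_ ?_ ?_ ?_
    · rw [finrank_euclideanSpace_fin]; omega
    · rw [finrank_euclideanSpace_fin]; exact_mod_cast (by omega : 2 < n)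
    · refine ae_of_all _ fun z => ?_
      rw [Real.rpow_neg (norm_nonneg z)]
      simp
    · exact (Measurable.aestronglyMeasurable (by fun_prop))
  have h2 := ((integrable_indicator_iff measurableSet_ball).2 h).comp_sub_right x
  refine h2.integrableOn.congr_fun (s := ball 0 s) ?_ measurableSet_ball
  intro y hy
  have hy' : ‖y‖ < s := by simpa using hy
  have : y - x ∈ ball (0 : EuclideanSpace ℝ (Fin n)) (s + ‖x‖) := by
    simp only [mem_ball_zero_iff]
    linarith [norm_sub_le y x]
  simp only [Set.indicator_of_mem this]

open scoped RealInnerProductSpace in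
lemma reg_identity (n : ℕ) (hn : 3 ≤ n) (x : EuclideanSpace ℝ (Fin n)) (s : ℝ) (hs : 0 < s)
    (ε : ℝ) (hε : 0 < ε) :
    s ^ (n-1) * ∫ θ, (fun y => ⟪y, y - x⟫ / (‖y - x‖ ^ 2 + ε))
        (s • (θ : EuclideanSpace ℝ (Fin n))) ∂(sphereMeasure n) =
      s * ∫ y in ball (0 : EuclideanSpace ℝ (Fin n)) s,
        (n / (‖y - x‖ ^ 2 + ε) - 2 * ‖y - x‖ ^ 2 / (‖y - x‖ ^ 2 + ε)^2) := by
  have hq : ∀ y : EuclideanSpace ℝ (Fin n), ‖y - x‖ ^ 2 + ε ≠ 0 := fun y => by positivity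
  have hsum : ∀ z : EuclideanSpace ℝ (Fin n), ∑ i, z i * z i = ‖z‖^2 := by
    intro z
    rw [EuclideanSpace.norm_sq_eq]
    exact Finset.sum_congr rfl fun i _ => by rw [Real.norm_eq_abs, sq_abs]; ring
  let V : Fin n → EuclideanSpace ℝ (Fin n) → ℝ := fun i y => (y i - x i) / (‖y - x‖ ^ 2 + ε)
  have hV : ∀ i, ContDiff ℝ 1 (V i) := by
    intro i
    apply ContDiff.div
    · fun_prop
    · exact ((contDiff_id.sub contDiff_const).norm_sq ℝ).add contDiff_const
    · exact hq
  have hfd : ∀ i y, fderiv ℝ (V i) y (EuclideanSpace.single i 1)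
      = 1 / (‖y - x‖ ^ 2 + ε) - 2 * ((y - x) i * (y - x) i) / (‖y - x‖ ^ 2 + ε)^2 := by
    intro i y
    have hd : DifferentiableAt ℝ (V i) y := (hV i).differentiable (by norm_num) y
    have hl : HasDerivAt (fun t : ℝ => y + t • EuclideanSpace.single i (1:ℝ))
        (EuclideanSpace.single i (1:ℝ)) 0 := by
      simpa using ((hasDerivAt_id (0:ℝ)).smul_const (EuclideanSpace.single i (1:ℝ))).const_add y
    have h1 : HasDerivAt (fun t : ℝ => V i (y + t • EuclideanSpace.single i (1:ℝ)))
        (fderiv ℝ (V i) y (EuclideanSpace.single i 1)) 0 := by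
      have hd' : HasFDerivAt (V i) (fderiv ℝ (V i) y)
        (y + (0:ℝ) • EuclideanSpace.single i (1:ℝ)) := by simpa using hd.hasFDerivAt
      exact hd'.comp_hasDerivAt 0 hl
    have hform : ∀ t : ℝ, V i (y + t • EuclideanSpace.single i (1:ℝ))
        = ((y - x) i + t) / (‖y - x‖^2 + 2 * (y - x) i * t + t^2 + ε) := by
      intro t
      have : ‖y + t • EuclideanSpace.single i (1:ℝ) - x‖^2
          = ‖y - x‖^2 + 2 * (y - x) i * t + t^2 := by
        rw [add_sub_right_comm, norm_add_sq_real]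
        simp [norm_smul, inner_smul_right, EuclideanSpace.inner_single_right]
        ring
      simp only [V]
      rw [this]
      simp
      ring
    have hn1 : HasDerivAt (fun t : ℝ => (y - x) i + t) 1 0 := by
      simpa using (hasDerivAt_id (0:ℝ)).const_add ((y - x) i)
    have hn2 : HasDerivAt (fun t : ℝ => ‖y - x‖^2 + 2 * (y - x) i * t + t^2 + ε)
        (2 * (y - x) i) 0 := by
      have := (((((hasDerivAt_id (0:ℝ)).const_mul (2 * (y - x) i)).const_add (‖y-x‖^2)).add
        (hasDerivAt_pow 2 (0:ℝ))).add_const ε)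
      simpa using this
    have h2 := hn1.div hn2 (by simpa using hq y)
    have h3 := h1.unique (h2.congr_of_eventuallyEq (Eventually.of_forall hform))
    rw [h3]
    have := hq y
    simp only [mul_zero, add_zero, one_mul, zero_pow, ne_eq, OfNat.ofNat_ne_zero,
      not_false_eq_true]
    field_simp
  have key := divthm_ball n hn V hV s hs
  have e1 : (fun y : EuclideanSpace ℝ (Fin n) => ∑ i, y i * V i y)
      = fun y => ⟪y, y - x⟫ / (‖y - x‖ ^ 2 + ε) := by
    funext y
    simp only [V, PiLp.inner_apply]
    rw [Finset.sum_div]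
    refine Finset.sum_congr rfl fun i _ => ?_
    simp
    ring
  have e2 : (fun y : EuclideanSpace ℝ (Fin n) =>
      ∑ i, fderiv ℝ (V i) y (EuclideanSpace.single i 1))
      = fun y => (n / (‖y - x‖ ^ 2 + ε) - 2 * ‖y - x‖ ^ 2 / (‖y - x‖ ^ 2 + ε)^2) := by
    funext y
    simp_rw [hfd]
    rw [Finset.sum_sub_distrib, ← Finset.sum_div, ← Finset.sum_div, ← Finset.mul_sum, hsum]
    simp
  rw [e1, e2] at key
  exact key

open scoped RealInnerProductSpace in
lemma sph_bound (n : ℕ) (x : EuclideanSpace ℝ (Fin n)) (s : ℝ) :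
    ∃ C : ℝ, 0 ≤ C ∧ ∀ y : EuclideanSpace ℝ (Fin n), ‖y‖ = s →
      |⟪y, y - x⟫| ≤ C * ‖y - x‖^2 := by
  by_cases hx : ‖x‖ = s
  · refine ⟨1/2, by norm_num, fun y hy => ?_⟩
    have h1 : ⟪y, y - x⟫ = 1/2 * ‖y - x‖^2 := by
      rw [norm_sub_sq_real, inner_sub_right, real_inner_self_eq_norm_sq, hx, hy]
      ring
    rw [h1, abs_of_nonneg (by positivity)]
  · have hpos : 0 < |s - ‖x‖| := abs_pos.2 (sub_ne_zero.2 (Ne.symm hx))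
    refine ⟨|s| / |s - ‖x‖|, by positivity, fun y hy => ?_⟩
    have h1 : |⟪y, y - x⟫| ≤ ‖y‖ * ‖y - x‖ := abs_real_inner_le_norm _ _
    have h2 : |s - ‖x‖| ≤ ‖y - x‖ := by rw [← hy]; exact abs_norm_sub_norm_le y x
    have h3 : ‖y‖ = |s| := by rw [← hy, abs_norm]
    rw [div_mul_eq_mul_div, le_div_iff₀ hpos]
    rw [h3] at h1
    calc _ ≤ (|s| * ‖y - x‖) * ‖y - x‖ := by gcongr
      _ = _ := by ring

lemma tendsto_reg (a p : ℝ) (hp : p = 0 → a = 0) (h0 : 0 ≤ p) :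
    Tendsto (fun ε : ℝ => a / (p + ε)) (𝓝[>] 0) (𝓝 (a / p)) := by
  by_cases h : p = 0
  · simp [hp h]
  · have : ContinuousAt (fun ε : ℝ => a / (p + ε)) 0 :=
      ContinuousAt.div (by fun_prop) (by fun_prop) (by simpa using h)
    simpa using this.tendsto.mono_left nhdsWithin_le_nhds

open scoped RealInnerProductSpace in
/-- For every `x ∈ ℝⁿ` and `s > 0`,
`∫_{∂B_s(0)} ∂(log|x-y|)/∂ν dσ(y) = (n-2) ∫_{B_s(0)} |x-y|⁻² dy`, where
`∂(log|x-y|)/∂ν = (y·(y-x))/(|y| |y-x|²)`. -/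
theorem stmt9 (n : ℕ) (hn : 3 ≤ n) (x : EuclideanSpace ℝ (Fin n)) (s : ℝ) (hs : 0 < s) :
    sphereIntegral n (fun y => ⟪y, y - x⟫ / (‖y‖ * ‖y - x‖ ^ 2)) s
      = (n - 2) * ∫ y in Metric.ball (0 : EuclideanSpace ℝ (Fin n)) s, 1 / ‖x - y‖ ^ 2 := by
  have : IsFiniteMeasure (sphereMeasure n) := by unfold sphereMeasure; infer_instance
  have : Nonempty (Fin n) := ⟨⟨0, by omega⟩⟩
  have hnorm : ∀ θ : sphere (0 : EuclideanSpace ℝ (Fin n)) 1,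
      ‖s • (θ : EuclideanSpace ℝ (Fin n))‖ = s := by
    intro θ; simp [norm_smul, abs_of_pos hs]
  obtain ⟨C, hC0, hC⟩ := sph_bound n x s
  -- limit on the sphere
  have hL : Tendsto (fun ε : ℝ => s ^ (n-1) * ∫ θ, (fun y => ⟪y, y - x⟫ / (‖y - x‖ ^ 2 + ε))
        (s • (θ : EuclideanSpace ℝ (Fin n))) ∂(sphereMeasure n)) (𝓝[>] 0)
      (𝓝 (s ^ (n-1) * ∫ θ, (fun y => ⟪y, y - x⟫ / (‖y - x‖ ^ 2))
        (s • (θ : EuclideanSpace ℝ (Fin n))) ∂(sphereMeasure n))) := by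
    apply Tendsto.const_mul
    apply tendsto_integral_filter_of_dominated_convergence (fun _ => C)
    · filter_upwards [self_mem_nhdsWithin] with ε hε
      have hε' : 0 < ε := hε
      apply Continuous.aestronglyMeasurable
      apply Continuous.div (by fun_prop) (by fun_prop)
      intro θ
      positivity
    · filter_upwards [self_mem_nhdsWithin] with ε hε
      have hε' : 0 < ε := hε
      refine ae_of_all _ fun θ => ?_
      rw [Real.norm_eq_abs, abs_div, abs_of_pos (show 0 <
        ‖s • (θ : EuclideanSpace ℝ (Fin n)) - x‖ ^ 2 + ε by positivity), div_le_iff₀ (by positivity)]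
      refine (hC _ (hnorm θ)).trans ?_
      gcongr
      linarith
    · exact integrable_const C
    · refine ae_of_all _ fun θ => ?_
      apply tendsto_reg _ _ _ (by positivity)
      intro h
      have : s • (θ : EuclideanSpace ℝ (Fin n)) - x = 0 := by simpa using h
      rw [this]; simp
  -- limit on the ball
  have hR : Tendsto (fun ε : ℝ => s * ∫ y in ball (0 : EuclideanSpace ℝ (Fin n)) s,
        (n / (‖y - x‖ ^ 2 + ε) - 2 * ‖y - x‖ ^ 2 / (‖y - x‖ ^ 2 + ε)^2)) (𝓝[>] 0)
      (𝓝 (s * ∫ y in ball (0 : EuclideanSpace ℝ (Fin n)) s, (n - 2) * (1 / ‖y - x‖ ^ 2))) := by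
    apply Tendsto.const_mul
    have hne : ∀ᵐ y ∂(volume.restrict (ball (0 : EuclideanSpace ℝ (Fin n)) s)), y ≠ x :=
      ae_restrict_of_ae (by simp [ae_iff])
    apply tendsto_integral_filter_of_dominated_convergence
      (fun y => ((n:ℝ) + 2) * (1 / ‖y - x‖ ^ 2))
    · exact Eventually.of_forall fun ε => Measurable.aestronglyMeasurable (by fun_prop)
    · filter_upwards [self_mem_nhdsWithin] with ε hε
      have hε' : 0 < ε := hε
      filter_upwards [hne] with y hy
      have hp : 0 < ‖y - x‖ ^ 2 := by
        have := norm_pos_iff.2 (sub_ne_zero.2 hy)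
        positivity
      set p := ‖y - x‖ ^ 2
      have h1 : (n:ℝ) / (p + ε) ≤ n / p := by gcongr; linarith
      have h2 : 2 * p / (p + ε)^2 ≤ 2 / p := by
        rw [div_le_div_iff₀ (by positivity) hp]
        nlinarith [mul_pos hp hε', sq_nonneg ε]
      have h3 : 0 ≤ (n:ℝ) / (p + ε) := by positivity
      have h4 : 0 ≤ 2 * p / (p + ε)^2 := by positivity
      have h5 : ((n:ℝ) + 2) * (1 / p) = n / p + 2 / p := by ring
      have h6 : 0 ≤ (n:ℝ) / p := by positivity
      have h7 : 0 ≤ 2 / p := by positivity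
      rw [h5, Real.norm_eq_abs, abs_le]
      constructor <;> linarith
    · exact (int_inv_sq n hn x s).const_mul _
    · filter_upwards [hne] with y hy
      have hp : 0 < ‖y - x‖ ^ 2 := by
        have := norm_pos_iff.2 (sub_ne_zero.2 hy)
        positivity
      set p := ‖y - x‖ ^ 2
      have hc : ContinuousAt (fun ε : ℝ => n / (p + ε) - 2 * p / (p + ε)^2) 0 :=
        ContinuousAt.sub (ContinuousAt.div (by fun_prop) (by fun_prop) (by simpa using hp.ne'))
          (ContinuousAt.div (by fun_prop) (by fun_prop) (by simpa using hp.ne'))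
      have hv : ((n:ℝ) - 2) * (1 / p) = n / (p + 0) - 2 * p / (p + 0)^2 := by
        rw [add_zero]; field_simp
      rw [hv]
      exact hc.tendsto.mono_left nhdsWithin_le_nhds
  have hlim := tendsto_nhds_unique (hL.congr' (by
    filter_upwards [self_mem_nhdsWithin] with ε hε
    exact reg_identity n hn x s hs ε hε)) hR
  rw [integral_const_mul] at hlim
  have hfin : sphereIntegral n (fun y => ⟪y, y - x⟫ / (‖y‖ * ‖y - x‖ ^ 2)) s
      = s⁻¹ * (s ^ (n-1) * ∫ θ, (fun y => ⟪y, y - x⟫ / (‖y - x‖ ^ 2))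
        (s • (θ : EuclideanSpace ℝ (Fin n))) ∂(sphereMeasure n)) := by
    unfold sphereIntegral
    rw [mul_left_comm s⁻¹, ← integral_const_mul s⁻¹]
    congr 2
    funext θ
    simp only [hnorm]
    rw [← div_div, div_right_comm]
    ring
  rw [hfin, hlim, inv_mul_cancel_left₀ hs.ne']
  simp_rw [norm_sub_rev x]
end
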